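/- For every lattice Λ in ℝ⁹ and every Minkowskian sublattice Λ' of Λ, one has [Λ : Λ'] ≤ 16; i.e. the maximal index ı(Λ) of any 9-dimensional well-rounded lattice is at most 16 (the same bound as in dimension 8, so the general bound ı(Λ) ≤ ⌊γ₉^{9/2}⌋ is strict in dimension 9). -/

import Mathlib

open scoped BigOperators RealInnerProductSpace

noncomputable section

/-- The minimum of a lattice `Λ` in `ℝⁿ`: the infimum of the squared Euclidean
lengths `N(x) = ⟪x, x⟫` of the nonzero vectors of `Λ`. -/
def latticeMin {n : ℕ} (Λ : Submodule ℤ (EuclideanSpace ℝ (Fin n))) : ℝ :=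
  sInf {r : ℝ | ∃ x ∈ Λ, x ≠ 0 ∧ ⟪x, x⟫ = r}

/-- The set of minimal vectors of a lattice `Λ`:
`S(Λ) = {x ∈ Λ : x ≠ 0, N(x) = min Λ}`. -/
def minimalVectors {n : ℕ} (Λ : Submodule ℤ (EuclideanSpace ℝ (Fin n))) :
    Set (EuclideanSpace ℝ (Fin n)) :=
  {x | x ∈ Λ ∧ x ≠ 0 ∧ ⟪x, x⟫ = latticeMin Λ}

/-- `Λ` is a (full-rank) lattice in `ℝⁿ`: a discrete subgroup that spans `ℝⁿ`. -/
def IsLattice {n : ℕ} (Λ : Submodule ℤ (EuclideanSpace ℝ (Fin n))) : Prop :=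
  DiscreteTopology Λ ∧ Submodule.span ℝ (Λ : Set (EuclideanSpace ℝ (Fin n))) = ⊤

/-- `Λ'` is a Minkowskian sublattice of `Λ`: it is generated by `n` linearly
independent minimal vectors of `Λ`. -/
def IsMinkowskian {n : ℕ} (Λ Λ' : Submodule ℤ (EuclideanSpace ℝ (Fin n))) : Prop :=
  ∃ e : Fin n → EuclideanSpace ℝ (Fin n),
    LinearIndependent ℝ e ∧ (∀ i, e i ∈ minimalVectors Λ) ∧
      Λ' = Submodule.span ℤ (Set.range e)

/-- The quotient group `Λ/Λ'`. -/
abbrev quotLat {n : ℕ} (Λ Λ' : Submodule ℤ (EuclideanSpace ℝ (Fin n))) : Type :=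
  Λ ⧸ (Submodule.comap Λ.subtype Λ')

/-- The index `[Λ : Λ']`. -/
def subIndex {n : ℕ} (Λ Λ' : Submodule ℤ (EuclideanSpace ℝ (Fin n))) : ℕ :=
  Nat.card (quotLat Λ Λ')

namespace LatticeIndex

/-- Evaluates its argument to a numeral before passing it on. -/
def force {β : Type} (n : ℕ) (k : ℕ → β) : β :=
  Nat.rec (motive := fun _ => β) (k 0) (fun m _ => k m) (Nat.add n 1)

theorem force_eq {β : Type} (n : ℕ) (k : ℕ → β) : force n k = k n := rfl

/-- Evaluates the entries of a list to numerals before passing it on. -/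
def forceList {β : Type} (l : List ℕ) : (List ℕ → β) → β :=
  List.rec (motive := fun _ => (List ℕ → β) → β) (fun k => k [])
    (fun x _ ih k => force x fun y => ih fun ys => k (y :: ys)) l

theorem forceList_eq {β : Type} (l : List ℕ) (k : List ℕ → β) : forceList l k = k l := by
  induction l generalizing k with
  | nil => rfl
  | cons x xs ih => exact ih _

/-- Evaluates the entries of a list of lists to numerals before passing it on. -/
def forceLists {β : Type} (l : List (List ℕ)) : (List (List ℕ) → β) → β :=
  List.rec (motive := fun _ => (List (List ℕ) → β) → β) (fun k => k [])
    (fun x _ ih k => forceList x fun y => ih fun ys => k (y :: ys)) l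

theorem forceLists_eq {β : Type} (l : List (List ℕ)) (k : List (List ℕ) → β) :
    forceLists l k = k l := by
  induction l generalizing k with
  | nil => rfl
  | cons x xs ih => exact (forceList_eq x _).trans (ih _)

/-- The (truncated) scalar product of two lists. -/
def dot : List ℕ → List ℕ → ℕ :=
  List.rec (fun _ => 0) fun a _ ih ys => List.rec 0 (fun b bs _ => Nat.add (Nat.mul a b) (ih bs)) ys

@[simp] theorem dot_nil_left (b : List ℕ) : dot [] b = 0 := rfl
@[simp] theorem dot_nil_right (a : List ℕ) : dot a [] = 0 := by cases a <;> rfl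
@[simp] theorem dot_cons (x y : ℕ) (a b : List ℕ) : dot (x :: a) (y :: b) = x * y + dot a b := rfl

/-- Boolean equality of lists of natural numbers. -/
def beqList : List ℕ → List ℕ → Bool
  | [], [] => true
  | a :: as, b :: bs => Nat.beq a b && beqList as bs
  | _, _ => false

/-- Boolean membership in a list of lists of natural numbers. -/
def memList (a : List ℕ) (l : List (List ℕ)) : Bool := l.any fun b => beqList a b

/-- The sum of a list. -/
def sumList (l : List ℕ) : ℕ := List.rec 0 (fun x _ ih => Nat.add x ih) l

/-- The largest weight of a character. -/
abbrev maxWeight : ℕ := 1099511627776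

/-- Half of the width of a packed entry. -/
abbrev laneBound : ℕ := 140737488355328

/-- A finite abelian group `∏ ℤ/nⱼ` of exponent `E`, together with a list `reps` of characters
(a character is given by the list of its values on the generators, in `ℤ/E`), a list `ks` of
nonzero elements and a list `us` of endomorphisms. -/
structure GroupData where
  ns : List ℕ
  E : ℕ
  reps : List (List ℕ)
  ks : List (List ℕ)
  us : List (List (List ℕ))

/-- Evaluates the group data to numerals before passing them on. -/
def GroupData.normalize {β : Type} (D : GroupData) (k : GroupData → β) : β :=
  forceList D.ns fun ns => force D.E fun E => forceLists D.reps fun reps =>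
    forceLists D.ks fun ks => k ⟨ns, E, reps, ks, D.us⟩

/-- The opposite of a character. -/
def negChar (E : ℕ) (b : List ℕ) : List ℕ := b.map fun x => Nat.mod (Nat.sub E x) E

/-- The action of an endomorphism on a character. -/
def act (E : ℕ) (U : List (List ℕ)) (b : List ℕ) : List ℕ :=
  U.map fun row => Nat.mod (dot row b) E

/-- The distance of the value of a character to the nearest multiple of `E`. -/
def dist (E : ℕ) (k b : List ℕ) : ℕ :=
  force (Nat.mod (dot k b) E) fun a => cond (Nat.ble a (Nat.sub E a)) a (Nat.sub E a)

/-- Weights `w, w / 2, w / 4, …` of the successive entries of a list. -/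
def weightFrom : List (List ℕ) → ℕ → List ℕ → ℕ
  | [], _, _ => 0
  | c :: cs, w, b => cond (beqList c b) w (weightFrom cs (Nat.div w 2) b)

/-- The larger of the weights of a character and of its opposite. -/
def absWeight (D : GroupData) (b : List ℕ) : ℕ :=
  (fun x y => cond (Nat.ble x y) y x) (weightFrom D.reps maxWeight b)
    (weightFrom D.reps maxWeight (negChar D.E b))

/-- The linear forms evaluated at a character. -/
def row (D : GroupData) (b : List ℕ) : List ℕ :=
  D.ks.map (fun k => dist D.E k b) ++
    D.us.map fun U => Nat.add (weightFrom D.reps maxWeight b)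
      (Nat.sub maxWeight (absWeight D (act D.E U b)))

/-- The lower bounds for the sums of the linear forms. -/
def threshold (D : GroupData) : List ℕ :=
  D.ks.map (fun _ => 2 * D.E) ++ D.us.map fun _ => 9 * maxWeight

/-- Packs a list of numbers into one number. -/
def pack : List ℕ → ℕ
  | [] => 0
  | x :: xs => Nat.add x (Nat.mul 281474976710656 (pack xs))

/-- The entrywise maximum of two lists. -/
def maxList : List ℕ → List ℕ → List ℕ
  | a :: as, b :: bs => cond (Nat.ble a b) b a :: maxList as bs
  | _, _ => []

/-- The packed rows and packed suffix maxima of the rows, for the characters in a list. -/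
def table {β : Type} (D : GroupData) :
    List (List ℕ) → (List (ℕ × ℕ × List ℕ) → List ℕ → β) → β
  | [], k => k [] ((threshold D).map fun _ => 0)
  | c :: cs, k => table D cs fun tab sup =>
      forceList (row D c) fun r => forceList (maxList sup r) fun s =>
        force (pack r) fun t => force (pack s) fun p => k ((t, p, c) :: tab) s

/-- The depth first search for the multisets of `rem` characters for which all sums of linear forms
can reach their thresholds. -/
def search (K M : ℕ) (cols : List (ℕ × ℕ × List ℕ)) :
    ℕ → ℕ → List (List ℕ) → List (List (List ℕ)) → List (List (List ℕ)) :=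
  List.rec (motive := fun _ =>
      ℕ → ℕ → List (List ℕ) → List (List (List ℕ)) → List (List (List ℕ)))
    (fun rem _ path acc => Nat.rec (path :: acc) (fun _ _ => acc) rem)
    (fun c _ ih rem => Prod.rec (fun t c => Prod.rec (fun p b => Nat.rec (motive := fun _ =>
        ℕ → List (List ℕ) → List (List (List ℕ)) → List (List (List ℕ)))
      (fun S path acc => cond (Nat.beq (Nat.land (Nat.add S K) M) M) (path :: acc) acc)
      (fun r ihr S path acc =>
        cond (Nat.beq (Nat.land (Nat.add S (Nat.add (Nat.mul (Nat.succ r) p) K)) M) M)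
          (ihr (Nat.add S t) (b :: path) (ih (Nat.succ r) S path acc))
          acc) rem) c) c) cols

/-- Decodes a list of pairs of an element of `ks` and a bit mask. -/
def decode {β : Type} (ks : List (List ℕ)) : ℕ → ℕ → (List (List ℕ × ℕ) → β) → β
  | 0, _, f => f []
  | n + 1, c, f => cond (Nat.beq c 0) (f [])
      (List.rec (f []) (fun k _ _ => force (Nat.mod (Nat.div c 64) 512) fun m =>
          force (Nat.div c 32768) fun c' => decode ks n c' fun ents => f ((k, m) :: ents))
        (ks.drop (Nat.pred (Nat.mod c 64))))

/-- The coordinates (shifted by `E`) of the vectors of a certificate at a given index. -/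
def coords (E : ℕ) (ents : List (List ℕ × ℕ)) (i : ℕ) (b : List ℕ) : List ℕ :=
  List.rec [] (fun t _ ih => Nat.add (Nat.mod (dot t.1 b) E)
    (Nat.mul E (Nat.land (Nat.shiftRight t.2 i) 1)) :: ih) ents

/-- The coordinates of the vectors of a certificate, with `E` times their sum. -/
def allCoords {β : Type} (E : ℕ) (ents : List (List ℕ × ℕ)) (bs : List (List ℕ)) :
    ℕ → (List (ℕ × List ℕ) → β) → β :=
  List.rec (motive := fun _ => ℕ → (List (ℕ × List ℕ) → β) → β) (fun _ k => k [])
    (fun b _ ih i k => forceList (coords E ents i b) fun z => force (Nat.mul E (sumList z)) fun s =>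
      force (Nat.succ i) fun j => ih j fun zs => k ((s, z) :: zs)) bs

/-- The absolute value of a moment. -/
def absMoment (c : ℕ) (p q : ℕ × List ℕ) : ℕ :=
  (fun x y => Nat.add (Nat.sub x y) (Nat.sub y x)) (Nat.add (dot p.2 q.2) c) (Nat.add p.1 q.1)

/-- The upper bound for the sum of the norms of the vectors of a certificate. -/
def energy (c : ℕ) (l : List (ℕ × List ℕ)) : ℕ :=
  List.rec 0 (fun p ps ih => Nat.add (absMoment c p p)
    (Nat.add (List.rec 0 (fun q _ s => Nat.add (absMoment c p q) s) ps) ih)) l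

/-- Checks a certificate. -/
def checkCert (D : GroupData) (path : List (List ℕ)) (cert : ℕ) : Bool :=
  force D.E fun E => decode D.ks 100 cert fun ents =>
    force (Nat.mul (Nat.mul E E) ents.length) fun c =>
      allCoords E ents path 0 fun zs => Nat.blt (energy c zs) c

/-- Checks a list of certificates. -/
def checkCerts (D : GroupData) : List (List (List ℕ)) → List ℕ → Bool
  | [], _ => true
  | _ :: _, [] => false
  | p :: ps, c :: cs => checkCert D p c && checkCerts D ps cs

/-- The sum of two lists, padded with zeros. -/
def addList : List ℕ → List ℕ → List ℕ
  | [], bs => bs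
  | a :: as, [] => a :: as
  | a :: as, b :: bs => Nat.add a b :: addList as bs

/-- The image of an element under an endomorphism. -/
def coact : List ℕ → List (List ℕ) → List ℕ
  | k :: ks, u :: us => addList (u.map fun x => Nat.mul k x) (coact ks us)
  | _, _ => []

/-- The characters of `∏ ℤ/nⱼ`. -/
def chars (E : ℕ) : List ℕ → List (List ℕ)
  | [] => [[]]
  | n :: ns => (chars E ns).flatMap fun b => (List.range n).map fun a => (E / n * a) :: b

/-- Reduction of an element modulo the orders of the generators. -/
def reduce : List ℕ → List ℕ → List ℕ
  | n :: ns, k :: ks => Nat.mod k n :: reduce ns ks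
  | _, _ => []

/-- Reduction of the opposite of an element modulo the orders of the generators. -/
def reduceNeg : List ℕ → List ℕ → List ℕ
  | n :: ns, k :: ks => Nat.mod (Nat.sub n (Nat.mod k n)) n :: reduceNeg ns ks
  | _, _ => []

/-- The matrix `U` defines an endomorphism. -/
def isEndo (ns : List ℕ) : List ℕ → List (List ℕ) → Bool
  | [], [] => true
  | n :: ms, u :: us => (Nat.beq u.length ns.length &&
      (reduce ns (u.map fun x => Nat.mul n x)).all fun x => Nat.beq x 0) && isEndo ns ms us
  | _, _ => false

/-- Checks the validity of the group data. -/
def checkData (D : GroupData) : Bool :=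
  ((Nat.blt 0 D.E && Nat.blt D.E 100) &&
    D.ns.all (fun n => Nat.blt 0 n && Nat.beq (Nat.mod D.E n) 0)) &&
  ((D.ks.all (fun k => Nat.beq k.length D.ns.length &&
      (reduce D.ns k).any fun x => Nat.blt 0 x)) &&
    ((chars D.E D.ns).all (fun b => memList b D.reps || memList (negChar D.E b) D.reps) &&
    (D.reps.all (fun b => Nat.blt 0 (weightFrom D.reps maxWeight b)) &&
    D.us.all (fun U => isEndo D.ns D.ns U &&
      D.ks.all (fun k => (fun k' => memList (reduce D.ns k') D.ks ||
        memList (reduceNeg D.ns k') D.ks) (coact k U))))))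

/-- The complete check of a group. -/
def checkGroup (D : GroupData) (certs : List ℕ) : Bool :=
  D.normalize fun D => checkData D && table D D.reps fun tab _ =>
    force (pack ((threshold D).map fun _ => laneBound)) fun M =>
    force (pack ((threshold D).map fun t => laneBound - t)) fun K =>
      checkCerts D (search K M tab 9 0 [] []) certs

/-! ### Characters -/

theorem beqList_eq_true {a b : List ℕ} : beqList a b = true ↔ a = b := by
  induction a generalizing b with
  | nil => cases b <;> simp [beqList]
  | cons x a ih => cases b <;> simp [beqList, ih]

theorem memList_eq_true {a : List ℕ} {l : List (List ℕ)} : memList a l = true ↔ a ∈ l := by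
  simp [memList, beqList_eq_true]

theorem dot_addList (x y b : List ℕ) : dot (addList x y) b = dot x b + dot y b := by
  induction x generalizing y b with
  | nil => simp [addList]
  | cons x xs ih =>
    cases y with
    | nil => simp [addList]
    | cons y ys =>
      cases b with
      | nil => simp
      | cons b bs =>
        simp only [addList, dot_cons, ih, Nat.add_eq]
        ring

theorem dot_map_mul (k : ℕ) (x b : List ℕ) : dot (x.map fun y => Nat.mul k y) b = k * dot x b := by
  induction x generalizing b with
  | nil => simp
  | cons x xs ih =>
    cases b with
    | nil => simp
    | cons b bs =>
      rw [List.map_cons, dot_cons, dot_cons, ih, Nat.mul_eq]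
      ring

theorem dot_act (E : ℕ) (U : List (List ℕ)) (k b : List ℕ) :
    dot k (act E U b) ≡ dot (coact k U) b [MOD E] := by
  induction k generalizing U with
  | nil => simp [coact]; rfl
  | cons k ks ih =>
    cases U with
    | nil => simp [act, coact]; rfl
    | cons u us =>
      simp only [act, List.map_cons, dot_cons, coact, dot_addList, dot_map_mul]
      exact ((Nat.mod_modEq _ _).mul_left k).add (ih us)

/-- The list `b` is a character, with values in `ℤ/E`, of the group `∏ ℤ/nⱼ`. -/
def IsChar (E : ℕ) (ns b : List ℕ) : Prop :=
  List.Forall₂ (fun n x => 0 < n ∧ E ∣ n * x ∧ x < E) ns b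

theorem dot_reduce {E : ℕ} {ns b : List ℕ} (h : IsChar E ns b) (k : List ℕ) :
    dot (reduce ns k) b ≡ dot k b [MOD E] := by
  induction h generalizing k with
  | nil => simp; rfl
  | @cons n x ns b hx _ ih =>
    cases k with
    | nil => simp [reduce]; rfl
    | cons k ks =>
      simp only [reduce, dot_cons]
      refine Nat.ModEq.add ?_ (ih ks)
      change k % n * x ≡ k * x [MOD E]
      conv_rhs => rw [← Nat.mod_add_div k n, add_mul]
      refine ((Nat.ModEq.refl _).add (Nat.modEq_zero_iff_dvd.2 ?_ : _ ≡ 0 [MOD E])).symm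
      rw [mul_right_comm]
      exact hx.2.1.mul_right _

theorem dvd_dot_reduceNeg_add {E : ℕ} {ns b : List ℕ} (h : IsChar E ns b) (k : List ℕ) :
    E ∣ dot (reduceNeg ns k) b + dot k b := by
  induction h generalizing k with
  | nil => simp
  | @cons n x ns b hx _ ih =>
    cases k with
    | nil => simp [reduceNeg]
    | cons k ks =>
      simp only [reduceNeg, dot_cons]
      rw [add_add_add_comm, ← add_mul]
      refine dvd_add (hx.2.1.trans (mul_dvd_mul_right ?_ x)) (ih ks)
      change n ∣ (n - k % n) % n + k
      have h1 : k % n < n := Nat.mod_lt _ hx.1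
      rw [← Nat.modEq_zero_iff_dvd]
      refine ((Nat.mod_modEq _ _).add (Nat.mod_modEq k n).symm).trans ?_
      rw [Nat.sub_add_cancel h1.le]
      simp [Nat.ModEq]

theorem IsChar.negChar {E : ℕ} {ns b : List ℕ} (h : IsChar E ns b) :
    IsChar E ns (negChar E b) := by
  induction h with
  | nil => exact .nil
  | @cons n x ns b hx _ ih =>
    refine .cons ⟨hx.1, ?_, Nat.mod_lt _ (by omega)⟩ ih
    rw [← Nat.modEq_zero_iff_dvd]
    refine ((Nat.mod_modEq _ _).mul_left n).trans ?_
    change n * (E - x) ≡ 0 [MOD E]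
    rw [Nat.mul_sub, Nat.modEq_zero_iff_dvd]
    exact Nat.dvd_sub (dvd_mul_left _ _) hx.2.1

theorem dvd_dot_negChar_add {E : ℕ} {ns b : List ℕ} (h : IsChar E ns b) (k : List ℕ) :
    E ∣ dot k (negChar E b) + dot k b := by
  induction h generalizing k with
  | nil => simp [LatticeIndex.negChar]
  | @cons n x ns b hx _ ih =>
    cases k with
    | nil => simp
    | cons k ks =>
      change E ∣ (k * ((E - x) % E) + dot ks (LatticeIndex.negChar E b)) + (k * x + dot ks b)
      rw [add_add_add_comm, ← mul_add]
      refine dvd_add (Dvd.dvd.mul_left ?_ k) (ih ks)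
      rw [← Nat.modEq_zero_iff_dvd]
      refine ((Nat.mod_modEq _ _).add_right x).trans ?_
      rw [Nat.sub_add_cancel hx.2.2.le]
      simp [Nat.ModEq]

theorem dot_eq_zero_of_all {a : List ℕ} (h : (a.all fun x => Nat.beq x 0) = true) (b : List ℕ) :
    dot a b = 0 := by
  induction a generalizing b with
  | nil => simp
  | cons a as ih =>
    cases b with
    | nil => simp
    | cons b bs =>
      simp only [List.all_cons, Bool.and_eq_true] at h
      have h1 : a = 0 := Nat.eq_of_beq_eq_true h.1
      simp [h1, ih h.2]

theorem IsChar.act {E : ℕ} {ns b : List ℕ} (hE : 0 < E) (h : IsChar E ns b)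
    {ms : List ℕ} (hms : ∀ n ∈ ms, 0 < n) {U : List (List ℕ)} (hU : isEndo ns ms U = true) :
    IsChar E ms (act E U b) := by
  induction ms generalizing U with
  | nil =>
    cases U with
    | nil => exact .nil
    | cons u us => simp [isEndo] at hU
  | cons n ms ih =>
    cases U with
    | nil => simp [isEndo] at hU
    | cons u us =>
      simp only [isEndo, Bool.and_eq_true] at hU
      refine .cons ⟨hms n (by simp), ?_, Nat.mod_lt _ hE⟩
        (ih (fun m hm => hms m (by simp [hm])) hU.2)
      rw [← Nat.modEq_zero_iff_dvd]
      refine ((Nat.mod_modEq _ _).mul_left n).trans ?_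
      rw [← dot_map_mul]
      refine (dot_reduce h _).symm.trans ?_
      rw [dot_eq_zero_of_all hU.1.2]

theorem IsChar.mem_chars {E : ℕ} {ns b : List ℕ} (h : IsChar E ns b) (hns : ∀ n ∈ ns, n ∣ E) :
    b ∈ chars E ns := by
  induction h with
  | nil => simp [chars]
  | @cons n x ns b hx _ ih =>
    simp only [chars, List.mem_flatMap, List.mem_map, List.mem_range]
    refine ⟨b, ih fun m hm => hns m (by simp [hm]), x / (E / n), ?_, ?_⟩
    all_goals
      obtain ⟨m, rfl⟩ := hns n (by simp)
      obtain ⟨hn, hd, hlt⟩ := hx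
      have hm : m ∣ x := Nat.dvd_of_mul_dvd_mul_left hn hd
      rw [Nat.mul_div_cancel_left _ hn]
    · exact Nat.div_lt_of_lt_mul (by rwa [mul_comm])
    · rw [Nat.mul_div_cancel' hm]

/-! ### Realizations -/

theorem checkData_iff {D : GroupData} : checkData D = true ↔
    ((0 < D.E ∧ D.E < 100) ∧ ∀ n ∈ D.ns, 0 < n ∧ n ∣ D.E) ∧
    (∀ k ∈ D.ks, k.length = D.ns.length ∧ ∃ x ∈ reduce D.ns k, 0 < x) ∧
    (∀ b ∈ chars D.E D.ns, b ∈ D.reps ∨ negChar D.E b ∈ D.reps) ∧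
    (∀ b ∈ D.reps, 0 < weightFrom D.reps maxWeight b) ∧
    ∀ U ∈ D.us, isEndo D.ns D.ns U = true ∧
      ∀ k ∈ D.ks, reduce D.ns (coact k U) ∈ D.ks ∨ reduceNeg D.ns (coact k U) ∈ D.ks := by
  simp [checkData, memList_eq_true, Nat.dvd_iff_mod_eq_zero, -Nat.reduceMul,
    -Nat.reduceLT]
  exact fun _ _ _ _ _ _ => Iff.rfl

variable {V : Type*} [NormedAddCommGroup V] [InnerProductSpace ℝ V]

/-- The vectors `e` and the characters `b` could arise from a lattice with minimum `1` which
contains the lattice generated by `e` with quotient containing the group of `D`. -/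
structure Realizes (D : GroupData) (e : Fin 9 → V) (b : Fin 9 → List ℕ) : Prop where
  norm_eq : ∀ i, ‖e i‖ = 1
  inner_le : ∀ i j, i ≠ j → |⟪e i, e j⟫| ≤ 1 / 2
  isChar : ∀ i, IsChar D.E D.ns (b i)
  le_norm : ∀ k ∈ D.ks, ∀ Y : Fin 9 → ℤ, (∀ i, Y i ≡ dot k (b i) [ZMOD D.E]) →
    (D.E : ℝ) ^ 2 ≤ ‖∑ i, (Y i : ℝ) • e i‖ ^ 2

theorem Realizes.perm {D : GroupData} {e : Fin 9 → V} {b : Fin 9 → List ℕ} (h : Realizes D e b)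
    (σ : Equiv.Perm (Fin 9)) : Realizes D (e ∘ σ) (b ∘ σ) where
  norm_eq i := h.norm_eq _
  inner_le i j hij := h.inner_le _ _ (σ.injective.ne hij)
  isChar i := h.isChar _
  le_norm k hk Y hY := by
    have := h.le_norm k hk (Y ∘ σ.symm) fun i => by simpa using hY (σ.symm i)
    rw [← Equiv.sum_comp σ] at this
    simpa using this

theorem modEq_neg_of_dvd_add {E x y : ℕ} {Y : ℤ} (h : E ∣ x + y) (hY : Y ≡ x [ZMOD E]) :
    -Y ≡ y [ZMOD E] := by
  have h1 : (E : ℤ) ∣ x + y := by exact_mod_cast h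
  have h2 := hY.dvd
  rw [Int.modEq_iff_dvd]
  have : (y : ℤ) - -Y = (x + y) - (x - Y) := by ring
  rw [this]
  exact dvd_sub h1 h2

theorem Realizes.flip {D : GroupData} {e : Fin 9 → V} {b : Fin 9 → List ℕ} (h : Realizes D e b)
    (s : Fin 9 → Bool) :
    Realizes D (fun i => bif s i then -e i else e i)
      (fun i => bif s i then negChar D.E (b i) else b i) where
  norm_eq i := by cases hs : s i <;> simp [h.norm_eq]
  inner_le i j hij := by
    have := h.inner_le i j hij
    cases hs : s i <;> cases ht : s j <;> simpa using this
  isChar i := by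
    cases hs : s i
    · exact h.isChar i
    · exact (h.isChar i).negChar
  le_norm k hk Y hY := by
    have := h.le_norm k hk (fun i => bif s i then -Y i else Y i) fun i => by
      have h1 := hY i
      cases hs : s i
      · simpa [hs] using h1
      · simp only [hs, cond_true] at h1 ⊢
        exact modEq_neg_of_dvd_add (dvd_dot_negChar_add (h.isChar i) k) h1
    convert this using 4 with i
    cases hs : s i <;> simp

theorem Realizes.act {D : GroupData} (hD : checkData D = true) {e : Fin 9 → V}
    {b : Fin 9 → List ℕ} (h : Realizes D e b) {U : List (List ℕ)} (hU : U ∈ D.us) :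
    Realizes D e (fun i => act D.E U (b i)) where
  norm_eq := h.norm_eq
  inner_le := h.inner_le
  isChar i := by
    rw [checkData_iff] at hD
    exact (h.isChar i).act hD.1.1.1 (fun n hn => (hD.1.2 n hn).1) (hD.2.2.2.2 U hU).1
  le_norm k hk Y hY := by
    rw [checkData_iff] at hD
    have hY' : ∀ i, Y i ≡ dot (coact k U) (b i) [ZMOD D.E] := fun i =>
      (hY i).trans (Int.natCast_modEq_iff.2 (dot_act _ _ _ _))
    rcases (hD.2.2.2.2 U hU).2 k hk with hk' | hk'
    · exact h.le_norm _ hk' Y fun i =>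
        (hY' i).trans (Int.natCast_modEq_iff.2 (dot_reduce (h.isChar i) _)).symm
    · have := h.le_norm _ hk' (-Y) fun i => by
        have h1 := dvd_dot_reduceNeg_add (h.isChar i) (coact k U)
        rw [add_comm] at h1
        exact modEq_neg_of_dvd_add h1 (hY' i)
      simpa using this

theorem weightFrom_le (l : List (List ℕ)) (w : ℕ) (b : List ℕ) : weightFrom l w b ≤ w := by
  induction l generalizing w with
  | nil => simp [weightFrom]
  | cons c l ih =>
    cases h : beqList c b
    · simp only [weightFrom, h, cond_false]
      exact (ih _).trans (Nat.div_le_self _ _)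
    · simp [weightFrom, h]

theorem weightFrom_eq_zero {l : List (List ℕ)} (w : ℕ) {b : List ℕ} (hb : b ∉ l) :
    weightFrom l w b = 0 := by
  induction l generalizing w with
  | nil => simp [weightFrom]
  | cons c l ih =>
    simp only [List.mem_cons, not_or] at hb
    have h : beqList c b = false := by
      rw [← Bool.not_eq_true, beqList_eq_true]
      exact Ne.symm hb.1
    simp only [weightFrom, h, cond_false]
    exact ih _ hb.2

/-- The weight of a character. -/
abbrev GroupData.weight (D : GroupData) (b : List ℕ) : ℕ := weightFrom D.reps maxWeight b

theorem absWeight_eq_max (D : GroupData) (b : List ℕ) :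
    absWeight D b = max (D.weight b) (D.weight (negChar D.E b)) := by
  unfold absWeight
  cases h : Nat.ble (weightFrom D.reps maxWeight b) (weightFrom D.reps maxWeight (negChar D.E b))
  · simp only [h, cond_false]
    rw [← Bool.not_eq_true, Nat.ble_eq] at h
    rw [max_eq_left]
    exact (not_le.1 h).le
  · simp only [h, cond_true]
    rw [Nat.ble_eq] at h
    rw [max_eq_right h]

theorem absWeight_le (D : GroupData) (b : List ℕ) : absWeight D b ≤ maxWeight := by
  rw [absWeight_eq_max]
  exact max_le (weightFrom_le _ _ _) (weightFrom_le _ _ _)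

/-- A realization that is maximal for the total weight. -/
structure Canonical (D : GroupData) (e : Fin 9 → V) (b : Fin 9 → List ℕ) : Prop
    extends Realizes D e b where
  mem_reps : ∀ i, b i ∈ D.reps
  absWeight_le : ∀ U ∈ D.us, ∑ i, absWeight D (LatticeIndex.act D.E U (b i)) ≤ ∑ i, D.weight (b i)

theorem Realizes.exists_canonical {D : GroupData} (hD : checkData D = true) {e : Fin 9 → V}
    {b : Fin 9 → List ℕ} (h : Realizes D e b) :
    ∃ (e : Fin 9 → V) (b : Fin 9 → List ℕ), Canonical D e b := by
  set S : Set ℕ := {w | ∃ (e : Fin 9 → V) (b : Fin 9 → List ℕ), Realizes D e b ∧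
    ∑ i, D.weight (b i) = w}
  have hS : BddAbove S := by
    refine ⟨∑ _i : Fin 9, maxWeight, ?_⟩
    rintro _ ⟨e, b, -, rfl⟩
    exact Finset.sum_le_sum fun i _ => weightFrom_le _ _ _
  obtain ⟨e, b, h, hw⟩ : sSup S ∈ S := Nat.sSup_mem ⟨_, e, b, h, rfl⟩ hS
  have hmax : ∀ (e' : Fin 9 → V) (b' : Fin 9 → List ℕ), Realizes D e' b' →
      ∑ i, absWeight D (b' i) ≤ ∑ i, D.weight (b i) := by
    intro e' b' h'
    rw [hw]
    refine le_csSup hS ⟨_, _, h'.flip fun i =>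
      Nat.ble (D.weight (b' i)) (D.weight (negChar D.E (b' i))), ?_⟩
    refine Finset.sum_congr rfl fun i _ => ?_
    unfold absWeight
    cases h : Nat.ble (D.weight (b' i)) (D.weight (negChar D.E (b' i))) <;> simp only [h] <;> rfl
  refine ⟨e, b, h, fun i => ?_, fun U hU => hmax _ _ (h.act hD hU)⟩
  by_contra hi
  rw [checkData_iff] at hD
  have h1 : negChar D.E (b i) ∈ D.reps :=
    (hD.2.2.1 _ ((h.isChar i).mem_chars fun n hn => (hD.1.2 n hn).2)).resolve_left hi
  refine (hmax e b h).not_gt (Finset.sum_lt_sum (fun j _ => ?_) ⟨i, Finset.mem_univ _, ?_⟩)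
  · rw [absWeight_eq_max]
    exact le_max_left _ _
  · rw [absWeight_eq_max, GroupData.weight, weightFrom_eq_zero _ hi]
    exact lt_max_of_lt_right (hD.2.2.2.1 _ h1)

theorem Realizes.two_mul_le {D : GroupData} (hE : 0 < D.E) {e : Fin 9 → V} {b : Fin 9 → List ℕ}
    (h : Realizes D e b) {k : List ℕ} (hk : k ∈ D.ks) {Y : Fin 9 → ℤ}
    (hY : ∀ i, Y i ≡ dot k (b i) [ZMOD D.E]) : 2 * (D.E : ℤ) ≤ ∑ i, |Y i| := by
  set x : V := ∑ i, (Y i : ℝ) • e i with hx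
  have hE' : (0 : ℝ) < D.E := by exact_mod_cast hE
  have hpos : 0 < ‖x‖ ^ 2 := (pow_pos hE' 2).trans_le (h.le_norm k hk Y hY)
  have h1 : ∀ i, 2 * (D.E : ℝ) * ((Y i : ℝ) * ⟪x, e i⟫) ≤ |(Y i : ℝ)| * ‖x‖ ^ 2 := by
    intro i
    have key : ∀ s : ℤ, |s| = 1 → 2 * (D.E : ℝ) * (s * ⟪x, e i⟫) ≤ ‖x‖ ^ 2 := by
      intro s hs
      have h2 := h.le_norm k hk (fun j => Y j - if j = i then s * D.E else 0) fun j => by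
        refine Int.ModEq.trans ?_ (hY j)
        rw [Int.modEq_iff_dvd]
        by_cases hj : j = i
        · subst hj; simp
        · simp [hj]
      have h3 : ∑ j, ((Y j - if j = i then s * D.E else 0 : ℤ) : ℝ) • e j =
          x - ((s : ℝ) * D.E) • e i := by
        rw [hx, eq_sub_iff_add_eq, ← Finset.sum_erase_add _ _ (Finset.mem_univ i), add_assoc,
          ← add_smul, ← Finset.sum_erase_add (a := i) Finset.univ (fun i => (Y i : ℝ) • e i)
          (Finset.mem_univ i)]
        congr 1
        · refine Finset.sum_congr rfl fun j hj => ?_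
          simp [Finset.ne_of_mem_erase hj]
        · simp
      rw [h3, norm_sub_sq_real, norm_smul, h.norm_eq, real_inner_smul_right] at h2
      have hs' : (s : ℝ) ^ 2 = 1 := by
        have : s ^ 2 = 1 := by rw [← sq_abs, hs, one_pow]
        exact_mod_cast this
      have h4 : (‖(s : ℝ) * D.E‖ * 1) ^ 2 = (D.E : ℝ) ^ 2 := by
        rw [mul_one, Real.norm_eq_abs, sq_abs, mul_pow, hs', one_mul]
      rw [h4] at h2
      linarith
    have habs : |(Y i : ℝ)| * (SignType.sign (Y i) : ℤ) = Y i := by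
      exact_mod_cast abs_mul_sign (Y i)
    by_cases hi : Y i = 0
    · simp [hi]
    · have := key (SignType.sign (Y i) : ℤ) (by
        rcases lt_or_gt_of_ne hi with hi | hi <;> simp [hi])
      calc 2 * (D.E : ℝ) * ((Y i : ℝ) * ⟪x, e i⟫)
          = |(Y i : ℝ)| * (2 * (D.E : ℝ) * ((SignType.sign (Y i) : ℤ) * ⟪x, e i⟫)) := by
            conv_lhs => rw [← habs]
            ring
        _ ≤ _ := mul_le_mul_of_nonneg_left this (abs_nonneg _)
  have h2 : 2 * (D.E : ℝ) * ‖x‖ ^ 2 ≤ (∑ i, |(Y i : ℝ)|) * ‖x‖ ^ 2 := by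
    have h3 : ‖x‖ ^ 2 = ∑ i, (Y i : ℝ) * ⟪x, e i⟫ := by
      rw [← real_inner_self_eq_norm_sq]
      conv_lhs => enter [3]; rw [hx]
      rw [inner_sum]
      simp only [real_inner_smul_right]
    conv_lhs => rw [h3]
    rw [Finset.mul_sum, Finset.sum_mul]
    exact Finset.sum_le_sum fun i _ => h1 i
  have h3 := le_of_mul_le_mul_right h2 hpos
  exact_mod_cast h3

theorem dist_eq_min (E : ℕ) (k b : List ℕ) : dist E k b = min (dot k b % E) (E - dot k b % E) := by
  rw [dist, force_eq]
  change cond (Nat.ble (dot k b % E) (E - dot k b % E)) (dot k b % E) (E - dot k b % E) = _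
  cases h : Nat.ble (dot k b % E) (E - dot k b % E)
  · rw [← Bool.not_eq_true, Nat.ble_eq] at h
    rw [cond_false, min_eq_right (not_le.1 h).le]
  · rw [Nat.ble_eq] at h
    rw [cond_true, min_eq_left h]

theorem exists_abs_eq_dist {E : ℕ} (hE : 0 < E) (k b : List ℕ) :
    ∃ Y : ℤ, Y ≡ dot k b [ZMOD E] ∧ |Y| = dist E k b := by
  have h1 := Nat.mod_lt (dot k b) hE
  have h2 : ((dot k b % E : ℕ) : ℤ) ≡ dot k b [ZMOD E] :=
    Int.natCast_modEq_iff.2 (Nat.mod_modEq _ _)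
  rw [dist_eq_min]
  rcases le_total (dot k b % E) (E - dot k b % E) with h | h
  · exact ⟨_, h2, by rw [min_eq_left h, Nat.abs_cast]⟩
  · refine ⟨(dot k b % E : ℕ) - E, by simp [Int.ModEq], ?_⟩
    rw [min_eq_right h, abs_of_nonpos (by omega)]
    omega

theorem Realizes.two_mul_le_sum_dist {D : GroupData} (hE : 0 < D.E) {e : Fin 9 → V}
    {b : Fin 9 → List ℕ} (h : Realizes D e b) {k : List ℕ} (hk : k ∈ D.ks) :
    2 * D.E ≤ ∑ i, dist D.E k (b i) := by
  choose Y hY hYd using fun i => exists_abs_eq_dist hE k (b i)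
  have := h.two_mul_le hE hk hY
  simp only [hYd] at this
  exact_mod_cast this

/-! ### The search -/

/-- Packs the values `f 0, …, f (m - 1)` into one number. -/
def packFn : ℕ → (ℕ → ℕ) → ℕ
  | 0, _ => 0
  | m + 1, f => f 0 + 281474976710656 * packFn m fun j => f (j + 1)

theorem packFn_add (m : ℕ) (f g : ℕ → ℕ) :
    packFn m (fun j => f j + g j) = packFn m f + packFn m g := by
  induction m generalizing f g with
  | zero => rfl
  | succ m ih => simp only [packFn, ih]; ring

theorem packFn_mul (m r : ℕ) (f : ℕ → ℕ) : packFn m (fun j => r * f j) = r * packFn m f := by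
  induction m generalizing f with
  | zero => rfl
  | succ m ih => simp only [packFn, ih]; ring

theorem packFn_congr {m : ℕ} {f g : ℕ → ℕ} (h : ∀ j < m, f j = g j) : packFn m f = packFn m g := by
  induction m generalizing f g with
  | zero => rfl
  | succ m ih => rw [packFn, packFn, h 0 (by omega), ih fun j hj => h (j + 1) (by omega)]

theorem pack_eq_packFn (l : List ℕ) : pack l = packFn l.length fun j => l.getD j 0 := by
  induction l with
  | nil => rfl
  | cons x l ih =>
    simp only [pack, List.length_cons, packFn, ih]
    rfl

theorem land_packFn {m : ℕ} {f : ℕ → ℕ} (h1 : ∀ j < m, laneBound ≤ f j)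
    (h2 : ∀ j < m, f j < 2 * laneBound) :
    Nat.land (packFn m f) (packFn m fun _ => laneBound) = packFn m fun _ => laneBound := by
  induction m generalizing f with
  | zero => simp [packFn]
  | succ m ih =>
    have ih := @ih (fun j => f (j + 1)) (fun j hj => h1 (j + 1) (by omega))
      fun j hj => h2 (j + 1) (by omega)
    have h3 := h1 0 (by omega)
    have h4 := h2 0 (by omega)
    change packFn m _ &&& packFn m _ = _ at ih
    change packFn (m + 1) _ &&& packFn (m + 1) _ = _
    simp only [packFn]
    set x := packFn m fun j => f (j + 1)
    set y := packFn m fun _ => laneBound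
    have e1 : (281474976710656 : ℕ) = 2 ^ 48 := by norm_num
    have h5 : f 0 < 2 ^ 48 := by simp only [laneBound] at h4; omega
    have h6 : laneBound < 2 ^ 48 := by norm_num [laneBound]
    rw [e1, add_comm (f 0), add_comm laneBound]
    apply Nat.eq_of_testBit_eq
    intro i
    rw [Nat.testBit_and, Nat.testBit_two_pow_mul_add _ h5, Nat.testBit_two_pow_mul_add _ h6]
    split_ifs with hi
    · have e2 : laneBound = 2 ^ 47 := by norm_num [laneBound]
      rw [e2, Nat.testBit_two_pow]
      by_cases h : 47 = i
      · subst h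
        simp only [decide_true, Bool.and_true]
        have e3 : f 0 = 2 ^ 47 * 1 + (f 0 - 2 ^ 47) := by omega
        rw [e3, Nat.testBit_two_pow_mul_add _ (by simp only [laneBound] at h3 h4; omega)]
        simp
      · simp [h]
    · rw [← Nat.testBit_and, ih]

/-- The successive elements of `L` can be picked, with repetitions, by going through `l`. -/
inductive Picks {α : Type*} : List α → List α → Prop
  | nil (l : List α) : Picks l []
  | use {c : α} {l L : List α} : Picks (c :: l) L → Picks (c :: l) (c :: L)
  | drop {c : α} {l L : List α} : Picks l L → Picks (c :: l) L

theorem exists_perm_picks {α : Type*} [DecidableEq α] (l L : List α) (h : ∀ x ∈ L, x ∈ l) :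
    ∃ L', L'.Perm L ∧ Picks l L' := by
  induction l generalizing L with
  | nil =>
    have : L = [] := List.eq_nil_iff_forall_not_mem.2 fun x hx => by simpa using h x hx
    exact ⟨[], this ▸ .refl _, .nil _⟩
  | cons c l ih =>
    obtain ⟨L', hp, hL⟩ := ih (L.filter (· ≠ c)) fun x hx => by
      simp only [ne_eq, decide_not, List.mem_filter, Bool.not_eq_eq_eq_not, Bool.not_true,
        decide_eq_false_iff_not] at hx
      exact (List.mem_cons.1 (h x hx.1)).resolve_left hx.2
    refine ⟨L.filter (· = c) ++ L', ?_, ?_⟩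
    · refine (hp.append_left _).trans ?_
      simpa using List.filter_append_perm (· = c) L
    · have : ∀ x ∈ L.filter (· = c), x = c := fun x hx => by simpa using (List.mem_filter.1 hx).2
      generalize L.filter (· = c) = R at this
      induction R with
      | nil => exact .drop hL
      | cons x R ihR =>
        obtain rfl : x = c := this x (by simp)
        exact .use (ihR fun y hy => this y (by simp [hy]))

/-- The entrywise maximum of the values of `F` on a list. -/
def supFn (F : List ℕ → ℕ → ℕ) : List (List ℕ) → ℕ → ℕ
  | [], _ => 0
  | c :: cs, j => max (supFn F cs j) (F c j)

/-- The table of packed values and packed suffix maxima of `F`. -/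
def tableFn (m : ℕ) (F : List ℕ → ℕ → ℕ) : List (List ℕ) → List (ℕ × ℕ × List ℕ)
  | [] => []
  | c :: cs => (packFn m (F c), packFn m (supFn F (c :: cs)), c) :: tableFn m F cs

theorem mem_search_of_mem (K M : ℕ) (cols : List (ℕ × ℕ × List ℕ)) (rem S : ℕ)
    (path : List (List ℕ)) (acc : List (List (List ℕ))) (x : List (List ℕ)) (hx : x ∈ acc) :
    x ∈ search K M cols rem S path acc := by
  induction cols generalizing rem S path acc with
  | nil =>
    cases rem with
    | zero => exact List.mem_cons_of_mem _ hx
    | succ r => exact hx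
  | cons c cs ih =>
    obtain ⟨t, p, b⟩ := c
    induction rem generalizing S path acc with
    | zero =>
      change x ∈ cond _ (path :: acc) acc
      cases Nat.beq (Nat.land (Nat.add S K) M) M
      · exact hx
      · exact List.mem_cons_of_mem _ hx
    | succ r ihr =>
      change x ∈ cond (Nat.beq (Nat.land (Nat.add S (Nat.add (Nat.mul (Nat.succ r) p) K)) M) M)
        (search K M ((t, p, b) :: cs) r (Nat.add S t) (b :: path)
          (search K M cs (Nat.succ r) S path acc)) acc
      cases Nat.beq (Nat.land (Nat.add S (Nat.add (Nat.mul (Nat.succ r) p) K)) M) M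
      · exact hx
      · exact ihr _ _ _ (ih _ _ _ _ hx)

theorem le_supFn (F : List ℕ → ℕ → ℕ) {l L : List (List ℕ)} (h : Picks l L) (j : ℕ) :
    (L.map fun c => F c j).sum ≤ L.length * supFn F l j := by
  induction h with
  | nil => simp
  | use _ ih =>
    rw [List.map_cons, List.sum_cons, List.length_cons, add_mul, one_mul, add_comm]
    exact add_le_add ih (le_max_right _ _)
  | drop _ ih => exact ih.trans (Nat.mul_le_mul_left _ (le_max_left _ _))

theorem supFn_le {F : List ℕ → ℕ → ℕ} {j B : ℕ} {l : List (List ℕ)} (h : ∀ c ∈ l, F c j ≤ B) :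
    supFn F l j ≤ B := by
  induction l with
  | nil => simp [supFn]
  | cons c l ih =>
    exact max_le (ih fun c hc => h c (by simp [hc])) (h c (by simp))

theorem mem_search {m : ℕ} {F : List ℕ → ℕ → ℕ} {thr : ℕ → ℕ} (hthr : ∀ j < m, thr j ≤ laneBound)
    {l L : List (List ℕ)} (hL : Picks l L) (hF : ∀ c ∈ l, ∀ j < m, F c j ≤ 2 * maxWeight)
    (s : ℕ → ℕ) (path : List (List ℕ)) (acc : List (List (List ℕ)))
    (hs : ∀ j < m, thr j ≤ s j + (L.map fun c => F c j).sum)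
    (hs' : ∀ j < m, s j + L.length * (2 * maxWeight) ≤ 20 * maxWeight) :
    L.reverse ++ path ∈ search (packFn m fun j => laneBound - thr j) (packFn m fun _ => laneBound)
      (tableFn m F l) L.length (packFn m s) path acc := by
  have hcheck : ∀ {l L : List (List ℕ)}, Picks l L →
      (∀ c ∈ l, ∀ j < m, F c j ≤ 2 * maxWeight) → ∀ {s : ℕ → ℕ},
      (∀ j < m, thr j ≤ s j + (L.map fun c => F c j).sum) →
      (∀ j < m, s j + L.length * (2 * maxWeight) ≤ 20 * maxWeight) →
      Nat.beq (Nat.land (packFn m s + (L.length * packFn m (supFn F l) +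
        packFn m fun j => laneBound - thr j)) (packFn m fun _ => laneBound))
        (packFn m fun _ => laneBound) = true := by
    intro l L hL hF s hs hs'
    rw [← packFn_mul, ← packFn_add, ← packFn_add, land_packFn, Nat.beq_refl]
    · intro j hj
      have := hs j hj
      have := le_supFn F hL j
      have := hthr j hj
      omega
    · intro j hj
      have h1 := hs' j hj
      have h2 := Nat.mul_le_mul_left L.length (supFn_le fun c hc => hF c hc j hj)
      simp only [maxWeight, laneBound] at h1 h2 ⊢
      omega
  have hnil : ∀ {l : List (List ℕ)}, (∀ c ∈ l, ∀ j < m, F c j ≤ 2 * maxWeight) → ∀ {s : ℕ → ℕ}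
      (path : List (List ℕ)) (acc : List (List (List ℕ))),
      (∀ j < m, thr j ≤ s j) → (∀ j < m, s j ≤ 20 * maxWeight) →
      path ∈ search (packFn m fun j => laneBound - thr j) (packFn m fun _ => laneBound)
        (tableFn m F l) 0 (packFn m s) path acc := by
    intro l hF s path acc hs hs'
    cases l with
    | nil => exact List.mem_cons_self
    | cons c l =>
      have := hcheck (.nil (c :: l)) hF (s := s) (by simpa using hs) (by simpa using hs')
      rw [List.length_nil, zero_mul, zero_add] at this
      change path ∈ cond (Nat.beq (Nat.land (packFn m s + packFn m fun j => laneBound - thr j)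
        (packFn m fun _ => laneBound)) (packFn m fun _ => laneBound)) (path :: acc) acc
      rw [this]
      exact List.mem_cons_self
  induction hL generalizing s path acc with
  | nil l => exact hnil hF path acc (by simpa using hs) (by simpa using hs')
  | @use c l L hL ih =>
    have := hcheck (.use hL) hF hs hs'
    change _ ∈ cond (Nat.beq (Nat.land (packFn m s + ((L.length + 1) *
      packFn m (supFn F (c :: l)) + packFn m fun j => laneBound - thr j))
      (packFn m fun _ => laneBound)) (packFn m fun _ => laneBound))
      (search _ _ (tableFn m F (c :: l)) L.length (packFn m s + packFn m (F c)) (c :: path)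
        (search _ _ (tableFn m F l) (L.length + 1) (packFn m s) path acc)) acc
    rw [List.length_cons] at this
    rw [this, cond_true, ← packFn_add, List.reverse_cons, List.append_assoc]
    refine ih hF (fun j => s j + F c j) (c :: path) _ (fun j hj => ?_) fun j hj => ?_
    · have := hs j hj
      rw [List.map_cons, List.sum_cons] at this
      omega
    · have h1 := hs' j hj
      have h2 := hF c (by simp) j hj
      rw [List.length_cons, add_mul] at h1
      omega
  | @drop c l L hL ih =>
    cases L with
    | nil => exact hnil hF path acc (by simpa using hs) (by simpa using hs')
    | cons x L =>
      have := hcheck (.drop (c := c) hL) hF hs hs'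
      change _ ∈ cond (Nat.beq (Nat.land (packFn m s + ((L.length + 1) *
        packFn m (supFn F (c :: l)) + packFn m fun j => laneBound - thr j))
        (packFn m fun _ => laneBound)) (packFn m fun _ => laneBound))
        (search _ _ (tableFn m F (c :: l)) L.length (packFn m s + packFn m (F c)) (c :: path)
          (search _ _ (tableFn m F l) (L.length + 1) (packFn m s) path acc)) acc
      rw [List.length_cons] at this
      rw [this, cond_true]
      exact mem_search_of_mem _ _ _ _ _ _ _ _
        (ih (fun c hc => hF c (by simp [hc])) s path acc hs hs')

theorem length_maxList {a b : List ℕ} (h : a.length = b.length) :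
    (maxList a b).length = a.length := by
  induction a generalizing b with
  | nil => rfl
  | cons x a ih =>
    cases b with
    | nil => simp at h
    | cons y b => simp [maxList, ih (by simpa using h)]

theorem getD_maxList {a b : List ℕ} (h : a.length = b.length) (j : ℕ) :
    (maxList a b).getD j 0 = max (a.getD j 0) (b.getD j 0) := by
  induction a generalizing b j with
  | nil => obtain rfl : b = [] := by simpa using h.symm
           simp [maxList]
  | cons x a ih =>
    cases b with
    | nil => simp at h
    | cons y b =>
      cases j with
      | zero =>
        simp only [maxList, List.getD_cons_zero]
        cases hxy : Nat.ble x y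
        · rw [← Bool.not_eq_true, Nat.ble_eq] at hxy
          rw [cond_false, max_eq_left (not_le.1 hxy).le]
        · rw [Nat.ble_eq] at hxy
          rw [cond_true, max_eq_right hxy]
      | succ j => simpa [maxList] using ih (by simpa using h) j

/-- The values of the linear forms. -/
def rowFn (D : GroupData) (b : List ℕ) (j : ℕ) : ℕ := (row D b).getD j 0

theorem length_row (D : GroupData) (b : List ℕ) : (row D b).length = (threshold D).length := by
  simp [row, threshold]

theorem table_eq {β : Type} (D : GroupData) (l : List (List ℕ)) :
    ∃ sup : List ℕ, sup.length = (threshold D).length ∧ (∀ j, sup.getD j 0 = supFn (rowFn D) l j) ∧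
      ∀ k : List (ℕ × ℕ × List ℕ) → List ℕ → β,
        table D l k = k (tableFn (threshold D).length (rowFn D) l) sup := by
  induction l with
  | nil => exact ⟨(threshold D).map fun _ => 0, by simp, fun j => by
      simp [supFn, List.getD_eq_getElem?_getD], fun k => rfl⟩
  | cons c l ih =>
    obtain ⟨sup, h1, h2, h3⟩ := ih
    have h4 := h1.trans (length_row D c).symm
    refine ⟨maxList sup (row D c), by rw [length_maxList h4, h1], fun j => ?_, fun k => ?_⟩
    · rw [getD_maxList h4, h2]
      rfl
    · simp only [table, h3, forceList_eq, force_eq, tableFn]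
      congr 3
      · rw [pack_eq_packFn, length_row]
        rfl
      · congr 1
        rw [pack_eq_packFn, length_maxList h4, h1]
        exact packFn_congr fun j _ => by rw [getD_maxList h4, h2]; rfl

theorem exists_checkCert {D : GroupData} {l : List (List (List ℕ))} {certs : List ℕ}
    (h : checkCerts D l certs = true) {p : List (List ℕ)} (hp : p ∈ l) :
    ∃ c, checkCert D p c = true := by
  induction l generalizing certs with
  | nil => simp at hp
  | cons q l ih =>
    cases certs with
    | nil => simp [checkCerts] at h
    | cons c certs =>
      simp only [checkCerts, Bool.and_eq_true] at h
      rcases List.mem_cons.1 hp with rfl | hp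
      · exact ⟨c, h.1⟩
      · exact ih h.2 hp

theorem normalize_eq {β : Type} (D : GroupData) (k : GroupData → β) : D.normalize k = k D := by
  simp only [GroupData.normalize, forceList_eq, force_eq, forceLists_eq]

theorem checkGroup_iff {D : GroupData} {certs : List ℕ} : checkGroup D certs = true ↔
    checkData D = true ∧ checkCerts D (search
      (packFn (threshold D).length fun j => laneBound - (threshold D).getD j 0)
      (packFn (threshold D).length fun _ => laneBound)
      (tableFn (threshold D).length (rowFn D) D.reps) 9 0 [] []) certs = true := by
  rw [checkGroup, normalize_eq, Bool.and_eq_true]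
  obtain ⟨sup, -, -, h⟩ := table_eq (β := Bool) D D.reps
  rw [h]
  simp only [force_eq, pack_eq_packFn, List.length_map]
  have h1 : packFn (threshold D).length (fun j =>
      ((threshold D).map fun _ => laneBound).getD j 0) =
      packFn (threshold D).length fun _ => laneBound :=
    packFn_congr fun j hj => by simp [List.getD_eq_getElem?_getD, hj]
  have h2 : packFn (threshold D).length (fun j =>
      ((threshold D).map fun t => laneBound - t).getD j 0) =
      packFn (threshold D).length fun j => laneBound - (threshold D).getD j 0 :=
    packFn_congr fun j hj => by simp [List.getD_eq_getElem?_getD, hj]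
  rw [h1, h2]

theorem exists_eq_ofFn_comp_of_perm {α : Type*} {n : ℕ} {b : Fin n → α} {L : List α}
    (h : L.Perm (List.ofFn b)) : ∃ σ : Equiv.Perm (Fin n), L = List.ofFn (b ∘ σ) := by
  have h1 : List.Forall₂ (fun x i => x = b i) (List.ofFn b) (List.finRange n) := by
    rw [List.ofFn_eq_map, List.forall₂_map_left_iff, List.forall₂_same]
    simp
  obtain ⟨l, h2, h3⟩ := List.perm_comp_forall₂ h h1
  have hlen : l.length = n := by rw [h3.length_eq, List.length_finRange]
  have hinj : Function.Injective fun i : Fin n => l[(i : ℕ)]'(hlen.symm ▸ i.2) := by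
    intro i j hij
    exact Fin.ext ((h3.nodup_iff.2 (List.nodup_finRange n)).getElem_inj_iff.1 hij)
  refine ⟨Equiv.ofBijective _ (Finite.injective_iff_bijective.1 hinj), ?_⟩
  refine List.ext_getElem (by simp [h.length_eq]) fun i hi _ => ?_
  simpa using h2.get hi (h2.length_eq ▸ hi)

theorem rowFn_cases (D : GroupData) {j : ℕ} (hj : j < (threshold D).length) :
    (∃ k ∈ D.ks, (∀ b, rowFn D b j = dist D.E k b) ∧ (threshold D).getD j 0 = 2 * D.E) ∨
    ∃ U ∈ D.us, (∀ b, rowFn D b j = D.weight b + (maxWeight - absWeight D (act D.E U b))) ∧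
      (threshold D).getD j 0 = 9 * maxWeight := by
  simp only [rowFn, row, threshold, List.getD_eq_getElem?_getD, List.getElem?_append,
    List.length_map, List.getElem?_map]
  split_ifs with h
  · refine .inl ⟨D.ks[j], List.getElem_mem _, fun b => ?_, ?_⟩ <;> simp [h]
  · have h' : j - D.ks.length < D.us.length := by
      simp only [threshold, List.length_append, List.length_map] at hj
      omega
    refine .inr ⟨D.us[j - D.ks.length], List.getElem_mem _, fun b => ?_, ?_⟩
    · simp [h']
    · simp [h']

theorem Canonical.exists_checkCert {D : GroupData} {certs : List ℕ}
    (hD : checkGroup D certs = true) {e : Fin 9 → V} {b : Fin 9 → List ℕ} (h : Canonical D e b) :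
    ∃ (σ : Equiv.Perm (Fin 9)) (c : ℕ), checkCert D (List.ofFn (b ∘ σ)) c = true := by
  rw [checkGroup_iff, checkData_iff] at hD
  obtain ⟨L, hp, hL⟩ := exists_perm_picks D.reps (List.ofFn b) fun x hx => by
    obtain ⟨i, rfl⟩ := (List.mem_ofFn' _ _).1 hx
    exact h.mem_reps i
  have hlen : L.length = 9 := by rw [hp.length_eq, List.length_ofFn]
  have hmem := mem_search (m := (threshold D).length) (F := rowFn D)
    (thr := fun j => (threshold D).getD j 0) (fun j hj => ?_) hL (fun c _ j hj => ?_)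
    (fun _ => 0) [] [] (fun j hj => ?_) fun j _ => ?_
  · have h0 : packFn (threshold D).length (fun _ => 0) = 0 := by
      simpa using packFn_mul (threshold D).length 0 fun _ => 0
    rw [h0, hlen, List.append_nil] at hmem
    obtain ⟨c, hc⟩ := LatticeIndex.exists_checkCert hD.2 hmem
    obtain ⟨σ, hσ⟩ := exists_eq_ofFn_comp_of_perm (L.reverse_perm.trans hp)
    exact ⟨σ, c, hσ ▸ hc⟩
  · have := hD.1.1.1.2
    rcases rowFn_cases D hj with ⟨k, -, -, h2⟩ | ⟨U, -, -, h2⟩ <;> simp only [h2]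
    · simp only [laneBound]; omega
    · norm_num [laneBound, maxWeight]
  · have := hD.1.1.1.2
    rcases rowFn_cases D hj with ⟨k, -, h1, -⟩ | ⟨U, -, h1, -⟩ <;> rw [h1]
    · rw [dist_eq_min]
      simp only [maxWeight]; omega
    · have := weightFrom_le D.reps maxWeight c
      simp only [GroupData.weight]; omega
  · rw [zero_add, (hp.map _).sum_eq, ← List.ofFn_comp', List.sum_ofFn]
    rcases rowFn_cases D hj with ⟨k, hk, h1, h2⟩ | ⟨U, hU, h1, h2⟩ <;> simp only [h1, h2]
    · exact h.two_mul_le_sum_dist hD.1.1.1.1 hk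
    · have h3 := h.absWeight_le U hU
      have h4 : ∑ i, absWeight D (act D.E U (b i)) +
          ∑ i, (maxWeight - absWeight D (act D.E U (b i))) = 9 * maxWeight := by
        rw [← Finset.sum_add_distrib]
        simp [Nat.add_sub_cancel' (LatticeIndex.absWeight_le _ _)]
      rw [Finset.sum_add_distrib]
      omega
  · rw [hlen]; omega

/-! ### Certificates -/

theorem exists_decode_eq {β : Type} (ks : List (List ℕ)) (n c : ℕ) :
    ∃ ents : List (List ℕ × ℕ), (∀ t ∈ ents, t.1 ∈ ks) ∧
      ∀ f : List (List ℕ × ℕ) → β, decode ks n c f = f ents := by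
  induction n generalizing c with
  | zero => exact ⟨[], by simp, fun f => rfl⟩
  | succ n ih =>
    cases hc : Nat.beq c 0
    · cases hk : ks.drop (Nat.pred (Nat.mod c 64)) with
      | nil => exact ⟨[], by simp, fun f => by simp only [decode, hc, hk, cond_false]⟩
      | cons k l =>
        obtain ⟨ents, h1, h2⟩ := ih (Nat.div c 32768)
        refine ⟨(k, Nat.mod (Nat.div c 64) 512) :: ents, ?_, fun f => ?_⟩
        · have : k ∈ ks := List.mem_of_mem_drop (hk ▸ List.mem_cons_self)
          simpa [this] using h1
        · simp only [decode, hc, hk, cond_false, force_eq, h2]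
    · exact ⟨[], by simp, fun f => by simp only [decode, hc, cond_true]⟩

/-- The coordinates of the vectors of a certificate, with `E` times their sum. -/
def coordList (E : ℕ) (ents : List (List ℕ × ℕ)) : List (List ℕ) → ℕ → List (ℕ × List ℕ)
  | [], _ => []
  | b :: bs, i => (E * sumList (coords E ents i b), coords E ents i b) ::
      coordList E ents bs (i + 1)

theorem allCoords_eq {β : Type} (E : ℕ) (ents : List (List ℕ × ℕ)) (bs : List (List ℕ)) (i : ℕ)
    (k : List (ℕ × List ℕ) → β) : allCoords E ents bs i k = k (coordList E ents bs i) := by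
  induction bs generalizing i k with
  | nil => rfl
  | cons b bs ih =>
    have : allCoords E ents (b :: bs) i k = forceList (coords E ents i b) fun z =>
      force (Nat.mul E (sumList z)) fun s => force (Nat.succ i) fun j =>
        allCoords E ents bs j fun zs => k ((s, z) :: zs) := rfl
    rw [this]
    simp only [forceList_eq, force_eq, ih]
    rfl

theorem coordList_ofFn (E : ℕ) (ents : List (List ℕ × ℕ)) {n : ℕ} (b : Fin n → List ℕ) (i : ℕ) :
    coordList E ents (List.ofFn b) i = List.ofFn fun j : Fin n =>
      (E * sumList (coords E ents (i + j) (b j)), coords E ents (i + j) (b j)) := by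
  induction n generalizing i with
  | zero => rfl
  | succ n ih =>
    rw [List.ofFn_succ, List.ofFn_succ, coordList, ih]
    simp [add_assoc, add_comm 1]

theorem coords_eq_map (E : ℕ) (ents : List (List ℕ × ℕ)) (i : ℕ) (b : List ℕ) :
    coords E ents i b = ents.map fun t => dot t.1 b % E + E * ((t.2 >>> i) &&& 1) := by
  induction ents with
  | nil => rfl
  | cons t l ih => rw [List.map_cons, ← ih]; rfl

theorem sum_sub_mul_sub (E : ℝ) (z z' : List ℕ) (h : z.length = z'.length) :
    ∑ t ∈ Finset.range z.length, ((z.getD t 0 : ℝ) - E) * ((z'.getD t 0 : ℝ) - E) =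
      dot z z' + E * E * z.length - (E * sumList z + E * sumList z') := by
  induction z generalizing z' with
  | nil =>
    obtain rfl : z' = [] := by simpa using h.symm
    simp [sumList]
  | cons x z ih =>
    cases z' with
    | nil => simp at h
    | cons y z' =>
      rw [List.length_cons, Finset.sum_range_succ']
      simp only [List.getD_cons_succ, List.getD_cons_zero]
      rw [ih z' (by simpa using h)]
      have h1 : ∀ (a : ℕ) (l : List ℕ), sumList (a :: l) = a + sumList l := fun _ _ => rfl
      rw [h1, h1, dot_cons]
      push_cast
      ring

theorem absMoment_eq (E : ℕ) (z z' : List ℕ) (h : z.length = z'.length) :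
    (absMoment (E * E * z.length) (E * sumList z, z) (E * sumList z', z') : ℝ) =
      |∑ t ∈ Finset.range z.length, ((z.getD t 0 : ℝ) - E) * ((z'.getD t 0 : ℝ) - E)| := by
  rw [sum_sub_mul_sub _ _ _ h]
  have key : ∀ x y : ℕ, ((x - y + (y - x) : ℕ) : ℝ) = |(x : ℝ) - y| := by
    intro x y
    rcases le_total x y with h | h
    · rw [Nat.sub_eq_zero_of_le h, zero_add, abs_of_nonpos (by simpa using h), Nat.cast_sub h]
      ring
    · rw [Nat.sub_eq_zero_of_le h, add_zero, abs_of_nonneg (by simpa using h), Nat.cast_sub h]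
  refine (key _ _).trans ?_
  simp only [Nat.add_eq]
  push_cast
  rfl

theorem sum_norm_sq_le_energy (E C : ℕ) (l : List (V × List ℕ)) (h1 : ∀ p ∈ l, ‖p.1‖ = 1)
    (h2 : l.Pairwise fun p q => |⟪p.1, q.1⟫| ≤ 1 / 2) (h3 : ∀ p ∈ l, p.2.length = C) :
    ∑ t ∈ Finset.range C, ‖(l.map fun p => ((p.2.getD t 0 : ℝ) - E) • p.1).sum‖ ^ 2 ≤
      energy (E * E * C) (l.map fun p => (E * sumList p.2, p.2)) := by
  induction l with
  | nil => simp
  | cons p l ih =>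
    simp only [List.mem_cons, forall_eq_or_imp] at h1 h3
    rw [List.pairwise_cons] at h2
    replace ih := ih h1.2 h2.2 h3.2
    have henergy : energy (E * E * C) ((p :: l).map fun p => (E * sumList p.2, p.2)) =
        absMoment (E * E * C) (E * sumList p.2, p.2) (E * sumList p.2, p.2) +
        ((l.map fun q => absMoment (E * E * C) (E * sumList p.2, p.2)
          (E * sumList q.2, q.2)).sum + energy (E * E * C) (l.map fun p =>
            (E * sumList p.2, p.2))) := by
      change absMoment _ _ _ + (List.rec 0 (fun q _ s => absMoment (E * E * C)
        (E * sumList p.2, p.2) q + s) (l.map fun p => (E * sumList p.2, p.2)) + energy _ _) = _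
      congr 2
      clear ih h1 h2 h3
      induction l with
      | nil => rfl
      | cons q l ih => rw [List.map_cons, List.map_cons, List.sum_cons, ← ih]
    set y : ℕ → ℝ := fun t => (p.2.getD t 0 : ℝ) - E with hy
    set w : ℕ → V := fun t => (l.map fun p => ((p.2.getD t 0 : ℝ) - E) • p.1).sum with hw
    have hexp : ∀ t, ‖((p :: l).map fun p => ((p.2.getD t 0 : ℝ) - E) • p.1).sum‖ ^ 2 =
        y t * y t + 2 * (y t * ⟪p.1, w t⟫) + ‖w t‖ ^ 2 := by
      intro t
      rw [List.map_cons, List.sum_cons]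
      change ‖y t • p.1 + w t‖ ^ 2 = _
      rw [norm_add_sq_real, norm_smul, h1.1, real_inner_smul_left, mul_one, Real.norm_eq_abs,
        sq_abs]
      ring
    have hdiag : ∑ t ∈ Finset.range C, y t * y t =
        absMoment (E * E * C) (E * sumList p.2, p.2) (E * sumList p.2, p.2) := by
      have := absMoment_eq E p.2 p.2 rfl
      rw [h3.1] at this
      rw [this, abs_of_nonneg (Finset.sum_nonneg fun t _ => mul_self_nonneg _)]
    have hcross : ∑ t ∈ Finset.range C, 2 * (y t * ⟪p.1, w t⟫) ≤
        ((l.map fun q => absMoment (E * E * C) (E * sumList p.2, p.2)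
          (E * sumList q.2, q.2)).sum : ℕ) := by
      simp only [hw]
      clear ih henergy hexp hw w
      induction l with
      | nil => simp
      | cons q l ih =>
        simp only [List.mem_cons, forall_eq_or_imp] at h1 h3 h2
        have ih := ih ⟨h2.1.2, (List.pairwise_cons.1 h2.2).2⟩ ⟨h1.1, h1.2.2⟩ ⟨h3.1, h3.2.2⟩
        simp only [List.map_cons, List.sum_cons, inner_add_right, mul_add,
          Finset.sum_add_distrib, Nat.cast_add]
        refine add_le_add ?_ ih
        have := absMoment_eq E p.2 q.2 (h3.1.trans h3.2.1.symm)
        rw [h3.1] at this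
        rw [this]
        have h4 : ∑ t ∈ Finset.range C, 2 * (y t * ⟪p.1, ((q.2.getD t 0 : ℝ) - E) • q.1⟫) =
            2 * ⟪p.1, q.1⟫ * ∑ t ∈ Finset.range C, y t * ((q.2.getD t 0 : ℝ) - E) := by
          rw [Finset.mul_sum]
          refine Finset.sum_congr rfl fun t _ => ?_
          rw [real_inner_smul_right]
          ring
        rw [h4]
        refine (le_abs_self _).trans ?_
        rw [abs_mul, abs_mul, abs_two]
        exact mul_le_of_le_one_left (abs_nonneg _) (by linarith [h2.1.1])
    rw [henergy, Finset.sum_congr rfl fun t _ => hexp t, Finset.sum_add_distrib,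
      Finset.sum_add_distrib, hdiag, Nat.cast_add, Nat.cast_add, ← add_assoc]
    exact add_le_add (add_le_add le_rfl hcross) ih

theorem Realizes.checkCert_ne_true {D : GroupData} {e : Fin 9 → V} {b : Fin 9 → List ℕ}
    (h : Realizes D e b) (cert : ℕ) : checkCert D (List.ofFn b) cert ≠ true := by
  intro hc
  obtain ⟨ents, h1, h2⟩ := exists_decode_eq (β := Bool) D.ks 100 cert
  simp only [checkCert, force_eq, h2, allCoords_eq, Nat.blt_eq] at hc
  change energy (D.E * D.E * ents.length) _ < D.E * D.E * ents.length at hc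
  set l : List (V × List ℕ) := List.ofFn fun i : Fin 9 => (e i, coords D.E ents i (b i)) with hl
  have h3 : coordList D.E ents (List.ofFn b) 0 = l.map fun p => (D.E * sumList p.2, p.2) := by
    rw [coordList_ofFn, hl, List.map_ofFn]
    simp only [zero_add]
    rfl
  have h4 := sum_norm_sq_le_energy D.E ents.length l
    (by simp [hl, h.norm_eq])
    (by
      rw [hl, List.pairwise_ofFn]
      exact fun i j hij => h.inner_le i j hij.ne)
    (by simp [hl, coords_eq_map])
  rw [← h3] at h4
  have h5 : (D.E * D.E * ents.length : ℕ) ≤ ∑ t ∈ Finset.range ents.length,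
      ‖(l.map fun p => ((p.2.getD t 0 : ℝ) - D.E) • p.1).sum‖ ^ 2 := by
    have : ((D.E * D.E * ents.length : ℕ) : ℝ) =
        ∑ t ∈ Finset.range ents.length, (D.E : ℝ) ^ 2 := by
      simp
      ring
    rw [this]
    refine Finset.sum_le_sum fun t ht => ?_
    rw [Finset.mem_range] at ht
    rw [hl, List.map_ofFn, List.sum_ofFn]
    have := h.le_norm ents[t].1 (h1 _ (List.getElem_mem _))
      (fun i => (dot ents[t].1 (b i) % D.E + D.E * ((ents[t].2 >>> (i : ℕ)) &&& 1) : ℕ) - D.E)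
      fun i => by simp [Int.ModEq]
    refine this.trans_eq (congrArg (‖·‖ ^ 2) (Finset.sum_congr rfl fun i _ => ?_))
    rw [Int.cast_sub, Int.cast_natCast, Int.cast_natCast]
    simp [coords_eq_map, List.getD_eq_getElem?_getD, ht]
  exact absurd (h5.trans h4) (not_le.2 (by exact_mod_cast hc))

theorem not_realizes {D : GroupData} {certs : List ℕ} (hD : checkGroup D certs = true)
    (e : Fin 9 → V) (b : Fin 9 → List ℕ) : ¬ Realizes D e b := by
  intro h
  obtain ⟨e, b, h⟩ := h.exists_canonical (checkGroup_iff.1 hD).1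
  obtain ⟨σ, c, hc⟩ := h.exists_checkCert hD
  exact (h.toRealizes.perm σ).checkCert_ne_true c hc

/-! ### From lattices to realizations -/

/-- The group `∏ ℤ/nⱼ`. -/
def GroupOf : List ℕ → Type
  | [] => Unit
  | n :: ns => ZMod n × GroupOf ns

instance GroupOf.addCommGroup : ∀ ns, AddCommGroup (GroupOf ns)
  | [] => inferInstanceAs (AddCommGroup Unit)
  | n :: ns =>
    letI := GroupOf.addCommGroup ns
    inferInstanceAs (AddCommGroup (ZMod n × GroupOf ns))

/-- The element with given coordinates. -/
def GroupOf.mk : ∀ ns : List ℕ, List ℕ → GroupOf ns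
  | [], _ => 0
  | _ :: _, [] => 0
  | n :: ns, k :: ks => ((k : ZMod n), GroupOf.mk ns ks)

theorem GroupOf.mk_ne_zero {ns k : List ℕ} (h : ∃ x ∈ reduce ns k, 0 < x) :
    GroupOf.mk ns k ≠ 0 := by
  induction ns generalizing k with
  | nil => simp [reduce] at h
  | cons n ns ih =>
    cases k with
    | nil => simp [reduce] at h
    | cons k ks =>
      intro h0
      have h1 : (k : ZMod n) = 0 := congrArg Prod.fst h0
      have h2 : GroupOf.mk ns ks = 0 := congrArg Prod.snd h0
      obtain ⟨x, hx, hx'⟩ := h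
      rcases List.mem_cons.1 hx with rfl | hx
      · rw [ZMod.natCast_eq_zero_iff] at h1
        exact hx'.ne' (Nat.mod_eq_zero_of_dvd h1)
      · exact ih ⟨x, hx, hx'⟩ h2

theorem exists_characters {W : Type*} [AddCommGroup W] (Λ Λ' : Submodule ℤ W) {e : Fin 9 → W}
    (hΛ' : Λ' = Submodule.span ℤ (Set.range e)) {E : ℕ} (hE : 0 < E) (ns : List ℕ)
    (hns : ∀ n ∈ ns, 0 < n ∧ n ∣ E) (f : GroupOf ns →+ Λ ⧸ Λ'.comap Λ.subtype) :
    ∃ b : Fin 9 → List ℕ, (∀ i, IsChar E ns (b i)) ∧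
      ∀ k, ∃ x : Λ, Submodule.Quotient.mk x = f (GroupOf.mk ns k) ∧
        ∃ c : Fin 9 → ℤ, (E : ℤ) • (x : W) = ∑ i, ((dot k (b i) : ℤ) + E * c i) • e i := by
  induction ns with
  | nil =>
    refine ⟨fun _ => [], fun _ => .nil, fun k => ⟨0, ?_, 0, by simp⟩⟩
    exact (map_zero f).symm
  | cons n ns ih =>
    obtain ⟨g, hg⟩ : ∃ g : ZMod n × GroupOf ns →+ Λ ⧸ Λ'.comap Λ.subtype,
      ∀ k ks, f (GroupOf.mk (n :: ns) (k :: ks)) = g ((k : ZMod n), GroupOf.mk ns ks) :=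
      ⟨f, fun _ _ => rfl⟩
    obtain ⟨b, hb, h⟩ := ih (fun m hm => hns m (by simp [hm]))
      (g.comp (AddMonoidHom.inr (ZMod n) (GroupOf ns)))
    obtain ⟨hn, m, hm⟩ := hns n (by simp)
    obtain ⟨x₀, hx₀⟩ := Submodule.Quotient.mk_surjective _ (g (1, 0))
    have hmem : (n : ℤ) • (x₀ : W) ∈ Λ' := by
      have h1 : Submodule.Quotient.mk (p := Λ'.comap Λ.subtype) ((n : ℤ) • x₀) = 0 := by
        rw [Submodule.Quotient.mk_smul, hx₀, ← map_zsmul, Prod.smul_mk, smul_zero,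
          show (n : ℤ) • (1 : ZMod n) = 0 by simp]
        exact map_zero g
      rw [Submodule.Quotient.mk_eq_zero] at h1
      exact h1
    rw [hΛ', Submodule.mem_span_range_iff_exists_fun] at hmem
    obtain ⟨a, ha⟩ := hmem
    have hm' : (E : ℤ) = n * m := by exact_mod_cast hm
    have hE' : (E : ℤ) ≠ 0 := by exact_mod_cast hE.ne'
    have hcast : ∀ i, (((m * a i) % E : ℤ).toNat : ℤ) = (m * a i) % E :=
      fun i => Int.toNat_of_nonneg (Int.emod_nonneg _ hE')
    refine ⟨fun i => ((m * a i) % E : ℤ).toNat :: b i, fun i => .cons ⟨hn, ?_, ?_⟩ (hb i),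
      fun k => ?_⟩
    · zify
      rw [hcast, Int.dvd_iff_emod_eq_zero, Int.mul_emod, Int.emod_emod_of_dvd _ dvd_rfl,
        ← Int.mul_emod, ← mul_assoc, ← hm']
      exact Int.mul_emod_right _ _
    · zify
      rw [hcast]
      exact Int.emod_lt_of_pos _ (by exact_mod_cast hE)
    · cases k with
      | nil => exact ⟨0, (map_zero f).symm, 0, by simp⟩
      | cons k ks =>
        obtain ⟨x, hx, c, hc⟩ := h ks
        refine ⟨(k : ℤ) • x₀ + x, ?_, fun i => k * ((m * a i) / E) + c i, ?_⟩
        · rw [Submodule.Quotient.mk_add, Submodule.Quotient.mk_smul, hx₀, hx, hg, ← map_zsmul,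
            AddMonoidHom.comp_apply, ← map_add]
          simp
        · have h1 : (E : ℤ) • ((k : ℤ) • (x₀ : W)) = ∑ i, ((k : ℤ) * (m * a i)) • e i := by
            have : (E : ℤ) • ((k : ℤ) • (x₀ : W)) = ((k : ℤ) * m) • ((n : ℤ) • (x₀ : W)) := by
              rw [smul_smul, smul_smul, hm']
              congr 1
              ring
            rw [this, ← ha, Finset.smul_sum]
            exact Finset.sum_congr rfl fun i _ => by rw [smul_smul, mul_assoc]
          rw [Submodule.coe_add, Submodule.coe_smul, smul_add, h1, hc, ← Finset.sum_add_distrib]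
          refine Finset.sum_congr rfl fun i _ => ?_
          rw [← add_smul, dot_cons, Nat.cast_add, Nat.cast_mul, hcast]
          congr 1
          conv_lhs => rw [← Int.emod_add_mul_ediv (m * a i) E]
          ring

theorem exists_realizes (Λ Λ' : Submodule ℤ V) {m : ℝ} (hm : 0 < m)
    (hmin : ∀ x ∈ Λ, x ≠ 0 → m ≤ ‖x‖ ^ 2) {e : Fin 9 → V} (hli : LinearIndependent ℝ e)
    (he : ∀ i, e i ∈ Λ) (he' : ∀ i, ‖e i‖ ^ 2 = m) (hΛ' : Λ' = Submodule.span ℤ (Set.range e))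
    {D : GroupData} (hD : checkData D = true) {f : GroupOf D.ns →+ Λ ⧸ Λ'.comap Λ.subtype}
    (hf : Function.Injective f) : ∃ (e : Fin 9 → V) (b : Fin 9 → List ℕ), Realizes D e b := by
  rw [checkData_iff] at hD
  obtain ⟨b, hb, h⟩ := exists_characters Λ Λ' hΛ' hD.1.1.1 D.ns hD.1.2 f
  set r : ℝ := (√m)⁻¹ with hr
  have hr2 : r ^ 2 * m = 1 := by
    rw [hr, inv_pow, Real.sq_sqrt hm.le, inv_mul_cancel₀ hm.ne']
  have hr0 : 0 < r := inv_pos.2 (Real.sqrt_pos.2 hm)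
  refine ⟨fun i => r • e i, b, ⟨fun i => ?_, fun i j hij => ?_, hb, fun k hk Y hY => ?_⟩⟩
  · have : ‖r • e i‖ ^ 2 = 1 := by
      rw [norm_smul, mul_pow, he', Real.norm_eq_abs, sq_abs, hr2]
    exact (pow_eq_one_iff_of_nonneg (norm_nonneg _) two_ne_zero).1 this
  · have hne : e i ≠ e j := hli.injective.ne hij
    have hne' : e i ≠ -e j := by
      intro h0
      have h1 := (linearIndepOn_pair_iff (K := ℝ) e hij (hli.ne_zero i)).1
        (hli.linearIndepOn (s := {i, j})) (-1)
      exact h1 (by rw [h0]; simp)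
    have h1 := hmin _ (Λ.sub_mem (he i) (he j)) (sub_ne_zero.2 hne)
    have h2 := hmin _ (Λ.add_mem (he i) (he j)) fun h0 => hne' (eq_neg_of_add_eq_zero_left h0)
    rw [norm_sub_sq_real, he', he'] at h1
    rw [norm_add_sq_real, he', he'] at h2
    rw [real_inner_smul_left, real_inner_smul_right, ← mul_assoc, ← sq, abs_mul,
      abs_of_nonneg (sq_nonneg r)]
    calc r ^ 2 * |⟪e i, e j⟫| ≤ r ^ 2 * (m / 2) :=
          mul_le_mul_of_nonneg_left (abs_le.2 ⟨by linarith, by linarith⟩) (sq_nonneg r)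
      _ = 1 / 2 := by rw [← mul_div_assoc, hr2]
  · obtain ⟨x, hx, c, hc⟩ := h k
    have hx' : (x : V) ∉ Λ' := by
      intro hx'
      have h0 : Submodule.Quotient.mk (p := Λ'.comap Λ.subtype) x = 0 :=
        (Submodule.Quotient.mk_eq_zero _).2 hx'
      rw [h0] at hx
      exact GroupOf.mk_ne_zero (hD.2.1 k hk).2 (hf (hx.symm.trans (map_zero f).symm))
    have heΛ' : ∀ i, e i ∈ Λ' := fun i => hΛ' ▸ Submodule.subset_span (Set.mem_range_self i)
    choose d hd using fun i => (hY i).symm.dvd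
    set v : V := x + ∑ i, (d i - c i) • e i with hv
    have hvΛ : v ∈ Λ := Λ.add_mem x.2 (Submodule.sum_mem _ fun i _ => Λ.smul_mem _ (he i))
    have hv0 : v ≠ 0 := by
      intro h0
      rw [hv, add_eq_zero_iff_eq_neg] at h0
      exact hx' (h0 ▸ Λ'.neg_mem (Submodule.sum_mem _ fun i _ => Λ'.smul_mem _ (heΛ' i)))
    have h1 : ∑ i, (Y i : ℝ) • r • e i = (r * D.E) • v := by
      have h2 : (D.E : ℤ) • v = ∑ i, Y i • e i := by
        rw [hv, smul_add, hc, Finset.smul_sum, ← Finset.sum_add_distrib]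
        refine Finset.sum_congr rfl fun i _ => ?_
        rw [smul_smul, ← add_smul]
        congr 1
        have := hd i
        linarith
      rw [mul_smul, ← Int.cast_natCast (R := ℝ) D.E, Int.cast_smul_eq_zsmul, h2, Finset.smul_sum]
      refine Finset.sum_congr rfl fun i _ => ?_
      rw [smul_comm, Int.cast_smul_eq_zsmul]
    rw [h1, norm_smul, mul_pow, Real.norm_eq_abs, sq_abs, mul_pow, mul_right_comm]
    have := mul_le_mul_of_nonneg_left (hmin v hvΛ hv0) (sq_nonneg r)
    rw [hr2] at this
    exact le_mul_of_one_le_left (sq_nonneg _) this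

/-! ### Subgroups of finite abelian groups -/

theorem exists_injective_zmod {n q : ℕ} (hq : 0 < q) (h : n ∣ q) :
    ∃ f : ZMod n →+ ZMod q, Function.Injective f := by
  obtain ⟨m, rfl⟩ := h
  have hm : 0 < m := Nat.pos_of_ne_zero (by rintro rfl; simp at hq)
  refine ⟨ZMod.lift n ⟨zmultiplesHom _ (m : ZMod (n * m)), ?_⟩, ?_⟩
  · suffices h : (n : ZMod (n * m)) * m = 0 by simpa using h
    exact_mod_cast ZMod.natCast_self (n * m)
  · rw [ZMod.lift_injective]
    intro k hk
    have h1 : ((k * m : ℤ) : ZMod (n * m)) = 0 := by simpa using hk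
    rw [ZMod.intCast_zmod_eq_zero_iff_dvd] at h1
    rw [ZMod.intCast_zmod_eq_zero_iff_dvd]
    push_cast at h1
    exact Int.dvd_of_mul_dvd_mul_right (by exact_mod_cast hm.ne') h1

theorem exists_injective_eraseIdx (L : List ℕ) {i : ℕ} (hi : i < L.length) :
    ∃ f : ZMod L[i] × GroupOf (L.eraseIdx i) →+ GroupOf L, Function.Injective f := by
  induction L generalizing i with
  | nil => simp at hi
  | cons q L ih =>
    cases i with
    | zero => exact ⟨AddMonoidHom.id (ZMod q × GroupOf L), Function.injective_id⟩
    | succ i =>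
      have hi' : i < L.length := Nat.lt_of_succ_lt_succ hi
      obtain ⟨f, hf⟩ := ih hi'
      refine ⟨(((AddMonoidHom.fst _ _).comp (AddMonoidHom.snd _ _)).prod
        (f.comp ((AddMonoidHom.fst _ _).prod ((AddMonoidHom.snd _ _).comp
          (AddMonoidHom.snd _ _)))) :
        ZMod L[i] × (ZMod q × GroupOf (L.eraseIdx i)) →+ ZMod q × GroupOf L), ?_⟩
      rintro ⟨x, y, z⟩ ⟨x', y', z'⟩ h
      have h1 : y = y' := congrArg Prod.fst h
      have h2 : f (x, z) = f (x', z') := congrArg Prod.snd h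
      have h3 := hf h2
      simp only [Prod.mk.injEq] at h3
      rw [h1, h3.1, h3.2]

/-- The `nⱼ` divide distinct entries of `L`. -/
def fits : List ℕ → List ℕ → Bool
  | [], _ => true
  | n :: ns, L => (List.range L.length).any fun i =>
      Nat.beq (L.getD i 0 % n) 0 && fits ns (L.eraseIdx i)

theorem exists_injective_of_fits {ns L : List ℕ} (hL : ∀ q ∈ L, 0 < q) (h : fits ns L = true) :
    ∃ f : GroupOf ns →+ GroupOf L, Function.Injective f := by
  induction ns generalizing L with
  | nil => exact ⟨0, fun _ _ _ => rfl⟩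
  | cons n ns ih =>
    simp only [fits, List.any_eq_true, List.mem_range, Bool.and_eq_true] at h
    obtain ⟨i, hi, h1, h2⟩ := h
    obtain ⟨f, hf⟩ := ih (fun q hq => hL q (List.mem_of_mem_eraseIdx hq)) h2
    have h3 : n ∣ L[i] := by
      have := Nat.eq_of_beq_eq_true h1
      rw [List.getD_eq_getElem _ _ hi] at this
      exact Nat.dvd_of_mod_eq_zero this
    obtain ⟨g, hg⟩ := exists_injective_zmod (hL _ (List.getElem_mem hi)) h3
    obtain ⟨φ, hφ⟩ := exists_injective_eraseIdx L hi
    exact ⟨φ.comp (g.prodMap f : ZMod n × GroupOf ns →+ _), hφ.comp (hg.prodMap hf)⟩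

theorem exists_list_of_pi {n : ℕ} (p e : Fin n → ℕ) (hp : ∀ i, (p i).Prime) :
    ∃ L : List ℕ, (∀ q ∈ L, IsPrimePow q) ∧ L.prod = ∏ i, p i ^ e i ∧
      ∃ f : GroupOf L →+ ∀ i, ZMod (p i ^ e i), Function.Injective f := by
  induction n with
  | zero => exact ⟨[], by simp, by simp, 0, fun _ _ _ => rfl⟩
  | succ n ih =>
    obtain ⟨L, h1, h2, f, hf⟩ := ih (fun i => p i.succ) (fun i => e i.succ) fun i => hp _
    rw [Fin.prod_univ_succ, ← h2]
    by_cases h0 : e 0 = 0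
    · refine ⟨L, h1, by simp [h0], ⟨⟨fun y => Fin.cons 0 (f y), ?_⟩, ?_⟩, ?_⟩
      · funext i
        cases i using Fin.cases <;> simp
      · intro x y
        funext i
        cases i using Fin.cases <;> simp
      · intro x y hxy
        exact hf (funext fun i => congrFun hxy i.succ)
    · refine ⟨p 0 ^ e 0 :: L, ?_, by simp, ⟨⟨fun y : ZMod (p 0 ^ e 0) × GroupOf L =>
        Fin.cons y.1 (f y.2), ?_⟩, ?_⟩, ?_⟩
      · simp only [List.mem_cons, forall_eq_or_imp]
        exact ⟨(hp 0).isPrimePow.pow h0, h1⟩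
      · funext i
        cases i using Fin.cases
        · rfl
        · exact congrFun (map_zero f) _
      · intro x y
        funext i
        cases i using Fin.cases
        · rfl
        · exact congrFun (map_add f x.2 y.2) _
      · intro x y hxy
        exact Prod.ext (congrFun hxy 0) (hf (funext fun i => congrFun hxy i.succ))

theorem exists_injective_list (G : Type*) [AddCommGroup G] [Finite G] :
    ∃ L : List ℕ, (∀ q ∈ L, IsPrimePow q) ∧ L.prod = Nat.card G ∧
      ∃ f : GroupOf L →+ G, Function.Injective f := by
  obtain ⟨ι, _, p, hp, e, ⟨φ⟩⟩ := AddCommGroup.equiv_directSum_zmod_of_finite G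
  classical
  let ψ : G ≃+ ∀ i, ZMod (p i ^ e i) := φ.trans (DirectSum.addEquivProd _)
  let σ := (Fintype.equivFin ι).symm
  obtain ⟨L, h1, h2, f, hf⟩ := exists_list_of_pi (p ∘ σ) (e ∘ σ) fun i => hp _
  let τ : (∀ j, ZMod (p (σ j) ^ e (σ j))) ≃+ ∀ i, ZMod (p i ^ e i) :=
    (LinearEquiv.piCongrLeft ℤ (fun i => ZMod (p i ^ e i)) σ).toAddEquiv
  refine ⟨L, h1, ?_, (τ.trans ψ.symm).toAddMonoidHom.comp f, (τ.trans ψ.symm).injective.comp hf⟩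
  rw [h2, Nat.card_congr ψ.toEquiv, Nat.card_pi]
  simp only [Nat.card_zmod, Function.comp_apply]
  exact Equiv.prod_comp σ fun i => p i ^ e i

/-- The prime powers up to `37`. -/
def primePowers : List ℕ :=
  [2, 3, 4, 5, 7, 8, 9, 11, 13, 16, 17, 19, 23, 25, 27, 29, 31, 32, 37]

/-- The lists of prime powers of length at most `l` and product at most `B`, for `B ≤ 37`. -/
def primePowerLists : ℕ → ℕ → List (List ℕ)
  | 0, _ => [[]]
  | l + 1, B => [] :: (primePowers.filter (· ≤ B)).flatMap fun q =>
      (primePowerLists l (B / q)).map (q :: ·)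

theorem mem_primePowerLists {l B : ℕ} {L : List ℕ} (hB : B ≤ 37) (hL : ∀ q ∈ L, IsPrimePow q)
    (hl : L.length ≤ l) (hp : L.prod ≤ B) : L ∈ primePowerLists l B := by
  induction l generalizing B L with
  | zero =>
    obtain rfl : L = [] := by simpa using hl
    simp [primePowerLists]
  | succ l ih =>
    cases L with
    | nil => simp [primePowerLists]
    | cons q L =>
      simp only [List.mem_cons, forall_eq_or_imp] at hL
      rw [List.prod_cons] at hp
      have hpos : 0 < L.prod := List.prod_pos fun q hq => (hL.2 q hq).pos
      have hq : q ≤ B := (Nat.le_mul_of_pos_right q hpos).trans hp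
      have hq' : q ∈ primePowers := by
        have key : ∀ q < 38, IsPrimePow q → q ∈ primePowers := by decide +kernel
        exact key q (by omega) hL.1
      refine List.mem_cons_of_mem _ (List.mem_flatMap.2 ⟨q, ?_, List.mem_map.2 ⟨L, ?_, rfl⟩⟩)
      · simpa [hq] using hq'
      · refine ih ((Nat.div_le_self _ _).trans hB) hL.2 (by simpa using hl) ?_
        rw [Nat.le_div_iff_mul_le hL.1.pos]
        linarith

/-- Types of groups such that all the abelian groups of order from `17` to `37` have a subgroup of
one of these types. -/
def groupTypes : List (List ℕ) :=
  [[11], [13], [2, 7], [3, 5], [16], [17], [2, 9], [19], [4, 5], [3, 7], [23], [3, 8], [25], [27],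
    [29], [31], [5, 7], [37], [2, 3, 3], [2, 2, 5], [2, 3, 4], [2, 2, 2, 3], [5, 5], [3, 9],
    [3, 3, 3], [4, 8], [2, 2, 8], [2, 4, 4], [2, 2, 2, 4], [2, 2, 2, 2, 2]]

theorem exists_injective_groupType (G : Type*) [AddCommGroup G] (h1 : 17 ≤ Nat.card G)
    (h2 : Nat.card G ≤ 37) :
    ∃ ns ∈ groupTypes, ∃ f : GroupOf ns →+ G, Function.Injective f := by
  have : Finite G := Nat.finite_of_card_ne_zero (by omega)
  obtain ⟨L, hL, hp, f, hf⟩ := exists_injective_list G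
  have hlen : L.length ≤ 5 := by
    by_contra! h
    have h3 : 2 ^ L.length ≤ L.prod := List.pow_card_le_prod L 2 fun q hq => (hL q hq).two_le
    have h4 : 2 ^ 6 ≤ 2 ^ L.length := Nat.pow_le_pow_right (by norm_num) h
    omega
  have hmem := mem_primePowerLists le_rfl hL hlen (hp.trans_le h2)
  have key : ∀ L ∈ primePowerLists 5 37, 17 ≤ L.prod → ∃ ns ∈ groupTypes, fits ns L = true := by
    decide +kernel
  obtain ⟨ns, hns, hfit⟩ := key L hmem (hp ▸ h1)
  obtain ⟨g, hg⟩ := exists_injective_of_fits (fun q hq => (hL q hq).pos) hfit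
  exact ⟨ns, hns, f.comp g, hf.comp hg⟩

/-! ### Blichfeldt's bound for the index -/

section Blichfeldt

open MeasureTheory

theorem sum_sum_norm_sub_sq_le {ι : Type*} (s : Finset ι) (y : ι → V) :
    ∑ i ∈ s, ∑ j ∈ s, ‖y i - y j‖ ^ 2 ≤ 2 * s.card * ∑ i ∈ s, ‖y i‖ ^ 2 := by
  have h : ∑ i ∈ s, ∑ j ∈ s, ‖y i - y j‖ ^ 2 =
      2 * s.card * ∑ i ∈ s, ‖y i‖ ^ 2 - 2 * ⟪∑ i ∈ s, y i, ∑ i ∈ s, y i⟫ := by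
    simp only [norm_sub_sq_real, sum_inner, inner_sum, Finset.sum_add_distrib,
      Finset.sum_sub_distrib, Finset.sum_const, nsmul_eq_mul, ← Finset.mul_sum]
    rw [Finset.sum_comm (f := fun i j => ⟪y i, y j⟫)]
    ring
  rw [h, real_inner_self_eq_norm_sq]
  linarith [sq_nonneg ‖∑ i ∈ s, y i‖]

theorem sum_max_sub_norm_sq_le {ι : Type*} {r : ℝ} (hr : 0 ≤ r) {y : ι → V}
    (hy : ∀ i j, i ≠ j → 2 * r ≤ ‖y i - y j‖ ^ 2) (s : Finset ι) :
    ∑ i ∈ s, max (r - ‖y i‖ ^ 2) 0 ≤ r := by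
  classical
  let t := s.filter fun i => 0 < r - ‖y i‖ ^ 2
  have h1 : ∑ i ∈ s, max (r - ‖y i‖ ^ 2) 0 = ∑ i ∈ t, (r - ‖y i‖ ^ 2) := by
    rw [Finset.sum_filter]
    refine Finset.sum_congr rfl fun i _ => ?_
    split_ifs with h
    · exact max_eq_left h.le
    · exact max_eq_right (not_lt.1 h)
  rw [h1]
  rcases t.eq_empty_or_nonempty with h | h
  · simpa [h] using hr
  have h2 : ∑ i ∈ t, ∑ j ∈ t, (if i = j then 0 else 2 * r) ≤
      ∑ i ∈ t, ∑ j ∈ t, ‖y i - y j‖ ^ 2 := by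
    refine Finset.sum_le_sum fun i _ => Finset.sum_le_sum fun j _ => ?_
    split_ifs with hij
    · positivity
    · exact hy i j hij
  have h3 : ∑ i ∈ t, ∑ j ∈ t, (if i = j then 0 else 2 * r) = t.card * (t.card - 1) * (2 * r) := by
    have : ∀ i ∈ t, ∑ j ∈ t, (if i = j then 0 else 2 * r) = (t.card - 1) * (2 * r) := by
      intro i hi
      have : ∀ j, (if i = j then 0 else 2 * r) = 2 * r - if i = j then 2 * r else 0 := by
        intro j; split_ifs <;> simp
      simp [this, hi]
      ring
    rw [Finset.sum_congr rfl this]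
    simp
    ring
  have h4 := h2.trans (sum_sum_norm_sub_sq_le t y)
  rw [h3] at h4
  have h5 : (0 : ℝ) < t.card := by exact_mod_cast h.card_pos
  rw [Finset.sum_sub_distrib, Finset.sum_const, nsmul_eq_mul]
  nlinarith

variable [FiniteDimensional ℝ V] [MeasurableSpace V] [BorelSpace V]

theorem integral_max_sub_norm_sq_le (Λ : Submodule ℤ V) [DiscreteTopology Λ] [IsZLattice ℝ Λ]
    {r : ℝ} (hr : 0 ≤ r) (hmin : ∀ x ∈ Λ, x ≠ 0 → 2 * r ≤ ‖x‖ ^ 2) :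
    ∫ x : V, max (r - ‖x‖ ^ 2) 0 ≤ r * ZLattice.covolume Λ := by
  let b := Module.Free.chooseBasis ℤ Λ
  have hF := ZLattice.isAddFundamentalDomain b (volume : Measure V)
  set F := ZSpan.fundamentalDomain (b.ofZLatticeBasis ℝ)
  have : MeasurableVAdd Λ V := (inferInstance : MeasurableVAdd Λ.toAddSubgroup V)
  have : VAddInvariantMeasure Λ V volume :=
    (inferInstance : VAddInvariantMeasure Λ.toAddSubgroup V volume)
  have hfin : volume F ≠ ⊤ := (ZSpan.fundamentalDomain_isBounded _).measure_lt_top.ne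
  have hnonneg : ∀ x : V, 0 ≤ max (r - ‖x‖ ^ 2) 0 := fun _ => le_max_right _ _
  rw [ZLattice.covolume_eq_measure_fundamentalDomain Λ volume hF,
    integral_eq_lintegral_of_nonneg_ae (.of_forall hnonneg) (by fun_prop)]
  refine ENNReal.toReal_le_of_le_ofReal (by positivity) ?_
  rw [hF.lintegral_eq_tsum'', ← lintegral_tsum (fun i => by
      simp only [Submodule.vadd_def]; fun_prop)]
  have key : ∀ z : V, ∑' x : Λ, ENNReal.ofReal (max (r - ‖x +ᵥ z‖ ^ 2) 0) ≤ ENNReal.ofReal r := by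
    intro z
    rw [ENNReal.tsum_eq_iSup_sum]
    refine iSup_le fun s => ?_
    rw [← ENNReal.ofReal_sum_of_nonneg fun _ _ => le_max_right _ _]
    refine ENNReal.ofReal_le_ofReal (sum_max_sub_norm_sq_le hr (fun i j hij => ?_) s)
    have h := hmin (i - j) (Λ.sub_mem i.2 j.2) fun h =>
      hij (Subtype.ext (sub_eq_zero.1 h))
    simpa [Submodule.vadd_def] using h
  refine (lintegral_mono key).trans ?_
  rw [setLIntegral_const, ENNReal.ofReal_mul hr, ofReal_measureReal hfin]

theorem integral_max_sub_norm_sq [Nontrivial V] {R : ℝ} (hR : 0 ≤ R) :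
    ∫ x : V, max (R ^ 2 - ‖x‖ ^ 2) 0 = 2 / (Module.finrank ℝ V + 2) *
      volume.real (Metric.ball (0 : V) 1) * R ^ (Module.finrank ℝ V + 2) := by
  rw [integral_fun_norm_addHaar volume fun t => max (R ^ 2 - t ^ 2) 0]
  obtain ⟨n, hn⟩ : ∃ n, Module.finrank ℝ V = n + 1 :=
    Nat.exists_eq_succ_of_ne_zero Module.finrank_pos.ne'
  have h1 : ∫ t in Set.Ioi (0 : ℝ), t ^ n • max (R ^ 2 - t ^ 2) 0 =
      ∫ t in (0 : ℝ)..R, (R ^ 2 * t ^ n - t ^ (n + 2)) := by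
    rw [intervalIntegral.integral_of_le hR]
    symm
    rw [← integral_indicator measurableSet_Ioi, ← integral_indicator measurableSet_Ioc]
    congr 1
    funext t
    by_cases h0 : 0 < t
    · by_cases ht : t ≤ R
      · have h2 : t ^ 2 ≤ R ^ 2 := pow_le_pow_left₀ h0.le ht 2
        rw [Set.indicator_of_mem (Set.mem_Ioc.2 ⟨h0, ht⟩), Set.indicator_of_mem (Set.mem_Ioi.2 h0),
          max_eq_left (by linarith), smul_eq_mul]
        ring
      · have h2 : R ^ 2 ≤ t ^ 2 := pow_le_pow_left₀ hR (not_le.1 ht).le 2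
        rw [Set.indicator_of_notMem (fun h => ht h.2), Set.indicator_of_mem (Set.mem_Ioi.2 h0),
          max_eq_right (by linarith), smul_zero]
    · rw [Set.indicator_of_notMem (fun h => h0 h.1), Set.indicator_of_notMem (s := Set.Ioi 0) h0]
  rw [hn, Nat.add_sub_cancel, h1, intervalIntegral.integral_sub (by simp)
    (by simp), intervalIntegral.integral_const_mul, integral_pow, integral_pow]
  simp only [nsmul_eq_mul, smul_eq_mul]
  push_cast
  field_simp
  ring

theorem covolume_span_le {n : ℕ} [Fact (Module.finrank ℝ V = n)] (b : Module.Basis (Fin n) ℝ V) :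
    ZLattice.covolume (Submodule.span ℤ (Set.range b)) ≤ ∏ i, ‖b i‖ := by
  let o : Orientation ℝ V (Fin n) := b.orientation
  let b₀ : OrthonormalBasis (Fin n) ℝ V :=
    (stdOrthonormalBasis ℝ V).reindex (finCongr Fact.out)
  rw [ZLattice.covolume_eq_measure_fundamentalDomain _ _ (ZSpan.isAddFundamentalDomain b volume),
    ZSpan.measureReal_fundamentalDomain b volume b₀.toBasis,
    measureReal_congr (ZSpan.fundamentalDomain_ae_parallelepiped b₀.toBasis volume)]
  rw [b₀.coe_toBasis, measureReal_def, b₀.volume_parallelepiped, ENNReal.toReal_one, mul_one,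
    ← o.volumeForm_robust' b₀]
  exact o.abs_volumeForm_apply_le b

/-- Blichfeldt's bound for the index of a sublattice generated by minimal vectors. -/
theorem card_quotient_mul_le [Nontrivial V] (Λ Λ' : Submodule ℤ V) [DiscreteTopology Λ]
    [IsZLattice ℝ Λ] {n : ℕ} (hn : Module.finrank ℝ V = n) {m : ℝ} (hm : 0 < m)
    (hmin : ∀ x ∈ Λ, x ≠ 0 → m ≤ ‖x‖ ^ 2) {e : Fin n → V} (hli : LinearIndependent ℝ e)
    (he : ∀ i, e i ∈ Λ) (he' : ∀ i, ‖e i‖ ^ 2 = m) (hΛ' : Λ' = Submodule.span ℤ (Set.range e)) :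
    Nat.card (Λ ⧸ Λ'.comap Λ.subtype) * (2 * volume.real (Metric.ball (0 : V) 1)) ≤
      (n + 2) * √2 ^ n := by
  have : Fact (Module.finrank ℝ V = n) := ⟨hn⟩
  have hn0 : 0 < n := hn ▸ Module.finrank_pos
  have : Nonempty (Fin n) := ⟨⟨0, hn0⟩⟩
  let b := basisOfLinearIndependentOfCardEqFinrank hli (by simp [hn])
  have hb : ⇑b = e := coe_basisOfLinearIndependentOfCardEqFinrank hli _
  obtain ⟨R, hR, rfl⟩ : ∃ R : ℝ, 0 < R ∧ m = 2 * R ^ 2 :=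
    ⟨√(m / 2), by positivity, by rw [Real.sq_sqrt (by positivity)]; ring⟩
  rw [← hb] at hΛ'
  subst hΛ'
  have h1 := integral_max_sub_norm_sq_le Λ (sq_nonneg R) hmin
  rw [integral_max_sub_norm_sq hR.le, hn] at h1
  have hle : Submodule.span ℤ (Set.range b) ≤ Λ := by
    rw [Submodule.span_le, hb]
    rintro _ ⟨i, rfl⟩
    exact he i
  have h2 := ZLattice.covolume_div_covolume_eq_relIndex' _ Λ hle
  have h3 : (Submodule.span ℤ (Set.range b)).toAddSubgroup.relIndex Λ.toAddSubgroup =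
    Nat.card (Λ ⧸ (Submodule.span ℤ (Set.range b)).comap Λ.subtype) := rfl
  rw [h3, div_eq_iff (ZLattice.covolume_ne_zero _ _)] at h2
  have h4 := covolume_span_le b
  have h5 : ∀ i, ‖b i‖ = √2 * R := fun i => by
    rw [hb, ← Real.sqrt_sq (norm_nonneg _), he', Real.sqrt_mul (by norm_num), Real.sqrt_sq hR.le]
  simp only [h5, Finset.prod_const, Finset.card_univ, Fintype.card_fin, mul_pow, h2] at h4
  set d : ℝ := (Nat.card (Λ ⧸ (Submodule.span ℤ (Set.range b)).comap Λ.subtype) : ℝ)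
  set c := ZLattice.covolume Λ
  set v := volume.real (Metric.ball (0 : V) 1)
  have h6 : 2 * v * R ^ n ≤ (n + 2) * c := by
    have h7 : 2 / ((n : ℝ) + 2) * v * R ^ (n + 2) = R ^ 2 * (2 * v * R ^ n / (n + 2)) := by
      field_simp
      ring
    rw [h7] at h1
    have h8 := le_of_mul_le_mul_left h1 (by positivity)
    rwa [div_le_iff₀ (by positivity), mul_comm c] at h8
  have hd : 0 ≤ d := Nat.cast_nonneg _
  refine le_of_mul_le_mul_right ?_ (pow_pos hR n)
  calc d * (2 * v) * R ^ n = d * (2 * v * R ^ n) := by ring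
    _ ≤ d * ((n + 2) * c) := by gcongr
    _ = (n + 2) * (d * c) := by ring
    _ ≤ (n + 2) * (√2 ^ n * R ^ n) := by gcongr
    _ = _ := by ring

theorem volume_real_unit_ball_fin_nine :
    volume.real (Metric.ball (0 : EuclideanSpace ℝ (Fin 9)) 1) = 32 * Real.pi ^ 4 / 945 := by
  have h1 : Real.Gamma (9 / 2 + 1) = 945 / 32 * √Real.pi := by
    rw [Real.Gamma_add_one (by norm_num), show (9 / 2 : ℝ) = 7 / 2 + 1 by norm_num,
      Real.Gamma_add_one (by norm_num), show (7 / 2 : ℝ) = 5 / 2 + 1 by norm_num,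
      Real.Gamma_add_one (by norm_num), show (5 / 2 : ℝ) = 3 / 2 + 1 by norm_num,
      Real.Gamma_add_one (by norm_num), show (3 / 2 : ℝ) = 1 / 2 + 1 by norm_num,
      Real.Gamma_add_one (by norm_num), Real.Gamma_one_half_eq]
    ring
  have h2 : √Real.pi ^ 9 = Real.pi ^ 4 * √Real.pi := by
    rw [show √Real.pi ^ 9 = (√Real.pi ^ 2) ^ 4 * √Real.pi by ring, Real.sq_sqrt Real.pi_pos.le]
  have h3 : 0 < √Real.pi := Real.sqrt_pos.2 Real.pi_pos
  rw [measureReal_def, EuclideanSpace.volume_ball, Fintype.card_fin, ENNReal.ofReal_one, one_pow,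
    one_mul, Nat.cast_ofNat, h1, h2, ENNReal.toReal_ofReal (by positivity)]
  field_simp

theorem card_quotient_le (Λ Λ' : Submodule ℤ (EuclideanSpace ℝ (Fin 9))) [DiscreteTopology Λ]
    [IsZLattice ℝ Λ] {m : ℝ} (hm : 0 < m) (hmin : ∀ x ∈ Λ, x ≠ 0 → m ≤ ‖x‖ ^ 2)
    {e : Fin 9 → EuclideanSpace ℝ (Fin 9)} (hli : LinearIndependent ℝ e) (he : ∀ i, e i ∈ Λ)
    (he' : ∀ i, ‖e i‖ ^ 2 = m) (hΛ' : Λ' = Submodule.span ℤ (Set.range e)) :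
    Nat.card (Λ ⧸ Λ'.comap Λ.subtype) ≤ 37 := by
  have h := card_quotient_mul_le Λ Λ' finrank_euclideanSpace_fin hm hmin hli he he' hΛ'
  by_contra! hd
  have hd' : (38 : ℝ) ≤ Nat.card (Λ ⧸ Λ'.comap Λ.subtype) := by exact_mod_cast hd
  have h2 : √2 ^ 9 = 16 * √2 := by
    rw [show √2 ^ 9 = (√2 ^ 2) ^ 4 * √2 by ring, Real.sq_sqrt (by norm_num)]
    norm_num
  have h3 : √2 ≤ 1.415 := by
    rw [Real.sqrt_le_left (by norm_num)]
    norm_num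
  have h4 : (3.14 : ℝ) ^ 4 ≤ Real.pi ^ 4 := pow_le_pow_left₀ (by norm_num) Real.pi_gt_d2.le 4
  rw [volume_real_unit_ball_fin_nine, h2] at h
  have h5 : 38 * (2 * (32 * Real.pi ^ 4 / 945)) ≤
      Nat.card (Λ ⧸ Λ'.comap Λ.subtype) * (2 * (32 * Real.pi ^ 4 / 945)) := by gcongr
  norm_num at h h4 h3
  linarith

end Blichfeldt

/-- Data for the group of type `[11]`. -/
def data_11 : GroupData where
  ns := [11]
  E := 11
  reps :=
    [[1], [2], [3], [4], [5], [0]]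
  ks :=
    [[1], [2], [3], [4], [5]]
  us :=
    [[[2]], [[3]], [[4]], [[5]]]

set_option maxRecDepth 100000 in
theorem check_11 : checkGroup data_11
    [46405528773021356996599402890931137949385548266498,
    1863904924734988283693411279355892912890324538766608423457346313482558742506634754,
    62047767314708261443383358337334836577568121181786692685969264487769398918619091533697,
    29145658325962199526985485177251895904700003434157458312763906059833967180104501165570,
    1382776618122291055675036613973843898754185411,
    46588216482789299464622563041836336168237833222339,
    1526602495073256832992640807733377687016287171386663363,
    398770938957662385317470087847834869272016156269622807100555073,
    1639171361627731837359678708563566392969030326215070899964574722,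
    1642384945009560961266447281459296820461809869287669088131305541,
    35358612167663434952260105233040931925933919730178,
    5136582498933380358888122391171233361774064153742801272806308595510032550707669287424575657776397423856918265202645744975985026609127279808544698966557364619101670054831927821079221154317122791816210233308621995053304683693616495585600641856140511404364809687877,
    45676185739339210156677716222233426053419885526913,
    45310818649400085239903118270794703195655976973763,
    1356497414215247933557516323465839985032006373544994007161840737598898113,
    45309971379999863448874184507483983032161939815873,
    1594498980904162159720131857129141517610592819815013166810903844793417537,
    45310698815907007030734108852753956952241573245125,
    62047674790273954714937788938522166916692025090648804522801373741144587128254725404867,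
    41201741908268745667760919842788476618393323140996,
    1529590720721331041940599825245408748298613693945610049,
    3849676861938127720596791782667279138607608892441339750919266106844813532131352869164163139864417182009533105324197083253225643486082690757232178242102907881854162817939970,
    90810583296639505743679388936863379526160222383578006903484816145016300383272913948754068464463987882749445489833430377378567608914474500033,
    1523599022015537774480414763998916221005120753639769029,
    52301276559863719100460519449061901723086619045755870942292631048775290408606556097560027920545471080852888518928667516953594075516571287489,
    1140343296450520303064057084176307012327504962] = true := by
  decide +kernel

/-- Data for the group of type `[13]`. -/
def data_13 : GroupData where
  ns := [13]
  E := 13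
  reps :=
    [[1], [2], [3], [4], [5], [6], [0]]
  ks :=
    [[1], [2], [3], [4], [5], [6]]
  us :=
    [[[2]], [[3]], [[4]], [[5]], [[6]]]

set_option maxRecDepth 100000 in
theorem check_13 : checkGroup data_13
    [48652064239718580905293204962408667304214437478606217247171,
    1382774408872729326433390461576205315929701124,
    50121703518256017112401091371384382266609349231742764056449,
    53501928848643055998896708678068138266025548133097212894828141019073,
    1616674423302923286420555340814325843892024884081556796404236225,
    44124767496603821511897974677667434571572822897859,
    45310751830536470705977222053531406262868551761729,
    1529595650426509757904573606067359273773709432721547781,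
    45310762979974622691122295372483321467596624322950,
    1626321443064329162334937324250021753252232190999136237900594178,
    1520616184313830015655475887260585167286442961869634562,
    45310765728601394180177881952064704811448731321925,
    40929015037336341543478343169111210862687627155141,
    50121784287139258033004921397156222070882183028902411228166,
    45469709352327231556667036814376228908632393237609158707669650774450487006342,
    53817820777246254383402048656543697997995397840860563433077275144964,
    42391999721519565811129709885715891105893768541638,
    57334177006334215666883434889071140371775619334769663764464662221278698173188,
    1711793173521210729351664782226196691143920383570037579467151432705277442,
    46588210907178890459159940428770127934838945304582,
    47378461713425931160094966827981972875668698040259638819330,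
    1436851224243898657393502494401435383466200610745020611,
    1523605050849050616565052124414807204768267415308030724,
    41567159097300141023051200062607525442611985972609,
    46679251044311516728507077202291115984809575481281,
    1412875843326833299405985300242142810118781320000925186,
    1523605961394085952221680205636189609662920631754258946,
    21292369230521483267531523351538559871477452801832377619646405834001790626926827198272922641308596797377,
    50023420404450808038299527394617864539200590354606276542145,
    2063630087672491986549788353493453941821112658693039340307784758237853226050586151288158233162753605,
    13894089250601511418137395802729014254358728173253,
    43883170296810407944239736437368868714749653395373722141452241085107368198017,
    880917679500126607927990079880305289500076998976269145327337409,
    13710916583167654322857374689853679813446034581891,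
    6616654854020633677884334120916732273084094045512034243776603392155140264054104569896760975856184780013121336633158529682851769439944116610492120501767951222903835037542926282308693833658201589972690951902491000316530589530444336708108748584739324147907,
    27504353858518980071954539965068618305200841780421] = true := by
  decide +kernel

/-- Data for the group of type `[2, 7]`. -/
def data_2_7 : GroupData where
  ns := [2, 7]
  E := 14
  reps :=
    [[7, 2], [7, 4], [7, 6], [0, 2], [0, 4], [0, 6], [7, 0], [0, 0]]
  ks :=
    [[1, 0], [0, 1], [1, 1], [0, 2], [1, 2], [0, 3], [1, 3]]
  us :=
    [[[1, 0], [0, 2]], [[1, 0], [0, 3]]]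

set_option maxRecDepth 100000 in
theorem check_2_7 : checkGroup data_2_7
    [87037910346005853707308061215738264502174343443416837,
    19819840886149023546820168410427832125163397,
    25957945652528708648680410819234177371668933363390298850509233179722355250545508709039891189573,
    38545465111240814655825699882699975647558, 5579256533998303667138457580642959615842939290051,
    1735902428652640523650860803458699114576041676453438944043886139347636101,
    40925478921755167666877783427012521852354, 577327071317227454372840964628056446941105925,
    19655309156384020659845976015264120672743812,
    167403641896036858546932858637233939645632720437544368826716037,
    21811134127279187538493251751524373003599299886218998363726152957762,
    40925447783027077246556759002186434904002,
    967074456082213127117562297583326026329284920305868998,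
    18186126914395752701989737708745023721386388218310, 42794451306876332283162060175307438264197,
    1529599495284163082219152695587262443767995121679895941,
    31888836496309802632963125116832839867253750073607,
    4757125583802756815023506424039484770031583295748,
    1121753474438149972720253884549097021278338050183570274252835097954881349,
    135044126127666720181032515736224443565561067889460099,
    111120712823848052228373597505474804477901316743627651,
    2618026473300029194338642425652385762338547391831485295645107353389343316429618986367552495399223100923434607202711060095424198,
    138016827187217185296267271044319025184124438092873666,
    19648832778951684979617152903513188216861620243525, 43475054950227188875904280608220251393669,
    2306322495073557074996248127595272637957,
    1517669981063895574358303510238971267142890669998247367,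
    1774801076040670665198280780546293974176877254746611417681472397112987458412493518964450576739733414675568358752606750454361798903741193669677229203851589,
    1379072589664851489710326092364269223986562079663935585218,
    45222222580012036492123800189240083097543476950149936414919,
    5110946871946767807672658570281924952002, 75571194730835027261025986787214894989215175,
    43473803726636805494204459058444607160194, 412835693121728412797180388709561860,
    1523646977551919015867443044750337217869861024562247618,
    604897713789999931049733973182584523333, 42793288439400682474371780133571388410759,
    1280417962242801690933380889756120981317,
    1182623653742419304040037124774313625237984375153490754,
    9236004415256320666280735374009323263786322401479,
    1542689332005081176017930682626107947865286045817591300252409228072935748,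
    37733853569848610339317477386881463063843619185027, 24253501889639362496147031445902756768068,
    1590983127815231321559699887277764584748272139583924286232061702,
    1587800635655134588594422751719757761820909137613789421329528769,
    57788208444311287265192101203796791934232505959189428594616816559488162176773,
    1224527827784928416660250438068496251933308003691994885,
    337853922302508291644609459909913117973137292853277024044778435,
    26878900993037871126972786324557236354646613572479175258683397977845595130090997614373764292333670972978065325607388493848659533381,
    1176543441605862447205299791198441301668401789475661766,
    46498299915667403256922665060147977475559709121605,
    25494911696807047270369949042714826956178976905607,
    1424549853340237522778193004244402279293296261, 1137609897699314115474869110386845062136962055,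
    34802169513331015044864060325227047132231, 621686451085619247702127683783182451982048389,
    34291722685162384491923430804549045164231, 1118129324626272882569221131534656597429157314,
    48978189462843807524613160042029195970486526523741417323874123750981,
    502953823687234091139115867409632264876552625702939483757062750828915241201373170158801202918391680523031742247016903,
    353472851595510936887270396717966385527316792505198468,
    86548448681088181003284921999841033711752455,
    218874398049900130627282220679951026876890543502237445,
    9872804799350609840014656536104072540201995634627,
    2654480269878295559675415861160124813204242138819,
    1529639586919891265355014653217865758862512872004634563,
    17449251708490087886936202957409670641660186363715,
    1642441041928056974780494876146609898192322207654246210636736068,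
    35140798016131814753578568597169842034375,
    2183172882058234634280576023835650513634351149256818868765575521739886455736055650932008524439492487,
    1329804352785195519465993919308166762934138306,
    12224553184033842736498460658186748631516432809108356165882941107398,
    34459703864174157146853261350323576010690,
    1285759846873401735966687895634680641013863637703577973324651525,
    43134692139778512663112943000481599546948, 33439381022817347007054420643144844605378,
    254255391146987274900836386425434863908063702928607488646471748,
    1986800524147444716310880038743922116631298507313125477591201189674953032239139035156915628632387014,
    39559010457497543455385349742131882709874255166914,
    1396706934223958623923293864371576752373329730,
    50951216669799783424124407598477193659578163901580901884688928643618551652203727631211639944193314387578310514535160971541164106035982987519949176705,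
    33952463028873431245195167964009458728642,
    54188620222907405919666576114743405317720616767604476546829099887701230439897340906977996044799599251655,
    34119790068883609073457384425455236579138, 5945649273447111819714451262253879158847450550341,
    7652100843560155549450767554974385736999006524437857593516448969180640210445236563524,
    20023405426597205512339903184422685620046234799932444520633382429293388315078,
    105129019796113718321043871289842845162236949024671879,
    43134609063028679388709097041515648268742,
    37767580434776137818178453208211886820520553322510293385153,
    566932775471546556528514214382549305039641890415127984241946206569945406842357456310620874761538089813182114426916675,
    1229528075917930483752859172202272313802114628,
    40834975476593282580080369490869152708982374366658,
    30208915810244802596218705265373510533058] = true := by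
  decide +kernel

/-- Data for the group of type `[3, 5]`. -/
def data_3_5 : GroupData where
  ns := [3, 5]
  E := 15
  reps :=
    [[5, 3], [10, 3], [5, 6], [10, 6], [0, 3], [0, 6], [5, 0], [0, 0]]
  ks :=
    [[1, 0], [0, 1], [1, 1], [2, 1], [0, 2], [1, 2], [2, 2]]
  us :=
    [[[1, 0], [0, 4]], [[1, 0], [0, 2]], [[1, 0], [0, 3]]]

set_option maxRecDepth 100000 in
theorem check_3_5 : checkGroup data_3_5
    [200687476227246267012232195999768014514537065047232390,
    6328810133614716831903161384671218083781979594621548690456596083137,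
    2563504286940452065249899125293913906338108419910,
    1517659020844127798768417306353030093260808360940405444,
    1359225671383559788746586697660052468053401906479924868, 113792435911935622731956162,
    30601779738659096851921288776040506234930727161734,
    196353734744718731769903890519374666520941336186312661370372996,
    1424550536238814127143955554879895087018668999,
    5992135617387966679275745317734939060790984834424867222791,
    5398483780181889027712244193013012192089113454789,
    2262128272608467222682532282474522485367325341865193027009,
    60052194718734581589101792074944256459288383980747077,
    1529639677371651768668833315748167703086783686951276358,
    1050664669307691585559256742837375672635268004602513990,
    44126362059694280829997151238043464724329743457478, 39483305597889213458019124724896062671942,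
    32929803913802277604274834786906875789249, 46048672216966069647545317604964201883947401097925,
    1316368238754245652551391462635517125, 37096751970437431926822932187416593843272464569924,
    5498971419454454367149643173664839088520139511471121044996,
    1402257194591166138006226463863609020878298822,
    39047983493162832398823433258401041116749720844507096913604,
    8227388979235942199233311455019026832671641920391,
    53818274096196625578892317805528763335961651687363784324250742103942,
    1379989196481792915472899569061004969871884739,
    24759617313640679267339707747319402193043289401031,
    11519313462577693946456158129986798790596477750724,
    1529642602203600386214266209914251812312820767359440260,
    373113974986063110398922696400298998096566918095929581364313986,
    37644762094221548077224191068013239131545817776066,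
    1221545092315323114835208642805372463843721325985332930,
    50123304851442755892491563568887251814421160296172843350213,
    1529632189746147279987508045019913915668560683282243398,
    10875780945326725920015760301579479060203996147137,
    46680826058177963297788731077202968481815100286727,
    5303964212536387633785691347695017505267627943226874433284,
    41020924715610023169908161580521323974201134259270, 1285214774061242791803483522175532482,
    26584385953678724831455121502248759936045801455300963859266,
    5891290225487719205086783517162212458237440656094454147009,
    179821611809373338871859979362743545133791412486284227,
    548857130342036739429130721114940519372195546684799994625907538796845956,
    39371427782477285120496464052477609390557641305863,
    46679691451453290903205531070374622337089197557699, 859544044848504987821608727447007429,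
    1433854422049787415109970562869410630864827932140018886, 1326752832210295945137837221408241602,
    1305983010757438716214597914275786949, 39207170320657092109608777922035993192509379,
    1529632369453821384259617021478323709248961138512787394,
    631827530349051466568639059606106864779620658989722695,
    43845520789170493052211905452620493283928407577421668246725,
    1542701967706008166771174917699048759004635262992168108941578063885565634,
    1046481309660288088064832631057088194, 1046486059713592144289388849461919682] = true := by
  decide +kernel

/-- Data for the group of type `[16]`. -/
def data_16 : GroupData where
  ns := [16]
  E := 16
  reps :=
    [[1], [3], [5], [7], [2], [6], [4], [8], [0]]
  ks :=
    [[1], [2], [3], [4], [5], [6], [7], [8]]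
  us :=
    [[[3]], [[5]], [[7]]]

set_option maxRecDepth 100000 in
theorem check_16 : checkGroup data_16
    [40176045775213620349282340142851, 35937646518006653747140,
    37525085348014882457696664801898043473793,
    1478631246471439829704083471881603824096606196494217053707762690,
    42289313556291485478126631715214251327425, 1207320570377933380282807745558828145650660164,
    1642386219704795396582390022648331383237114946762318165529686596,
    46496861481444573063960087683605524426871269293058,
    1402458046154384822260113979774728970529044546,
    1374090236217820761661017795096920648809990251626954689,
    1116769399089736312631893067998416148086487934967102790,
    41933805750262556102225873917749839925844862234757, 40159962920446156619275670005957454329922,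
    1481704799251384883979446325974686687536760968414756801,
    41263149664289235551168812470767624224066,
    22470937356593328072766158631739579642486532705634538977734,
    38115527345748145730951947156965816529988,
    1392046518027455895310932771746162544298378338184003009,
    1353029725044586017907973088120122581883252824067860678,
    38711042139071848113909695717913867156865,
    1472814761752777733746856695679810266953379218328715201,
    1295413633288051190874087281303262137029446990330196051298973762,
    763671424100050535005011667071826587422065432094439618,
    1257417276032189972173620627020149166541207427, 40922898252125820964765588057902545008770,
    265208852276243684744931789199164275354105026,
    46789971513771370749692607142339133086998479139239507306440, 20213469709113828374606336128964,
    1260120394068881930579031654381113343974931393, 1226887311933048402830091347691872177451318791,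
    1368922022827791190668720502687828799756992452, 39901988881514597188830226807432564309953,
    38540810086059905741369816642823880179397, 1085724003890759351008391298,
    41568553068182097949264561272757576215767975886785,
    1402243661969958253276578985626593503261881410, 34609449417992468264002,
    33428821769577516068930, 21021712478954786485933291636927211168389,
    49729471406494467348528022182042819451583788805768033294342,
    46496861473196780892358286837854866160674519837059,
    1346698866697739596411479069861041345615062596, 1235815497540202680545404357,
    44031673156238905205195557792460022328313717604103,
    1164608275181024710647193531495666768033291453841270340,
    989890172670342663338619883445661182147553731,
    1481702796898270929746126719265042912071432574645430531,
    1379945638960348037911867439161925352166686145,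
    1269722240373097029646042683984640109069550018443595735025892871,
    1129183740194222366875157819379977019258370498,
    1446021232146799438592600206466488461035767340579478214,
    34356374994027059464996706017521841425390965517187,
    1368999782499494257202098006061568049715312962,
    51719516524574106099068698154204936289973225650594941301888380926022,
    1380150495391510766506077815354190952550070338,
    1454996133642740824687026854889822376643616278594084359,
    1385555538046449309412870150101247847764813890,
    47579302557476315813027787413083433127410316944711513866177,
    44572236522002378639401282208864493131696892424082361466239460157942356261871632318401,
    691741243279810681052360214414702536801597150225160646,
    46588216483554947770700367048256994445907330137666, 31617992200454487654878257676161,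
    39556139262157528475184164883259174651069074635970,
    1385539890447131512350553437894240708440849602, 32885178716760906666761343086536,
    39226555507252135632558788541634, 43473725710661198024840209948904266064261,
    40494244792516278877431833655490, 1329238573287587250745615294830806819356392782012014978,
    1265697288273353888182504600869906595985841671,
    1555654519707055996697071566277240667691616703837916234877432130,
    37821891322070668355280840068731454797856242924481,
    1265692943006304038959168905490139653687371972,
    41565570211144542191641130887270554958296550369476,
    1508921342318430827673101973260487911559827804144166469,
    45217325812608691029020775893341888550519697370821,
    39741475256966247835446431910545527915084857288900,
    1433810204712022384877195576901264151969304273720934337,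
    1379984942485090864922257632964735100923374020,
    39560220381732838839963495428857377232658247148613,
    1101830480273549310796518073184715781679811369224961985,
    51461867799667267446936604062334907989724560145426914475096341398075929078468,
    38645307181892067328529161238829297923850057704581,
    1421756906773944677258286655740577213141022210,
    46591309980026741651491556848108047428738304575211533595714,
    1526732680266304254170572366346566942625963420074409707566199110,
    36057332294977248260260643305154, 1391953436378611252559679600967043960971483675508170757,
    1296361060375703167649574942732697719386792133,
    1723154447365527635468016829519120105302020109250313075586203737660029195893495879,
    20213469706752591088326667299268, 36691176937904476794526017615042,
    40758027446783166384426790637122577788100, 34153370753429424991376932874184,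
    37958866223168620039399062728898, 16176241537871122348087879334046582765069690653765,
    40561306594335732731431320244930515841869974400197,
    1338123865374276163690751389834610249475809866082863109,
    1424543897991082533745159862807922477755399555,
    25022871958826335538632520175276003547944196486265976225729,
    1424544238263110333071914997388522887678419396, 1335343808231551299749147317979034576551476995,
    763670878891336977194707304952307420692414231291750597, 30984166892817567130840115457992,
    32885875057442060364460490778052, 1344066792922035034714637447511357482082305239335135365,
    1134763007351055817948389214535256438659543362, 1148618878667972349379691913318716201985371587,
    39138304928361840929172656387771922734154673142210645518146,
    981573163400853675613437930397893414678036161, 1168256406364857796703898780921508944981065665,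
    1411558570265906858420855658050815796154359631228658773224381854502679492,
    7537717951985964230937090992072, 39530719576105497504738584202248501324635847360969697408968,
    36688207870403419578483068925380, 7537717951985459947630357541828,
    1313152302017064442082875047732153406673987528,
    1463924445676065757449106555857349974706915152123624517,
    1421846478339279384365108843215810880725938113, 1143034253198550740439126861908603097124529604,
    1015284193260013642682194614099895874, 30477252639744042559042,
    1377245075676590317361980570582957335901220808,
    46314132017929748682079852284522062722312020492035,
    37089582073282445596615726182094334358493612631362, 29886938815536566461506,
    29591795414229554718146, 35310191760792233009923747240501166990788, 28706311167121614266434,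
    43388657720946186481437142922938061731847,
    763672798375007845311777098600950852957930935292196935,
    1009354831903606525218862373767110665441571595953294709710964805,
    1660270934075810645144631296334991358131062484443787991121676475618621447,
    667883147796542913838149353945501309275728435162109380,
    31779698569132816543721916297908429700023459252660040821040776639829185263425,
    54403454204177262018793470692581803334239857801842378205310186119151912969794,
    805865472505245442802429855458916446513489474,
    871279502773801721758690595174829799695808997238067396,
    18982287217030841046031896153735590805448, 624760981689526605297082224049516179995354690,
    32931621341620047744965184617966748128708, 30986575144475654078055682500290,
    1067129120942102523649463552160552900, 667879125779118245261559865276643883484796423348977608,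
    28504876577882553967036925100390787332040, 43473707528750094592190283871935143344065,
    31620419787402882612321056810178, 31620419787402882612321056810178] = true := by
  decide +kernel

/-- Data for the group of type `[17]`. -/
def data_17 : GroupData where
  ns := [17]
  E := 17
  reps :=
    [[1], [2], [3], [4], [5], [6], [7], [8], [0]]
  ks :=
    [[1], [2], [3], [4], [5], [6], [7], [8]]
  us :=
    [[[2]], [[3]], [[4]], [[5]], [[6]], [[7]], [[8]]]

set_option maxRecDepth 100000 in
theorem check_17 : checkGroup data_17
    [1421759536124555901238744877466262427383494916, 1382776788320547154513160916375287065210944002,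
    51188275622821931117031730628758513935067097315410543148612238668227,
    43133383718528118964913303484735158319555, 45498507557429151103256047149528319701762154164039,
    49436770748340771957372372890227367596821447874758691585026,
    46041416277883092901809977637393104418293269430209,
    1260206744733097540227616857562002389383313859, 40408831583179193930193723060419,
    1529593002862723918946089382773471272746042643601124742,
    46588127453352543622663225867591132974366041702081,
    30974082210888622022400084465142902130392269239493,
    1382767948951781174368945846125484628716452100,
    44580037203028775675848029398398169673514558455617, 39138900459711278834445843688921206258690,
    44490153993872612764540564474712787386500269538945,
    847451280524015875965349060308425874444884955480910533,
    29604764605844222567078411896257437429518491087965337097331321924100,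
    43133425178858276057155009772862753045506,
    1359126008062609969788190929193343619454939421927874952,
    1357723844411357527368894589153754842266660868,
    1445878373054630411029998810575184511853805841183702274,
    36274871821270358611039195064843542184532163947268,
    1093107434458095442475197598233319111651524417,
    44580073363395084843584755324889375211394974219266,
    41567106267693027489165229671369187684326178046600,
    1269320851245908945383538917369451797101456442406370177,
    45310598538695279990524916900614131732568210531525,
    844458033832484784404605496752725834293711989035497859,
    925253674157300173445324304367865467719285500467642114,
    50023492291787205264151887367818071172738611452067470080514,
    1508690422146705440996573046658074322486413854438062275,
    1457848985599988039079239916419923313575699048506194946,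
    46588138489738546103692481384924394593491685239430,
    1529590720657307767714526300791037973934335107101031426,
    46678939002494771752944305031601465000344441417988,
    1227473939652197411613078768945566377377124844017283459,
    1224450102069503933843988547888196303792983692965834947,
    42207993307498433045677447077166969451952868707080,
    1484734770450494515626720995250103259849662118614006274,
    30219252725292546414915845326107741227832325822978438900998,
    35813912497459608793874195963869977849715763706882,
    49924930631661175389303610761834887558722090634767270870977,
    1388959916862646868973198942053587023208909997648967682,
    1386014354008975389811860006157999096804608614005336966,
    26954690704679252076746226678585537708212005115079] = true := by
  decide +kernel

/-- Data for the group of type `[2, 9]`. -/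
def data_2_9 : GroupData where
  ns := [2, 9]
  E := 18
  reps :=
    [[9, 2], [9, 4], [9, 8], [0, 2], [0, 4], [0, 8], [9, 6], [0, 6], [9, 0], [0, 0]]
  ks :=
    [[1, 0], [0, 1], [1, 1], [0, 2], [1, 2], [0, 3], [1, 3], [0, 4], [1, 4]]
  us :=
    [[[1, 0], [0, 2]], [[1, 0], [0, 4]]]

set_option maxRecDepth 100000 in
theorem check_2_9 : checkGroup data_2_9
    [4262990356643744024634802627287544268681, 4348063544522374133549370526997697236103,
    114597843936090844106371730556128583, 1385647584421594851242005582419639679930627014,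
    40172370567451556010080778555271, 42112700339906077847696396028722486152841,
    1424589155579725330744105479652352203931553033, 131325439649255528544220095052565344319373250,
    40076325644772584326036665993396060664008,
    1529640774445978847132764783986969997942178766477603272,
    92424692997865217074222567600309839182499527, 1243641072550063362398477396058665732,
    40752697440605869446518915065150188027842, 86763755601446313181584196729169656708068868,
    43479118160039829980061199963840409831239, 127616687243532303310138807180035145,
    1326752280345196701899819688373878466, 16894854961073799741958705305290501943105991,
    424643295261762650857649813313060764140386665978929496988051716,
    45950236807453244643970186020637072251451649302984, 83176786302050552582819256519,
    1251839029276180497659196777558498627368871878, 1251839029276180497659196777558498627368871878,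
    1529605889286943904561435711479157561621352409798500616,
    750036530430489532181671092449246883803656964, 1421792977070944512742063103967990656981336965,
    1379954579153220383548877131611345858404205443,
    2656847058620712713366181031338168028972548651970,
    2840175618428796465096134936948586525079103587075,
    320641678764316104186333786244647893059220618430694088,
    1274140455672671614534922265096270653012802498, 1274140455361395409705247582649566071378706114,
    226221682255602981196210158883034122139336642, 1413438953010039041667384531529891180921841094,
    1079190473169824990508597271469691669242344004, 1184943427094107240871929025363120848451695172,
    1475825004935220861599659398751507325436462589528021447,
    306941592667212163425512197445351899524130884,
    46680296534585081914799448448679715633803462511689,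
    1251839029276180497659196777558498627368871878, 72904100252276811817592046074534921,
    43474021970278762743392300843643653324738,
    458095820927619120606024243302914808530104986630331465,
    1296441880460047616224134188307334097401077960, 1424588137237943923758348337438680749705428674,
    45584170330403113844844146816329313603948816661954,
    329576390980715611671845052693607695006388484680359559,
    8687910722123605264722807004343676376961744271108,
    1227388906972129077096104202244404291969377416509534145,
    167481120702654890730256510065311831610942980,
    8231096559621723906565724452365780216070831118857,
    5488060472602746656180172901098531053253479724548,
    1235189351408172859908555723041645369097287618,
    7957062223360532383318125178373632428834029729474,
    173862522735941203920657671630548259516229376966678471,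
    9625212916100928902115320074254638223237, 7957132023788871711920423838090043311947071465283,
    134239780358697457296262174340171934076236804, 156362475303602627562548749134054758818084546,
    273535805093533209729003682801999488560811203434086980439316553,
    1413409355967921602966341011409521393570835910,
    1224430093057607585521833886926048197719781942294121989,
    8264104201918670966757217291935343048642,
    161865787599811684245046487132843924976239534141478599,
    53608864195501043077054351743168071003658740458798215156930722294726,
    46005968518236260666811129587143494689810670297372451489224,
    8435278382445665541985326167983395238980, 2470839365482339623081312043316634573660594706633,
    1313086960896616301806567640944458909605981126,
    11978798024213795240711817679421542859046857687240,
    1251837668146712813905342924024039003765435334, 1405126114136121983502671103962530237026438217,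
    922142138414737294975994223938647141216188344481942789, 1098422344897279446285256251599526025,
    139634194021149098434150904278874996556762947,
    5757503384996198316290703393932940015041257936969,
    1341043371843400770186346588069474446480604610,
    368495634150979081826799904400921583242269008832170185,
    465911986165666799233654002331369369195792840, 262341378077053191621145205045608285563190722,
    1112550568092935707855755728153099419840028872, 1201749298000360606549859155015927973944574408,
    1402288579419252291033031003317848876161188040, 1251839029276180497659196777558498627368871878,
    1413430112818459674145414704533564681095380418, 10301340631829876119589032961523142721474,
    1529601226867315375391943849824698328890348087181219401,
    1424568567216505010443189004159657945434484356,
    39831771085291117093953571344781503921276386875465,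
    312610617948482378677922811469214715067272583, 136992333648830754455794814614429800994115395,
    46680809222195224735362691266425682292391656095618, 9434612185881970032168400952773,
    1299255963155041589594162403122880894931765192202259971,
    323582928834847377639590372732489657456258116, 187198436415573164927609809380193983973695045,
    1380153220334858541744949771533043943594019272,
    1014904473403072193169616701764689424420339751049,
    1616723951023483285486127582262157179599439009812086307290180676,
    1424584054010583204865699638031142286122035656, 699772916877395424177894442322190590319847556,
    36635327273320447946294473851178115673758655375428,
    1396681326646629013536852572819371810099526660, 2820580471428224467061613298758944200777,
    1251844474396141531361442052266204715060334793,
    31096049782687970949101413088094414774263006413459816557511,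
    624850647967605441863083508060703887984885698, 1226734364134621632812078245570801667477311043,
    1045645610248797337458500926683440322338622664, 1246173160846164908850937692192822116451712706,
    12515000967341173813878179695277618998983,
    5497208349560522854976017669041543464321732902341241353225,
    10754298035591482785813632730736244585802793559155548559999606944872527878086,
    49338685076100746437300314984920271578558424497664127307077,
    37573890715319096901756944502658642452523705365543566736834,
    5498160294183101904393787304614314017364074818908291632131,
    146810127824960683803669718088276112402432713774246727,
    1162626520575776612912468476944674117556198342,
    20290594666622193906313700536582006034280042555662219733737607756245294067946008814535,
    1162626520575776612912468476944674117556198342, 14557370372980112208556898271678271950531,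
    233523585092871262298367826215810284252232189482400901569388988918647956491709831,
    535623514241427179396702136074612351516613829,
    20928084404741990850514791559553120403815403920963,
    1413439633367086713683741280947538225245997256,
    305556252888684166007020782352450869843982568841846149,
    1616728660115963347361190849832902090806915371557999105601075268,
    934110753736468524563315271252881185119043266, 337451825082844267106060784479121433367359561,
    254229594524007811282085512326972755430255469499056553170612233,
    62049149582096777825766988671031215743488636762103026690074289688943741767594369383618,
    32070529062719607771075054507957542720507807366850,
    1251833584758304692041375728280690862619449286, 1251833584758304692041375728280690862619449286,
    203792257180150364981303936421190977801582285412301762,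
    592899617128213391141033205504193820102886872441757705,
    37916995711569690955767940003082453388347849220169] = true := by
  decide +kernel

/-- Data for the group of type `[19]`. -/
def data_19 : GroupData where
  ns := [19]
  E := 19
  reps :=
    [[1], [2], [3], [4], [5], [6], [7], [8], [9], [0]]
  ks :=
    [[1], [2], [3], [4], [5], [6], [7], [8], [9]]
  us :=
    [[[2]], [[3]], [[4]], [[5]], [[6]], [[7]], [[8]], [[9]]]

set_option maxRecDepth 100000 in
theorem check_19 : checkGroup data_19
    [647110221193261419737127364255220683736443400,
    709840756478814566809175911015213280759510036415445640,
    1005999816391699137144538656641890376291543405566262786, 976495987664964238384834649811709448,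
    39300824510250286998031494674117, 46588205332416669124998188092575149495391944342530,
    41094194839928536981952051260329702817665, 34971975669332590333365159056328395685825,
    422499214168177734862870372405931553432547198733741765,
    1484744539835657921696807770763420303507598391510100419,
    34291410935490764143101164137380921309635, 1084713519143555491117594491507439414771089156,
    40416465021179979587750436578621275765250, 1143294402783311264298963771258447237843363464,
    913255938344501068483329125175857193992837148950232578,
    1268525625119517417585961788164527780228300481, 1382776194158224118960934436690717097871894213,
    37826323420954833940788562109545671108875868240323,
    503251294388595700465483098295323355614520152445544005,
    1215730478213427841153734075080606315188484291,
    43396848873512984123813014500443698757644836989255,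
    1418963102432391778655007786175722783223378371,
    1526593548953829342299956894554026734550256060243148737,
    44731913847357911272306749636622779384624233295953170366081,
    42025300034702566724109598468661337600754370805633,
    49043871498438519805494987361931255204227058251789200621441,
    48652061261092497737469470460946501528556583635144652423041,
    26959747622132079709879588997505579648751316952454,
    46679265062253850706088491645122605283683154064132,
    36912297021725285291375105016498553576339385155521,
    1260489266696196736169147175836249840459888867403921539,
    460296134638312357861365316508363463420278979,
    1520614998234881345626537370298594701515614573775908488,
    1155673660530445338226423658861342251709451346573850372,
    40386716674302674192735630486866494120133122057413,
    1327108299597997769225837666338036612107171842,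
    45124098061783563468294478788311279845555907692149696823233,
    46586795158051420206678275760123758533113228230081,
    39560423751487162766469612692283613378714812969732,
    43848982587668413242746160854854164742817462776003,
    1457850810330510392629722452027316522983314735377841985,
    434471925197039328964203910844801363045659059541044039,
    1412999885465545930280448984858894378393062362782694402,
    43849219572980379064617542919434262266819840738377,
    45512968795143427617058097597616920775197591790293069554436,
    44632101023185207211797318421187859692891797412270257078145,
    30243309092327309808440795895767034572546746027720,
    7778079332340197816948982823831778431990841248134] = true := by
  decide +kernel

/-- Data for the group of type `[4, 5]`. -/
def data_4_5 : GroupData where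
  ns := [4, 5]
  E := 20
  reps :=
    [[5, 4], [15, 4], [5, 8], [15, 8], [10, 4], [10, 8], [0, 4], [0, 8], [5, 0], [10, 0], [0, 0]]
  ks :=
    [[1, 0], [2, 0], [0, 1], [1, 1], [2, 1], [3, 1], [0, 2], [1, 2], [2, 2], [3, 2]]
  us :=
    [[[1, 0], [0, 4]], [[1, 0], [0, 2]], [[1, 0], [0, 3]]]

set_option maxRecDepth 100000 in
theorem check_4_5 : checkGroup data_4_5
    [3410944701343618142166754892658096931721, 1032849496016758472781435599951793063558,
    2135937066711701074066786895889936190022, 607493906276223710567549550064363175875,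
    4668479945029543830689420911111851011070929079430, 40069645838368243989293162801499019085062,
    40070741453411772194838998983016104361667, 1173900403365581448658406119364165571,
    958165967027239847117336146954, 527342258068560851755785727877702343,
    3751120587110806945249744448621851507585, 1326755850709605111325154509940981699,
    1326755850709605111325154509940981699, 7494187652574261480781369742314296090312,
    92028522664767045275055198300706734213, 45951619466591107100861601148054415005720575698625,
    745704275429854510036144726048271607976401292300066438,
    156376769769541022618374790065202348846847494, 42795500200679662551611688678849886944195,
    9624895914247139586121669593923561274440, 337656843900607918479073443176049359240658883,
    1129041331862756725139833878091153208965890501,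
    84231468559097564754880852720771120699431182110392259,
    36086673113684368720276467793097108045800971272645,
    2563886261800195551840119062243542793173670666141664839561,
    799372254052544006576332190585382056085046116680327690,
    1365385266766689145765019845061191723041810994268512964, 1056713465791120639229779070807082697,
    744505070942158404509482213516854047373588679, 387651812180860729156227795089051499905639617,
    7681592332949483270048105784880968910371075277764, 34966399106147042674008457547973891653571,
    9706059383562851987933298411269255292353, 1380021019591666572112079842502246056245616906,
    733318547370488216290378336745957176203509699, 1326781677673524032109974811796831939,
    2644091844825180878744629448051880433800, 778919940772202037380741534793183912004,
    40332074511087623162602621009859, 276266335910051936155251944245081137549213635,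
    1424601575925018336493767922045399348724139657, 73088151990807432140920513131288968,
    1324159624144815311845478724092107016, 682981543349421805473355888465142721,
    33264987307981579603675213294646302128066, 376501013216455635370007847053502249168945604,
    97034040389244241313978275680127058121, 38276835601604413518798882137025,
    145351025529913086907919547056364170489568392, 647755884980630629469016782219871307408387305863,
    323631936308021916475624074633256081752775880, 162077269261734449983538104331443391695252929,
    148354504194106887425773685033959363, 607943133946665302708370358055978656298907277512183369,
    1326793715402470465637698503937602247, 36734540399704322910289362904398898251923479421962,
    39836955249802118692691144079199328891614110923915721339527,
    1377453344603598683546732841800903582340090265539,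
    36091735408712473803697187543273346117604980555715,
    38640654698625854256457460092692360288868006733252,
    37183942285674662555445247243275002424393956623301,
    36091735408712473803697187543273346117604980555715,
    421136777710421104995847240936740998510440775, 148177917803935123595111730265356600697158595,
    39371344328569788052679120231327058714126897638922, 23741131020997256870497618905163668727236,
    18552957622348056308928799839030902193474039314371, 1326755850709605111325154509940981699,
    2644424136291693408820983025657293576264, 162075308442669474334990823933370634567118273,
    1326755692253279935222526595733520323, 1424599538392686765970857117361398349568498056,
    1326755850709605111325154509940981699, 4051852928585214499230681602502,
    20206718828848819815182780895170, 1243716965685236266397095996481066183,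
    1326755850709605111325154509940981699, 2625753399816991126895217142721,
    37955583761617611277316655427484458872260, 35726348848666856057003127384059441012237500940227,
    1326785076926573926519849488388099785, 38470845716503767093354440373336581515433547597765,
    1326755692253279935222526595733520323, 1077482652345196485378389893017954756,
    1326755850709605111325154509940981699, 1377543172197238478895815462417659120513672641,
    40489012372670904606853959856066, 1326755375330958471608258913273774019,
    1326755850709605111325154509940981699, 38376318248113816119741009126938214992009,
    1326754741486314954083913739404443587, 1243712533879237847283519313378665159,
    103534751581363836751400175315430277254549894,
    37282581221383706510162816405844083070309803266310,
    46681113207242822658259021340854522871883524897731,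
    46682128066482794393672117293075028375698153914306, 20206116793237186100809366037441,
    1306023577191683851423138188544422087, 8603023550826512900335417273204504561605,
    75493274884053720391161051603044293, 36822664671444258585528345956562826354473228828611,
    46317017198956228442791350948304435514158543398087, 75493274884053720391161051603044293,
    43758324704093007951827579069655602370008540483654, 35574022488188361064035516317203211552645,
    20206041842197607280629992454081, 75492957961732256767886444766463941,
    46317017198956228442791350948304435514158543398087, 75493274884053720391161051603044293,
    1246191280983731252064937676056896049059795718,
    36822664671444258585528345956562826354473228828611,
    46317017198956228442791350948304435514158543398087, 75492324117088739243541270897133509,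
    1320458978334038514775209344649865215063057338957261700,
    1173791991920587804580993953383768321587192981492949578,
    39390176715379526267576375672877640449987, 5579382045455708717739834323347661031203896889480,
    1088093843897419621780862434476687043, 1162742220924000858179711755441011275679940679,
    1088100816265842122860507644802760131, 1529683525777275116194733896370010811045579526831642374,
    43387583209752109229753720020367778549961, 35361185315126632074569024716879817379687826560201,
    1306023577046773013265797657093471939, 224954245661222139063461839361165755378448206320072266,
    1246220461595736585819126049061370880501806090, 11834306731429238426369609144167280508426,
    565805656543858742065467090191672077564817126421890886, 4994307186813893501031347709889,
    1080405620632095295142259348289612810, 19099989221564984946064912557565143068947847016387,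
    17638002471729791218148551571078466348242140672582,
    47931407844311253903109781088432298034084571586045255753120914491460,
    75493274884053720391161051603044293, 2473964099168286168731744662096896378471635432646,
    1143261559999884051457427074137297146731448714,
    19531652856320082248772832410502629472561351180268108547781,
    75493274884053720391161051603044293, 574993023901933967328641827198963294644557032859010885,
    36822664671444258585528345956562826354473228828611,
    26870006574693106032354120402932515555249097988490,
    31333793217242414056635067043949378609522736777610, 40488876967076005537517957849026,
    1151610045286886825445277904278474081307920325, 75493274884053720391161051603044293,
    36822664671444258585528345956562826354473228828611, 849008278497389839288055584975357893,
    10065688141265936121719246862274, 28940741794164196649366467788637248893546248879893611858570,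
    592931772271746713101600745395951994764269663729895876, 75492957961732256767886444766463941,
    43475841919598181327753091328616282883525,
    90055919113348736759597001395228623213495684132167107,
    1424631520866882808051955340957630208439197129, 27811558596749167497370639881153,
    18643855370362522172741266395134092828452975694785,
    36822664671444258585528345956562826354473228828611,
    10335634464438851301845704897308237706906340498569,
    46317017198956228442791350948304435514158543398087,
    577397767647811557178897398662899772781008073,
    5031625502301219665939112696615008006203649523651, 10636739846221311889207578153772642467779,
    17110357832954804400678961866034989019464, 35360332418465926936045298642576391532756278247363,
    25956473187617087201985907484680112254019648493897,
    6491649454438409155180126578093823999806494017993,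
    1158724814859164371617798826616359128265065959327574215, 4994698841000264574217188581250,
    9986034400855159026075780026306, 1160639264949773827562042165479852743,
    14556628012543586973848520853235293290435, 1306024527707330981840389796821846215,
    1413483871354566389903154286425848586302469256, 20529229051317470457349093449665,
    1002759671114344839035961513135624522329519421363707329,
    5761997290048141317011202717499027681027612250825, 20512836330883084047631009329085795106755,
    693486255268650022684599791858613955, 157527448777083744617315400,
    43136021408498061605598969605865792050249,
    1517716019831692928483456668166785982752310228622282953, 1326765832457070302377844163320333834,
    24030477558103898514571990980262273206744902861062,
    45220824069402833502258746831597135392905036530628,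
    24756868765263659287131795269313726277140059820169, 30346395541355328563879591583618,
    30346714910580991578162566842305, 1413474688541548527893308272398695148460165060,
    1424622088166391816825074303663553242986734791,
    419333870730767614272482661903207491685587411657769994,
    37952142012917692624129893691329] = true := by
  decide +kernel

/-- Data for the group of type `[3, 7]`. -/
def data_3_7 : GroupData where
  ns := [3, 7]
  E := 21
  reps :=
    [[7, 3], [14, 3], [7, 6], [14, 6], [7, 9], [14, 9], [0, 3], [0, 6], [0, 9], [7, 0], [0, 0]]
  ks :=
    [[1, 0], [0, 1], [1, 1], [2, 1], [0, 2], [1, 2], [2, 2], [0, 3], [1, 3], [2, 3]]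
  us :=
    [[[1, 0], [0, 6]], [[1, 0], [0, 2]], [[1, 0], [0, 5]], [[1, 0], [0, 3]], [[1, 0], [0, 4]]]

set_option maxRecDepth 100000 in
theorem check_3_7 : checkGroup data_3_7
    [1196075663760286699991539428329968329923424854211,
    1424557517640488906726185458268392969130426563,
    1487864854740550323110707680651114984445394492193998279,
    1424557177100989589674430859677432194393121542, 1391118472851741633942217603525661950897849799,
    2020980073402739754669636848986944993239108813702,
    350666769483564096120335532023797636698035274530456516,
    755603037460558007132647027857914114907217097, 284759358414596883172822200892194965212625285,
    1218262286386886293923733397789867419462775479715661190,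
    1030183172820864406832728752741465233159, 291056548004884350058339176206896135,
    6217102275139074705209513357228588341980135764424, 33713055645974228121271400021337626242255879,
    1263144916877657135196169209322637770214411527,
    6492547063178739228796986091533857008162886188994, 1103801147602183017623091470926126153,
    5491360859024332142811633448115933029322497233412,
    30246269604646154424908147718823611190556584206474,
    1268746637216164744172538489647185079115746311, 106236590680293272877326776778200947500613570,
    6857752584500201034392893008273021771264339052166,
    4522700011520950992960631618310343031360785426578487239818,
    787341082635001661397465883820249249774584304463321161,
    797555772050249717573165080813653457950205258,
    45121411141716366366724863364350015202620234224725066,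
    46680965318660896217665932364295288417561612461894,
    1335387024515571075992257555380718609060994185, 1282677284550318078549081294729246088370585538,
    722369287787539426620870609203380100819882884, 8774974158313805639934708548257716564293,
    17950300191072610935649894446680151553825571869202030054849,
    40101439926986959967381358927672108020797221804105,
    63138887001832963583343279402231771677627208156890051,
    10509797689339612358737423957275560050426291505214953581194,
    426772544612102178783177326971700571227276870,
    1102782333534927379055189191019073588878338946692721818569349127,
    167953864166386626351102318327854370668590385107957448,
    64296273515260142271417603670602426980856197, 239941860654002306976836853254616954284732741,
    42794451278915062678532270550234918258439,
    1179817570113627739505028520861827172506896030880632327,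
    32759115016312868832057215561297446574537, 1165655210044505649865994202881641331447592385,
    224921003696822512474904797682548209497002359771924356,
    42113663517478880285639957563150692417474, 1424580062611513476868029035385101863075583239,
    198317935160751138191655721076460732385799624, 1154198152190887848939512896090108807371551562,
    1529611908428325618787908978518199412621731451321445313,
    1374590352627356339716972757584654813109487454218,
    30413951588338600105524003138854153060058285350159323986370,
    233802091226251897204647689482255849354982366283679169,
    23651689537779203196037330511518615655305549898330098977354,
    38544930160155075269873755620288204307394,
    473132853871030919254991212871070779827085696317834179,
    755585523339733205849119863335641615712700938, 789280785594106184261511352482917142749287175,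
    2112485762409853003961795158600602988721486252426] = true := by
  decide +kernel

/-- Data for the group of type `[23]`. -/
def data_23 : GroupData where
  ns := [23]
  E := 23
  reps :=
    [[1], [2], [3], [4], [5], [6], [7], [8], [9], [10], [11], [0]]
  ks :=
    [[1], [2], [3], [4], [5], [6], [7], [8], [9], [10], [11]]
  us :=
    [[[2]], [[3]], [[4]], [[5]], [[6]], [[7]], [[8]], [[9]], [[10]], [[11]]]

set_option maxRecDepth 100000 in
theorem check_23 : checkGroup data_23
    [1324359585224557140284806546879773338060815874, 43473725718738969515154304552567954407105,
    1282508167822361137518661370973221810526551298, 1424545090326852327026341731095988501246732617,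
    1357729370219744060719220386259853077628939144, 26980483300527796131752921316877115128259,
    42879257419791874957357189664377323799179, 11585548934805922289914579374102167142923,
    1221239487370905686126310398890819835599814529,
    1484740616465424475718297191404279537999978672815371778,
    1268527069967032457995707455956117698790979269, 41093496718363886421483274319488769843209,
    38925315259067778765605029901734378357269056381257,
    1145954307576292970486585712660338326047482121,
    1460797838652174035011224814471634201192017714429011531,
    823670365291329442396226052847433035796452997305823110,
    41178146372207492596547083610976654815427, 12530936901656399121852036207239129457718448124355,
    44398487188646210779414360050992262257458106460743,
    44771255246438245080105291020045952520569374241219,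
    1140385577773007658916921440315001429049802689, 1232418865080083902103337802710316724078573322,
    46679309714945850631968370025506017837022504447303,
    1185523271491184315241765311929354893961606029801372552,
    46679557540812596713137412853875850949203643691780,
    1179494745850231342771749488969742326140318537,
    1173523898882291663385116898906309380401961585640307714,
    1327107276318067842541665935593152439505924235,
    41566880515874384296935393287035564259757309262338,
    1502976964149004736113817184082895808295280240845153924,
    1278448204440907112580097881057360638486637217214159498,
    1371693634783626418093650698872481883196063617,
    28653943591870451205979610288637304212446877929035557862914,
    831076146256248814703733298600626902855159562, 1424541264928416003118743611451646845961660611,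
    30248811871736563932709245352191150144485173859659,
    46041076398077198080050692916567888517462059414276,
    30799938427164776115248249364193820083096293265158] = true := by
  decide +kernel

/-- Data for the group of type `[3, 8]`. -/
def data_3_8 : GroupData where
  ns := [3, 8]
  E := 24
  reps :=
    [[8, 3], [16, 3], [8, 9], [16, 9], [8, 6], [16, 6], [0, 3], [0, 9], [8, 12], [0, 6], [8, 0],
    [0, 12], [0, 0]]
  ks :=
    [[1, 0], [0, 1], [1, 1], [2, 1], [0, 2], [1, 2], [2, 2], [0, 3], [1, 3], [2, 3], [0, 4], [1,
    4]]
  us :=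
    [[[1, 0], [0, 7]], [[1, 0], [0, 3]], [[1, 0], [0, 5]]]

set_option maxRecDepth 100000 in
theorem check_3_8 : checkGroup data_3_8
    [1254183004729918400098040834164951884, 101414354445924800225427611875412420,
    10476383396691014870230224853909855672716, 80732086415934888279674237567244556,
    10475911136716673079225066677023722051852, 4680344628031624140567466899653,
    13365073493528437218212990474861188145546, 38274335542129764390861883472325,
    43389062894008530897230027534592934889158, 4685256139482292161637216867393491597765,
    259165177244381062990538694, 353659832673469547277235272397700848543336204135965571,
    43304846416890307695973945442311025786818, 38433021374316425710365241967942,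
    1163183589985433160620674631, 43303878312833506011056913495747557923532,
    21478286513437489728350622786502, 37708547566877934714562,
    43218828522616096033045427139313632765889, 1311176500201811962102219615714240067,
    164739037372738561062002336201762316019138498, 6115885863986289952339225956294,
    41386105396239959036705663603534901954679673328332,
    1246435180444460520952065623468690015110066501, 25123212361809528685466723979852,
    161253170635223700660361716406917068, 1109932867802598772827429648817629914603087242,
    230155834935829665107286468, 8768644938745509370778377646149462268297,
    284761059554193939670079361057679045189331393, 43481948158877956569292688118924836172101,
    1332600111779834264296319784884435939211155148, 150796396131455403486300286828353736906204042,
    1190389306141207147639395629457228820014898121,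
    10972385220893631661899978040099265383956857644938,
    37922222644728515478047457645689973150589149957057,
    1481695116382018876645537953573053562617127595149597124,
    21661622745697775834788912456084387250093995383625,
    1413435724118097802230489991564442519734616002, 1424551815226222514317942171903680243046647175,
    145295724307484619704470569115746674808350602, 797395755744294290512778093516162710370487236,
    1246435180444460837864715975673945568630305349, 293098650169468949133107745952112982031209932,
    1072647207938959190660517554295144386, 1075242643232565275419279364318455178,
    8098879975745898252130290934082569443276, 7418336010457610820996549510978779420108,
    11431981277931160065804740334276330869853708950148, 40415491643310567205345862377157421124294,
    38029075570889607508310177419654150171334, 13874572951650843775454097897760085120716,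
    6397447373220803615047772773953619135303, 8941740414574436732513825024136865444549,
    40572155657029149102329544266329693703818560569282,
    1229486049207588220201273662175100393216177093, 10140672676657072937719845768246067462082,
    323709172409335449335118736596166889116437831, 35233675553565903153837924216886123396930,
    36423635664527963699350025602062935465420, 24802576138248800178106194368009,
    1408118052408500616883885898438809109777192836, 43303899110154169933595709354899209977602,
    10302994467285697165738182001542939679692, 340478973675505031895029331037087156995719042,
    298615144910324966754757242171934370381042636, 252119160644467334046731867221224970,
    37413435585286012861634, 1243798413619480589507575177971636164, 37044518715739720482242,
    38907834498967822270539596405707, 35055711107746604613570, 8801809751156961044810319477702,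
    32887110359380608195260649241032, 30668463212856921606620583263112,
    1326747058484721601657910585276566855, 1424553852818810672362455364343421702823545991,
    38278283848392310142875230988229, 318125143609896648461873897436368817153734593,
    159011290006792127317262437676003143454162425158536652,
    293011285696117740872263369069498672921967553,
    4311667944275439926724918377532613454016247339591, 1326753386077325365121717553972189255,
    31302549848735405038783198260165, 37248182214417605508855245334981,
    86973033345951854384725892073308127828017026, 9040710109204595374262728306635,
    32569254908628347415008968417228, 1077612037885099849658309981174563913,
    1077636992171455625648591885188759490, 40173615789085409010432348325764,
    291092996828203091941720803420333445, 1129203147060851978200814468927717585092535621,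
    28760380336767962913981474682310409, 239828267824997783109364161,
    42027174535110774551953197685915141829363652, 332212161714333938749687586340694193091203779,
    148379693652696842076088461040949708,
    30714078172043344437138386594940770466498982072412824209284,
    354556463671430575673935495163672141907496009, 37644410185345731478905155583426,
    956313148106921264160229233683256964645420994, 39220566419675067720004515819457,
    39221651952718056297957459000520, 17544350669469680541410927496519649627659277906052,
    9417409963360436168658597856175174709840212764425,
    15454754257479850678248849126567830268278724439116,
    98934448142044709728562013841154983810928807390693955,
    209819667524492495700868408724521980379414580368342978,
    4480244938077241140490571819186558654516373336260,
    580877303444377479067754611736357259956616432233696138,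
    536344982959297619590354666803669560826632637560280769,
    1335382260860975486985677768146919639056835397, 32886179657904853966628992720583,
    38595002956686078603727009309637, 16265490623278113750819395513234900594636,
    1262093144248173180911513812794205637, 353536076282186132327025247699959834467400114415684035,
    1246165594252144023830458055628760339924142531,
    595856321300242828839476707561001302348829430854597895,
    46680117952780412993476892505729068842410062533446,
    1129226787326166195520783414507255630202493384,
    17968004465384713896321975861071798156558885637408543788938,
    661954742561212471654583630273200162804215150448618956,
    6492257287562649744547558821492187288327422292420,
    6491633177034565203048618825310027373194021882947, 30985404857066816901324921286603,
    29084427068990021176320409639622, 18985693636007356489954345003955675103179,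
    38595186819962494541447588576962, 31618485486023225139379078126534,
    823424872601935479121332919634963916, 8801944929789822412758540557126,
    534975021457958251899886611072168900, 6728876925973394321809546726387667359681,
    886905768007533812099183897119706504281463494, 1419006996736777805808333391426289885654396364,
    1025714022759267320198856145505599047, 1352362189224980899966956379139051868597288898,
    6388766107355922544308973072955482725062, 40500212013026835121202469921733,
    40489283210428328776666462845640, 5023973425111641521796777772894625379913,
    872666301437151503204900659593814009622691650, 1408117620754476535725457152660600224487891269,
    7225449981246494326743656920323368877295126254470,
    1045415331322439929786490516448335706984812996,
    18092291270679242285650247666874651723121004104586,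
    881336446999387680946476231841956332344454348,
    46680246405212878604117234962625295295708328563398,
    1190530359599831081960771686551763367904903042, 184595684418925946012797336721599948,
    6048400669713841465619430342602998721484, 8686781583993897095336357827051832640125918066052,
    19658044543904860784669390299661907922124738, 1240733235265921976947113049229505035644420995,
    1424582013463834283519884512792534846040994248,
    4115045356126129830435402612629476937582625527494,
    574437304445803438740594736500667560078153670,
    694848226236244257680208055142305896390914382204508038,
    616798371823984108114947478418825241840005361650728898,
    978714622475889414482192533500678765726275398, 510682088837878108682885570731334160003509196,
    354534670061826801390993056370622102734514636, 34630852535778014870556046074501019232709,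
    33525895348239446121354291083310626391575352364554,
    488379975573398707765066542798115294238957505, 527256648028610161040031486247217121026293577,
    242819294262570939496785741960426164400218049, 5374694841487071965455330207899450522633,
    20217222325836920279206165931973, 7043152589647551776498961108384001701973118325190,
    619034722688263514361952600322841442177563721, 37644410185345731478905155583426,
    34987447189290477566614032396269634098405021194052, 40489300136570422023790056994248,
    30601648574356607265193550256317398832960692896387,
    11244211620986600940956731458852613574591399583430, 7496427982101865411905166303837571594116,
    37863721937875429890158486133431041451973, 1246149252598897955662652075761169718736713288,
    1338188642613485720176175808006325707072094739181513675,
    27271695521603682324355651945829192429189239811662175115974,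
    496344717494043137146285930236376520, 43392046036759541121396850786738396020612,
    1285212880438639681494029834729678789, 40488313820153815293878249490374,
    43388920157969447884968523833235069947850, 11251370090689704197398435185596287211427699163074,
    30628499285799350665154, 600196358183369820522751756148588169,
    680597329908224394269756002175919686034827204, 1419015159720547266480878646684818763199661635,
    37561018538481166679618, 21027678628966750936521966200827379158982,
    32887112778995501324320813158342, 20217357729660778786833700156869,
    21708222592987349080620658934133219888582, 7501067953614048168599688253797450208331813916102,
    21708222592987349080620658934133219888582, 21027678627065217005969339122110242720198,
    169043677828455336865374873814525896, 345461969772523248776314611524903364,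
    1068113526634696845726771659417291707549722438, 40487194330053763493332938647432,
    18315611029344292985819766114757, 10138310570989949476735340273251689669062,
    10138310570356259580445075066884295208902, 43486024066349252634959272479595834879430,
    8317077145174061364183909913326243004340810851716, 32890585030665814555082348396226,
    43486024066349252634959272479595834879430, 40409590930784495837194529892296,
    21202110529985226606164008784093686195974255666056, 34028119931690743094345666,
    40172158003711316027662965866434, 12982591083853253513944642227642136128681876251459,
    596200416798012297720169285893494090850707301650956226,
    337725744493417702842250960499138863669794753, 23741881556039450063661736952032647030275,
    16725901897923518874618196399699072716684631705540,
    11617058009301616673771707690812976671453085892546,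
    715911841687218437160896179833601056860264147785613066, 32890420503417479332789731026632,
    10076476706702871116166266552267, 35108867076943839323111001512645,
    31909444791965883401893613614778005169159, 18950035759506221435287612083013,
    40489119019648749672979945933765, 1335323570068308318300249200672846503339144199,
    343170601237076936351063508144093008008390151, 18316539277172974017406803558347,
    24085764805866566399734924379228320590277] = true := by
  decide +kernel

/-- Data for the group of type `[25]`. -/
def data_25 : GroupData where
  ns := [25]
  E := 25
  reps :=
    [[1], [2], [3], [4], [6], [7], [8], [9], [11], [12], [5], [10], [0]]
  ks :=
    [[1], [2], [3], [4], [5], [6], [7], [8], [9], [10], [11], [12]]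
  us :=
    [[[2]], [[3]], [[4]], [[6]], [[7]], [[8]], [[9]], [[11]], [[12]]]

set_option maxRecDepth 100000 in
theorem check_25 : checkGroup data_25
    [1268518484475575823381522316184018509306624451, 1326873972034597778529245066988446408,
    1287805940084047607301161072113841861, 43388577282091947912341652326590223315460,
    1360475958048830790577031857962826700251330245, 1382776194025947628502262917493796586081286467,
    41518291265589677615723355067071674479172, 1382755705357457612051926883458749974004002057,
    1405068522617667181606812650391766478805431493, 38546274932402213450816908414216910794312,
    1257508216489559911906091326100574041498774407, 1296448172607156375688793287260491604398568964,
    1112598033404662783210612839889810287717606853, 1424546788794893332141441642128906572957738312,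
    1260209802014561438233784869059031208309225667,
    38558011307418602462056109473341875965412650430988,
    1182322322484392621310747161763506280015724353,
    1529591178840317004251330015879886273906671486341720967,
    1340962891065509518522644591498831085690938438, 1316680406912362016254509333501633733,
    1203552462643913047623651446161637664436206736597476550,
    1313208785735652421626368077362178627251268551, 1134807249092806425664964148259323626385504386,
    38542147140218581594123972976653512078852,
    1398310243980456961006437497387310997102177505866251978,
    39012349532797284224140010263592194984983797263301,
    1101403764481187301549808624978904774625818754, 1405164645509130699606863848217624504332055363,
    41475539404002549996234483868728867424719541005509,
    1090118732848489250438573327553894590764410372, 1341005512237127326386024227524550413424818371,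
    46588152408897004184790073514156686330968483643976,
    1338132181674654594326949444526121984706640898, 1315959540901919971835992589578269475070888778,
    46314184925279354986388355542152420034356722158089,
    36729823948296943128704665143226730039593276593482,
    45309606507301828420358514287303611694012220696261, 25447831444789263335814807837934216188428,
    37550638873445565803556180744447227159429299368387,
    1365092871128287171871444762634554993585260532257384389,
    45310328454117112302503775101883400978351821843272,
    38833589899236860651245110361612635049126537647306,
    1190676172143859140848391914009751565524948682, 1388347299185552621939131096749084015212165443,
    32077158065742644421074777330542188937774077568453,
    26411204692045735143941526047125155254763616553863, 174384916282033418542198304264249797,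
    911689802079329763467691031559235013] = true := by
  decide +kernel

/-- Data for the group of type `[27]`. -/
def data_27 : GroupData where
  ns := [27]
  E := 27
  reps :=
    [[1], [2], [4], [5], [7], [8], [10], [11], [13], [3], [6], [12], [9], [0]]
  ks :=
    [[1], [2], [3], [4], [5], [6], [7], [8], [9], [10], [11], [12], [13]]
  us :=
    [[[2]], [[4]], [[5]], [[7]], [[8]], [[10]], [[11]], [[13]]]

set_option maxRecDepth 100000 in
theorem check_27 : checkGroup data_27
    [43133300644784115292904787488376791071234, 42539011193667268849262622179204217861573,
    41006694620965158035653900860671830434061, 41936688148123853089275164977713837965241418522700,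
    1360471196697112667139174194474609632350433731, 1196180746906050805362430706700107852705558411,
    34631701082072437474880174519654704906049, 41439392055964004418345178955394811422085,
    34800214690103133421756895246820781031105,
    1368232359349669809419635118824716919053781770090838535,
    44031907453664577274412922826476854097643666025676,
    36090782080265825902762665343576209446662662384772, 1243953384804726186240448094512705794,
    1329846893532877100074850286114063465670930882, 1343741300337827781248687748576919704620580044,
    1349317423987471594521508548300106415477193927,
    36451764072650682381850666967289797847153885135178, 38886271813780632550581365727451555130436,
    1296532905390684012912672401520026152920841798, 1160028045078355159166599010547790724785728133,
    659908334971025961697284605341982917, 1402241536417766681766658237830333686268360712,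
    1460794915244950010417322588705629734227453289026649985,
    820770101774550860943524722489975810027072762224765318,
    1352144236910095196659289212249945146933863621,
    46587798592487530901736981624226832246653740808775,
    147299015264669694169223854398962522749055875409831492,
    978876252415206659411153546659305396048612556,
    904484640160560098208732724164912071207463941105079304,
    833785126663169266836394556176635056548531276,
    46405236217734306511667566585311345672755398214733,
    45675648169592902840082239227731555148666698596161,
    1059807987867924797131735697751403778156134209,
    180130186702462771707390509941676021067590653872275393,
    1484740523240298292756291527909865893398726450193027529,
    1026225699099662266015108991842263217224449473,
    43576046988547960610029816280644402573744936246729,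
    33078938306767335878407604280579586267262929162439,
    1313299983759690450117839661814949105434193922,
    26409540544869239716950598208382365692199845479881,
    926088933096132266712320445058310509051369992,
    1027110928736275864182211752608459588396039147777817285,
    29191996877755633280185296183112235052231,
    1081712648932268026459042078884010009401910979] = true := by
  decide +kernel

/-- Data for the group of type `[29]`. -/
def data_29 : GroupData where
  ns := [29]
  E := 29
  reps :=
    [[1], [2], [3], [4], [5], [6], [7], [8], [9], [10], [11], [12], [13], [14], [0]]
  ks :=
    [[1], [2], [3], [4], [5], [6], [7], [8], [9], [10], [11], [12], [13], [14]]
  us :=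
    [[[2]], [[3]], [[4]], [[5]], [[6]], [[7]], [[8]], [[9]], [[10]], [[11]], [[12]], [[13]],
    [[14]]]

set_option maxRecDepth 100000 in
theorem check_29 : checkGroup data_29
    [1212558747653018641941335287233839041, 36508467369399972585245335066097565662210,
    914913815513327808001171554157094451095364677,
    37095436060329052377781315008608800799267261735495,
    46041343971539782939483408087216599433151693022917,
    1173899149335330061599419818019170359917564811, 34971853767695635064275879076436706917378,
    36165593892400236594627542744655649177473, 1185070780225926205586323825448745658887501826,
    37269956613836929125213474318917602403909, 37459287043030092626484796920028889172039799335495,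
    1137548394610949836753208274028731496132631178, 1382774152445897325251410624890917463817025987,
    46496805807425282947219842956175992195895244510861,
    1132111185113634764898351720470398429359656712, 970639553670587634640664157817114520780557960,
    41566886177738164501925638024274985098418063866243,
    1382757229475918385414796687205685709980816716, 1382758934132703922411458512120505547425799818,
    45310810297352835643779539304372023141441348992897,
    1310469256114884036944357646926355579478823501, 1120917256794139369857755676072249791447700750,
    1282497542942533748755950308760271855269758222, 965101037951865821511398343184372004340988930,
    1357727244503945552740705791023125167897739073,
    40018311194516445453397274210720356135021020870213,
    1024168835563992945606353573685615696848627746748978763] = true := by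
  decide +kernel

/-- Data for the group of type `[31]`. -/
def data_31 : GroupData where
  ns := [31]
  E := 31
  reps :=
    [[1], [2], [3], [4], [5], [6], [7], [8], [9], [10], [11], [12], [13], [14], [15], [0]]
  ks :=
    [[1], [2], [3], [4], [5], [6], [7], [8], [9], [10], [11], [12], [13], [14], [15]]
  us :=
    [[[2]], [[3]], [[4]], [[5]], [[6]], [[7]], [[8]], [[9]], [[10]], [[11]], [[12]], [[13]],
    [[14]], [[15]]]

set_option maxRecDepth 100000 in
theorem check_31 : checkGroup data_31
    [43388403620068871287336620571397934213256, 42198996069040749445527552895852992460485,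
    40246142330051947192337842379210822375565, 1421752568186869030246744820349260157073552132,
    39992259801385525753819279517298580421634, 1004183320212110947656811991893314217103948227,
    43473572621414121659604711074926965323971, 42879418096560204794048001896489116951942,
    36929783194912856613046326112969082074378, 1104096082953687492109401885488172065194406536,
    616447816367680538005680741675996244230, 38281529235702111126466439253505309814270824999562,
    6597926724183432536145770440260344927725899840260, 27583485787450889968087552160151202430785,
    46041040172541371510868342653406565903563485280770,
    909327229557286890202090698329359280240780357, 739023050770383433699409431888303781480519502,
    1310457014135215209834011310389391850857528322, 750201232828768854762629335867485355736561859,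
    1165593201103998608540418732109719123928369993, 1421743040425897397857229677400394919871381313,
    41114493261915528025149931854375854302592575595654,
    7328446489244866908677648679025802375234700016642,
    31713739911576764909737857406393289771002659762627,
    1140349524784859395463868787155284412099421956] = true := by
  decide +kernel

/-- Data for the group of type `[5, 7]`. -/
def data_5_7 : GroupData where
  ns := [5, 7]
  E := 35
  reps :=
    [[7, 5], [14, 5], [21, 5], [28, 5], [7, 10], [14, 10], [21, 10], [28, 10], [7, 15], [14, 15],
    [21, 15], [28, 15], [0, 5], [0, 10], [0, 15], [7, 0], [14, 0], [0, 0]]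
  ks :=
    [[1, 0], [2, 0], [0, 1], [1, 1], [2, 1], [3, 1], [4, 1], [0, 2], [1, 2], [2, 2], [3, 2], [4,
    2], [0, 3], [1, 3], [2, 3], [3, 3], [4, 3]]
  us :=
    [[[2, 0], [0, 1]], [[2, 0], [0, 6]], [[1, 0], [0, 6]], [[1, 0], [0, 2]], [[2, 0], [0, 2]],
    [[2, 0], [0, 5]], [[1, 0], [0, 5]], [[1, 0], [0, 3]], [[2, 0], [0, 3]], [[2, 0], [0, 4]], [[1,
    0], [0, 4]]]

set_option maxRecDepth 100000 in
theorem check_5_7 : checkGroup data_5_7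
    [1424615791063348141742547348064619808415653646, 772247703505483761749644681631295016482063500,
    557997667476581479429095726489416187148497104, 1145785355831466632188352023141218244721440904,
    21025070607133583933465743955327352710344177395594,
    9973038761884008063164852013678873591890487563653,
    1263159284937151675836436333684774335806564241, 1326788325387523244628691897343701320,
    21248457800530623867557704659272, 6642980658118157181881440373614930404806] = true := by
  decide +kernel

/-- Data for the group of type `[37]`. -/
def data_37 : GroupData where
  ns := [37]
  E := 37
  reps :=
    [[1], [2], [3], [4], [5], [6], [7], [8], [9], [10], [11], [12], [13], [14], [15], [16], [17],
    [18], [0]]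
  ks :=
    [[1], [2], [3], [4], [5], [6], [7], [8], [9], [10], [11], [12], [13], [14], [15], [16], [17],
    [18]]
  us :=
    [[[2]], [[3]], [[4]], [[5]], [[6]], [[7]], [[8]], [[9]], [[10]], [[11]], [[12]], [[13]],
    [[14]], [[15]], [[16]], [[17]], [[18]]]

set_option maxRecDepth 100000 in
theorem check_37 : checkGroup data_37
    [1134834579561865466371128910132903873, 36251926533945729940252010198683931963843,
    1145954982107323847442851054146595617872346945, 38712371405890595684052025375847511817921,
    43303587130715135750175117311848558493569, 1405070310827022484628266514300554928629905093,
    30898948859271376086289912943540506346634,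
    40416371641677624771224118565556419952577] = true := by
  decide +kernel

/-- Data for the group of type `[2, 3, 3]`. -/
def data_2_3_3 : GroupData where
  ns := [2, 3, 3]
  E := 6
  reps :=
    [[3, 2, 0], [3, 0, 2], [3, 2, 2], [3, 4, 2], [0, 2, 0], [0, 0, 2], [0, 2, 2], [0, 4, 2], [3,
    0, 0], [0, 0, 0]]
  ks :=
    [[1, 0, 0], [0, 1, 0], [1, 1, 0], [0, 0, 1], [1, 0, 1], [0, 1, 1], [1, 1, 1], [0, 2, 1], [1,
    2, 1]]
  us :=
    [[[1, 0, 0], [0, 1, 0], [0, 0, 2]], [[1, 0, 0], [0, 2, 1], [0, 0, 1]], [[1, 0, 0], [0, 1, 1],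
    [0, 0, 1]], [[1, 0, 0], [0, 2, 1], [0, 0, 2]], [[1, 0, 0], [0, 1, 1], [0, 0, 2]], [[1, 0, 0],
    [0, 0, 1], [0, 1, 0]], [[1, 0, 0], [0, 0, 1], [0, 2, 0]], [[1, 0, 0], [0, 0, 1], [0, 2, 1]],
    [[1, 0, 0], [0, 0, 1], [0, 1, 1]], [[1, 0, 0], [0, 0, 1], [0, 1, 2]], [[1, 0, 0], [0, 0, 1],
    [0, 2, 2]], [[1, 0, 0], [0, 2, 1], [0, 2, 0]], [[1, 0, 0], [0, 1, 1], [0, 1, 0]], [[1, 0, 0],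
    [0, 1, 0], [0, 1, 2]], [[1, 0, 0], [0, 1, 0], [0, 1, 1]], [[1, 0, 0], [0, 1, 1], [0, 1, 2]],
    [[1, 0, 0], [0, 2, 1], [0, 2, 2]], [[1, 0, 0], [0, 2, 1], [0, 1, 0]], [[1, 0, 0], [0, 1, 1],
    [0, 2, 0]], [[1, 0, 0], [0, 1, 0], [0, 2, 1]], [[1, 0, 0], [0, 1, 0], [0, 2, 2]], [[1, 0, 0],
    [0, 1, 1], [0, 2, 1]], [[1, 0, 0], [0, 2, 1], [0, 1, 1]]]

set_option maxRecDepth 100000 in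
theorem check_2_3_3 : checkGroup data_2_3_3
    [1200326954567682819315177123663243937987, 4342624532751691896189350823792086320071,
    1475911141535622194458309193198531198729922992303963522,
    75613384746960704860480181354917607776763973,
    11065431976948224550506201000423373837649156606403, 292864427755469552247569986,
    198093259486182157476557253902092635654650310, 40490618060064344846167141779143,
    11491254230479597654671022758096875487170, 1882140387322736687208264367916401812169,
    3918538252892010694445762181607930958723,
    350619088243365703979615258499495114989547435610792325,
    40586806279755774775284976173441964374914,
    1584552049638022715066645870508295097635371604735067397887756099,
    331435594913476029539947385271431531292739869792568662015934276,
    8000701314998880619400824818211533946754, 8085938098415907377716229511497686028225,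
    1317420333157012221817426402003441320440166926556331586,
    1539553263931797316584913383988423053822716734129044895383587779,
    2304878925936015772835077798075513882565,
    884898215819358791243421499368942569554007704778063114108376141380662195995679261000992374231563780,
    236556205927230004090130279000305350,
    1627004383378762058942463200155116512737251429696152546749382847068863977339737543] = true := by
  decide +kernel

/-- Data for the group of type `[2, 2, 5]`. -/
def data_2_2_5 : GroupData where
  ns := [2, 2, 5]
  E := 10
  reps :=
    [[5, 0, 2], [0, 5, 2], [5, 5, 2], [5, 0, 4], [0, 5, 4], [5, 5, 4], [0, 0, 2], [0, 0, 4], [5,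
    0, 0], [0, 5, 0], [5, 5, 0], [0, 0, 0]]
  ks :=
    [[1, 0, 0], [0, 1, 0], [1, 1, 0], [0, 0, 1], [1, 0, 1], [0, 1, 1], [1, 1, 1], [0, 0, 2], [1,
    0, 2], [0, 1, 2], [1, 1, 2]]
  us :=
    [[[1, 1, 0], [0, 1, 0], [0, 0, 1]], [[0, 1, 0], [1, 0, 0], [0, 0, 1]], [[0, 1, 0], [1, 1, 0],
    [0, 0, 1]], [[1, 1, 0], [1, 0, 0], [0, 0, 1]], [[1, 0, 0], [1, 1, 0], [0, 0, 1]], [[1, 0, 0],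
    [0, 1, 0], [0, 0, 2]], [[1, 1, 0], [0, 1, 0], [0, 0, 2]], [[0, 1, 0], [1, 0, 0], [0, 0, 2]],
    [[0, 1, 0], [1, 1, 0], [0, 0, 2]], [[1, 1, 0], [1, 0, 0], [0, 0, 2]], [[1, 0, 0], [1, 1, 0],
    [0, 0, 2]]]

set_option maxRecDepth 100000 in
theorem check_2_2_5 : checkGroup data_2_2_5
    [43477560393502293729788947332104347516868, 1326829693392957189437516305930551236,
    1171107210705141833793719425737031620, 1326798158548386990665708472602099652,
    3940667599786369806777177216964143346028665765828, 42796912691138018553966050312162042344646,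
    1326797207781422599822905425222860740, 101452864144578408129136724914926022,
    555118204995531201801035346649393268502429636, 2653131493574560671764223650404671774794,
    179502267648749019144251472387211204, 1419092073702237742886485802982863421021864138,
    276222354087296975352480395378635416654938052, 1324228944466605429967960022387417226,
    84115681999545693191223977383855385129320388, 5797771031843334005095812862368716818697,
    20924959775522712833050736851902316827782458541899,
    781713661980249017973961633343945871417642482432966596,
    206716354024692263292620186118361056287070661, 1326824781251712580977857820241330116,
    1326824781251712580977857820241330116, 1326802120072572091430874203082096580,
    17672056020918222642684069347268, 1424645132659905193249951230698919159784408459,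
    1326824939717709458776301022830821316, 1041330054136148597108141786071908810,
    1041330054310293388894945244405392966, 262421665479097535951067490547961417,
    1449900959598851599512514949395008645557487473269067446969728964,
    655344966814196756035974657915761030028516037, 1316449370868619440937292953496611016,
    2470368074380176170026137770252135116679482568186114998212,
    1424677121237843232768650710244150682453194952, 1306064143036178528527661330512248772,
    32439118691929835396802488054459305817357762595913,
    170530054347394633421070927201266787550568906, 1041330054310293388894945244405392966,
    41208485335577420549060648813195322879547283898308,
    1402339541802323872938048731305175158771529928, 228980270949533049086551381592444943018043591,
    1041329578941318746044288251065623750, 35358843660655892933350150537719513048110631945803,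
    9071792367322631076548689464377616284108787366896735836661671431819,
    1041329578941318746044288251065623750, 1413526068042832274949927942694030516219605192,
    1088138847543956120159289263257845188, 1326799743179340073383974291435061188,
    1380076310273855461581204945009020623309236424, 1010175797790110665743842408938168774,
    989986814438349461739965630677893281378208199, 43476072806312796931711693770062249169545,
    1326799743159996669992343714671001540, 242771655377984432630748223743736717789696777,
    1010175797790110665743842408938168774, 1326797685655368281671831442881150916,
    46987819068371455895212140811155677071490362363876397513668,
    220881073068602182247901042812687813, 1481836804099866934884795578104583602561832788187844933,
    1095855348718073757046863803929979334, 1090314311647246109821687356239405227444637131,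
    1285286404057402827356277979746676936, 42136071538784612716398475333607814978604747,
    1090223372783920737505112649033675600002640262, 42119906329960285769868713574418564377841355,
    262419447936879622648495498982627781, 1326795308781477896165161478134071236,
    1529708012865294436131415666410016583757078895087874248,
    1242288369737840685143228186107244869351748104219915206,
    18972364918222366740104761615722521752136,
    608030999596452010666788056853232445977730238543844040,
    46318444490206531256041815196928679865639944483016,
    86743346652999165468930945979108021198227271, 744647655827411068799902940761268176506063813,
    53822599914074809533244485532030713241479491070689651751009726349251,
    1402367874172428513462446225182214580443709124,
    13800434518260547305352701616185098525970899541387,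
    84084370455664478221814698751172087503978436, 760935724220587324618874574745192902,
    283325984505735224641267141, 1326833964547005531291395671491621320,
    200193334671079613229248138325627847, 1285293688096586018161058694910213828,
    41208596874687187075372709742266827337574589431748,
    823631355760075697789475526037822254744731474293245130,
    25415250787372913973050667846082480721879670770057997447880,
    61567773137016314679860816341578508694987768255194081304020370119436056944609327133896,
    46318422199323539860427225488806335002785383491721,
    15505595558215515087399527888007436699876860326848218900101] = true := by
  decide +kernel

/-- Data for the group of type `[2, 3, 4]`. -/
def data_2_3_4 : GroupData where
  ns := [2, 3, 4]
  E := 12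
  reps :=
    [[0, 4, 3], [6, 4, 3], [0, 8, 3], [6, 8, 3], [6, 4, 0], [0, 4, 6], [6, 4, 6], [0, 0, 3], [6,
    0, 3], [0, 4, 0], [6, 0, 0], [0, 0, 6], [6, 0, 6], [0, 0, 0]]
  ks :=
    [[1, 0, 0], [0, 1, 0], [1, 1, 0], [0, 0, 1], [1, 0, 1], [0, 1, 1], [1, 1, 1], [0, 2, 1], [1,
    2, 1], [0, 0, 2], [1, 0, 2], [0, 1, 2], [1, 1, 2]]
  us :=
    [[[1, 0, 0], [0, 1, 0], [1, 0, 1]], [[1, 0, 2], [0, 1, 0], [0, 0, 1]], [[1, 0, 2], [0, 1, 0],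
    [1, 0, 1]], [[1, 0, 0], [0, 1, 0], [1, 0, 3]], [[1, 0, 0], [0, 1, 0], [0, 0, 3]], [[1, 0, 2],
    [0, 1, 0], [1, 0, 3]], [[1, 0, 2], [0, 1, 0], [0, 0, 3]]]

set_option maxRecDepth 100000 in
theorem check_2_3_4 : checkGroup data_2_3_4
    [3755074608806211027856216946295785812547, 267799196292123125376154882237962567,
    2483076295571374337710044506764060526476, 2568141699281037585234327544241811005005,
    30185788731020657690572, 2312937712614859524914995290188443387016,
    8969825951364497918007921838028, 518752124963832951469256554772401591309,
    1025609050511728465244321684168048580, 2654185532698984943412767204409117638792,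
    1357678584444726836566729765354333496984963020, 32253229414815180761876450808777,
    32094671537942541267379393986500, 278546218353183496685913804,
    615579142251401508694651547125441861, 350971034929775898089983873735587039180,
    328051872160166743870714152908, 32253287759945900682253114191818,
    43392396301295995821712088463997872997064, 9452382117800673600456193510101791965060,
    75799857877008234531886621451557186775958467, 1326826676552219427024634682892616456,
    31141617399163338930533016244172, 37602733637668200159377030104166099750860,
    10250161342487697501628420655353950266069637771714, 5206277248490817817178050343307741134660,
    1311236171861295276980100154620542295013375007441482178, 143107710013034975690231628,
    999679331499224467240663164892991687, 8525058423870269378729130815214219300812,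
    36999732465910882439915722059362051667034743511373,
    226105314585470318169171363441242010305335049, 596885733731341752508427765223295080112333510,
    7958085290806483676867583724081754498637270283202,
    282152528590012760426076599931189595449099206, 3734862752617202199096746869704,
    36685328272848311778325576450952, 485289724225477713321953200520,
    244443210132977666033814890914910343, 5475561577006787668059055436231,
    5376537961093430198119727162340703178700, 254370210704467893982337549,
    33520744731341875955748105809349, 1968792050877558035356234046180822346693,
    128615597627239106656027869187581730042872712, 28338115762697658634202905981135630888773,
    40751703322074249136944175308146034840263, 6559961198573491608074715736666370454343,
    40751796973873211008606401390265663262156, 35989935899404363501911073170701076774347,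
    40490850287309464757063970553668, 1119134395996167374329790897929,
    496287679435594396038128701395861451, 8439432598886008035351530208257632406344,
    6398693439373059018060266637778143715081, 39418229913738625418140456748491448801956301,
    14510253541315389414171742335400010947098434, 164999449269744347602476419357425698248950221,
    33862226489036907013217972472868002751427, 1424554205126578081258081806007739197459367884,
    2118211754280345851188795831446995037600117864331,
    39041614038193345370108766947239950552684326460263173097160,
    1036097507383663792677154389144043458, 153700023369567763085106250854600648,
    1235602329663424578768342984, 532870549012613017083494031163268765709657413,
    18507000834015495631620988427437638, 20845679875474285488616495088071,
    1829922527176791803744584210893, 39273014871392803932592592640053773,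
    1316449369795403734998701376224551107, 39856751624313986843341475701123,
    1015235630030265062047685478719847812, 165049311491627099528620239296193459477935047749959626,
    160098114834201873100149133, 179666987996241807800459404687741389,
    11618139653287178701228548156478722803739050417481, 10077129771104746311188432056258,
    787531906986735800616703114289288614144899947396624322, 40334560145144678468970856412997,
    15146191733779945767968081853898, 40333322167252108814733984319619,
    46226122248226446233408197289090416299879677773318, 418278915820523976920489928473946183,
    10821237527673622787685483606206685847500, 29181474275860328735932585700786692010317,
    2050427782081351430864076863340558987533, 2292965555581058492358287792345273275578405079363,
    5635410580449594310028513511880, 18014115625305612860162395508491274952748409546759,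
    1316432890160791598252046477209042820, 17680721866089545969266900434628,
    40015481352217626905862775973446, 431285084761663063472115415894830729,
    10820806593973177605017030228599346798540, 530045688245623797744629614080770696060216326,
    901081627021117659585535043897562626310979881198168135,
    524338300522381981394216523895114916627831938666077900,
    354576695220003557454033916009056424972858189,
    377713599182484832732358841867093751380723750269930371, 288692136182062161822727344228605772,
    46683808741673734418296036360077699951136021382342,
    46682590757432141899638473903855260817560843987399, 330143993355329558270826256454006730,
    245777300477528602353001169990, 14902585616668587764669416691957559074252,
    869938461731206045363380263890340547, 17368219336850828537330186648597838246900402548164,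
    1326795305633248820137806094366016966, 1290296324812418539663671865694848649075114540484,
    122383352121550137839678782034968516, 839206516802718412701123374697080475766679490,
    13081639078937580721672858806727, 43477150081147650127306751128467096613325,
    4010278439312612200042037930273387185606, 1327064044018325587146671800283705805,
    158745123168383680780746299424276356, 37911397995868962666744430812121840609100237773260,
    901092560796022291746448532603911753, 158711051035153590658737351002586052,
    45952032237092854630553811876591995991892553015751,
    33342906300898609679121760897108544629185450521165,
    13073268608871859170243369155334251584337563687628,
    46683619108093676790164098161058245360108007829837, 38029460089728658260260414872207745162188,
    12160125435748349373672797282793041128570812276556,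
    380703199378554927200160700964495075033996771186712583,
    176008253001689878167168336181945548528608135, 17967899277311848450311106975369655501123,
    254211788223588216944582278609407192164582723,
    2752255288724948165145000655979521903398138153350, 43477331929427212395380131109089904524740,
    8098817519876358244347688702388224631495, 33443332429024813639991918321057405503432,
    1424676439759369883084197883545160792993574601,
    10905595056339242096505029024980148831351460302991005058696,
    371092811448648931584796962829003581831913420,
    38360623675333102669006753725477674793971292865131933238984,
    446932805808142492347361029341229773, 15145556037145138308956763094916,
    10480275180620297453410190952121709723594, 29717348255357725385391809582533,
    31228874947038471058510351593484002140106,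
    12474687690690553959733870496857154605622491075787509489991,
    287653887022266673231142366586791331564162248, 361402845315066978471572731502829959,
    2564016101641756418941016018039588830985, 43474725223207163464350032650428087320393,
    262425679609370766191521581255843918553286536,
    14546205877885737484954330299487274807640662342546924755491582486477,
    906283747676856525061761575317243784, 43484694800799255821264076879405903030087,
    43484694800640794660384691289512820909767, 4683864624117596339350914214572566104515,
    43484694800799255821264076879405903030087, 30350873725493437886578043475909,
    27316938376997425609111882135075164744970628504073,
    9513094292356998912281191214714046989288509556421, 43484694800640794660384691289512820909767,
    43484694800323872338625920109726656669127, 86586811444686967530465065419681131533712842,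
    43484694800640794660384691289512820909767, 29955671039948493755136140828357,
    21280291461829136903365190301055799558535, 21536804067102865653619096749230931581382,
    1424635524813455052724698655905341468420929988, 21536804067102865653619096749230931581382,
    20769569615988644110688268996792713151303, 21536804067102865653619096749230931581382,
    75265239861358812243337613, 21366652499049743242962502560375260874695,
    21706924481060042315011848927028181239495, 15070602404782259408561298878413,
    21366652499048621323202479043166341436358, 21026349361039836709635986752241064509895,
    677864170682821402118260485693253964527844105, 345987663575704477502840712,
    641674209795418056915522771746979787] = true := by
  decide +kernel

/-- Data for the group of type `[2, 2, 2, 3]`. -/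
def data_2_2_2_3 : GroupData where
  ns := [2, 2, 2, 3]
  E := 6
  reps :=
    [[3, 0, 0, 2], [0, 3, 0, 2], [3, 3, 0, 2], [0, 0, 3, 2], [3, 0, 3, 2], [0, 3, 3, 2], [3, 3, 3,
    2], [0, 0, 0, 2], [3, 0, 0, 0], [0, 3, 0, 0], [3, 3, 0, 0], [0, 0, 3, 0], [3, 0, 3, 0], [0, 3,
    3, 0], [3, 3, 3, 0], [0, 0, 0, 0]]
  ks :=
    [[1, 0, 0, 0], [0, 1, 0, 0], [1, 1, 0, 0], [0, 0, 1, 0], [1, 0, 1, 0], [0, 1, 1, 0], [1, 1, 1,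
    0], [0, 0, 0, 1], [1, 0, 0, 1], [0, 1, 0, 1], [1, 1, 0, 1], [0, 0, 1, 1], [1, 0, 1, 1], [0, 1,
    1, 1], [1, 1, 1, 1]]
  us :=
    [[[1, 1, 0, 0], [1, 0, 0, 0], [1, 0, 1, 0], [0, 0, 0, 1]], [[1, 1, 1, 0], [0, 1, 1, 0], [0, 0,
    1, 0], [0, 0, 0, 1]], [[1, 0, 1, 0], [0, 0, 1, 0], [0, 1, 0, 0], [0, 0, 0, 1]], [[0, 1, 0, 0],
    [1, 0, 0, 0], [0, 0, 1, 0], [0, 0, 0, 1]], [[1, 1, 0, 0], [0, 1, 1, 0], [0, 1, 0, 0], [0, 0,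
    0, 1]], [[1, 0, 0, 0], [0, 1, 1, 0], [0, 0, 1, 0], [0, 0, 0, 1]], [[1, 0, 1, 0], [0, 1, 0, 0],
    [0, 0, 1, 0], [0, 0, 0, 1]], [[1, 1, 0, 0], [0, 1, 0, 0], [0, 0, 1, 0], [0, 0, 0, 1]], [[1, 0,
    0, 0], [0, 0, 1, 0], [0, 1, 0, 0], [0, 0, 0, 1]], [[1, 0, 1, 0], [0, 1, 1, 0], [0, 0, 1, 0],
    [0, 0, 0, 1]], [[1, 1, 1, 0], [0, 1, 0, 0], [0, 0, 1, 0], [0, 0, 0, 1]]]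

set_option maxRecDepth 100000 in
theorem check_2_2_2_3 : checkGroup data_2_2_2_3
    [39146935909662429958598911900655909403660, 695238641498481095822722639298921203467,
    1381148823082043854437826480600754152266, 957883650856612645011162699,
    33282532353527566638911109338406072977355, 99741910841583440586205490945662092491,
    47207880310379293851973376452754116, 1036431229525889256603663640641733071,
    34807219185408188478883623053352132447435, 1424584902099578295049977315559705363234568268,
    21013888043650221335254643657558078830529, 231805718570887850881087937768631027366135497,
    170555921394403592450125739794646419261309902,
    3525064100573761681143400788284782077243439952704663567651242193796766929353,
    59980014279015480634740135926910712131547921992948007070224431601948005537789088674792989184836606478262771280483649621985616473026216093186038038523934865475077641760641464712310598961016910265292279660638248334701506266010782358241077997235271174271559006517953231,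
    1424831281954513471259873915134625136448591814, 655777857114601512411409097,
    722619485455015056620362646915424970820943560,
    34988796385055924738979688048601756043662250570124,
    13081035049089719307314726437106422885362170169293,
    133319697334879239507323120980536035575085414016066424539434425995809178723759794850205946645619661] = true := by
  decide +kernel

/-- Data for the group of type `[5, 5]`. -/
def data_5_5 : GroupData where
  ns := [5, 5]
  E := 5
  reps :=
    [[1, 0], [2, 0], [0, 1], [1, 1], [2, 1], [3, 1], [4, 1], [0, 2], [1, 2], [2, 2], [3, 2], [4,
    2], [0, 0]]
  ks :=
    [[1, 0], [2, 0], [0, 1], [1, 1], [2, 1], [3, 1], [4, 1], [0, 2], [1, 2], [2, 2], [3, 2], [4,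
    2]]
  us :=
    [[[2, 1], [2, 0]], [[4, 1], [0, 4]], [[1, 0], [0, 4]], [[2, 0], [0, 4]], [[0, 1], [4, 1]],
    [[1, 2], [0, 4]], [[4, 2], [0, 1]], [[4, 1], [0, 1]], [[0, 1], [1, 0]], [[3, 2], [0, 1]], [[0,
    2], [4, 3]], [[0, 2], [4, 1]], [[2, 0], [0, 1]], [[1, 0], [0, 3]], [[4, 1], [0, 2]], [[1, 1],
    [0, 2]], [[2, 1], [0, 1]]]

set_option maxRecDepth 100000 in
theorem check_5_5 : checkGroup data_5_5
    [1248949036316793463102038063597263239, 321105254322977113870096089238471230072592775,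
    867235192749483728885654779882199810, 1316409280008932382768170275518578563] = true := by
  decide +kernel

/-- Data for the group of type `[3, 9]`. -/
def data_3_9 : GroupData where
  ns := [3, 9]
  E := 9
  reps :=
    [[0, 1], [3, 1], [6, 1], [0, 2], [3, 2], [6, 2], [0, 4], [3, 4], [6, 4], [3, 0], [0, 3], [3,
    3], [6, 3], [0, 0]]
  ks :=
    [[1, 0], [0, 1], [1, 1], [2, 1], [0, 2], [1, 2], [2, 2], [0, 3], [1, 3], [2, 3], [0, 4], [1,
    4], [2, 4]]
  us :=
    [[[2, 3], [0, 8]], [[1, 0], [1, 8]], [[1, 0], [0, 8]], [[1, 0], [1, 1]], [[1, 0], [1, 4]],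
    [[2, 3], [0, 1]], [[1, 0], [1, 7]], [[1, 0], [2, 8]], [[1, 0], [2, 1]], [[1, 3], [0, 8]], [[1,
    3], [1, 5]], [[1, 0], [0, 2]], [[1, 0], [0, 4]], [[2, 3], [2, 4]]]

set_option maxRecDepth 100000 in
theorem check_3_9 : checkGroup data_3_9
    [36057177587816422974122711247302, 1012698653810073203767047527692597578,
    40243584934958117643439201240463989367875, 1098608944300749484636900018907046745802433735,
    1201746917309005747166699226191997324834698563,
    38460874577570131184238699009526138152164444504002,
    987007644452604866449896099590290097177847437,
    27592957589907438453578221310781577855793937608065,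
    544100793660534489788566207795362719255100549, 1223822645475490870225854600594018545587800647,
    1031590938219377268496922171893046351248040589,
    33533181872924143171909446882973366555212882694343] = true := by
  decide +kernel

/-- Data for the group of type `[3, 3, 3]`. -/
def data_3_3_3 : GroupData where
  ns := [3, 3, 3]
  E := 3
  reps :=
    [[1, 0, 0], [0, 1, 0], [1, 1, 0], [2, 1, 0], [0, 0, 1], [1, 0, 1], [2, 0, 1], [0, 1, 1], [1,
    1, 1], [2, 1, 1], [0, 2, 1], [1, 2, 1], [2, 2, 1], [0, 0, 0]]
  ks :=
    [[1, 0, 0], [0, 1, 0], [1, 1, 0], [2, 1, 0], [0, 0, 1], [1, 0, 1], [2, 0, 1], [0, 1, 1], [1,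
    1, 1], [2, 1, 1], [0, 2, 1], [1, 2, 1], [2, 2, 1]]
  us :=
    [[[2, 1, 1], [1, 0, 2], [0, 0, 1]], [[2, 1, 0], [0, 0, 1], [0, 1, 0]], [[2, 0, 1], [0, 2, 0],
    [0, 0, 2]], [[1, 0, 0], [0, 2, 1], [0, 0, 1]], [[2, 1, 0], [0, 2, 0], [0, 0, 2]], [[0, 2, 1],
    [2, 0, 0], [0, 0, 1]], [[1, 0, 0], [0, 2, 0], [0, 0, 2]], [[0, 0, 1], [0, 2, 1], [1, 2, 0]],
    [[2, 0, 1], [0, 1, 0], [0, 0, 1]], [[0, 1, 0], [1, 0, 1], [0, 0, 1]], [[2, 0, 1], [0, 2, 1],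
    [0, 0, 1]], [[2, 1, 1], [0, 1, 0], [0, 0, 1]]]

set_option maxRecDepth 100000 in
theorem check_3_3_3 : checkGroup data_3_3_3
    [42461495574113011306628450693374336395657] = true := by
  decide +kernel

/-- Data for the group of type `[4, 8]`. -/
def data_4_8 : GroupData where
  ns := [4, 8]
  E := 8
  reps :=
    [[0, 1], [2, 1], [4, 1], [6, 1], [0, 3], [2, 3], [4, 3], [6, 3], [2, 0], [0, 2], [2, 2], [4,
    2], [6, 2], [2, 4], [4, 0], [0, 4], [4, 4], [0, 0]]
  ks :=
    [[1, 0], [2, 0], [0, 1], [1, 1], [2, 1], [3, 1], [0, 2], [1, 2], [2, 2], [3, 2], [0, 3], [1,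
    3], [2, 3], [3, 3], [0, 4], [1, 4], [2, 4]]
  us :=
    [[[3, 2], [0, 7]], [[1, 0], [1, 1]], [[1, 0], [2, 7]], [[1, 0], [1, 7]], [[1, 4], [0, 7]],
    [[3, 2], [0, 1]], [[1, 0], [3, 3]], [[1, 0], [2, 1]], [[1, 0], [0, 7]], [[3, 2], [3, 1]], [[1,
    2], [0, 7]], [[1, 0], [1, 3]], [[1, 0], [2, 5]], [[1, 0], [3, 7]], [[1, 2], [0, 1]]]

set_option maxRecDepth 100000 in
theorem check_4_8 : checkGroup data_4_8
    [1003769193599113277416504903, 1326793561675683870080946646056075139,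
    1197251622142920667309340993, 689727836448869887309701574, 37635958476414933663363,
    452779990833425717265722825, 1221299393854385308513477452, 36537672453312326768400399691081,
    42027478924929383181531728321325866051334, 34635587809091011012431547140375581092485,
    39386252004667683079247307636675, 1076204538530636740415514438,
    1179088975069294996544481484721028995, 36209497368123306429557246164931,
    1335640712941318160209429675808300175364095939, 1105032357311289034577045320,
    36683800977041078208104059941568160983497, 828860246937394964444391501407188810,
    1259456352970908058595437397919627719, 32650528712424559941587260604355,
    1041339399492916712146108380766011267, 34788494685431206501766117159812,
    40490443746751150062149019333953, 37635958476414933663363, 36828917928434738528003,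
    36828915676497487986563, 37635962980839194754819,
    1146092202127030283731577491739487930885174153, 1235672498398268459302879107,
    1148778448644028463633890246, 39221606019288993815838991646529,
    38429169950190378066028643052298, 1226486615982011713885304775,
    1246565852861166063998873641274862172010575943, 29863498056053467030183655761898975092546,
    829838673386381920809768269, 1042496280775256150181962186, 728107387118076169493387728,
    9432092203895024539397535957103407998065317236805,
    1380026980629152719586593407916058591352868742, 10826455657029211061448064361627717295056,
    1098783516110511031847845896745182249070552513, 781799195339396448468405999962168272,
    1326777558803079636515237279566351756, 35221403540218843362933655690231224129229,
    776600319274210193053686470633974472, 22520004763387183720260, 36828915676566203269059,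
    37635962980839194754819, 37635962980839194754819, 37635962980839194754819,
    22815161676040660805188, 37635967484438817931011, 37635962980839194754819,
    37709752209548022774983, 37635962980839194754819, 43475904357028343588770544478918319210371,
    23388396477561090124357885780430, 21339404135745429136964, 32893148020120299340015048647626,
    1324187599423803281623261579764105155, 923288579264216678376700599104886610940032132,
    39202009245975959734755267516997756126389606678467, 31630207362705456448227210909641,
    1077469816996448545336394553395050433, 31630313938547841935805620839748,
    37635958476414933663363, 37635958476414933663363, 23704794453430881636239873888070,
    25924491111149999566143424223109, 21929717961052383306820, 846573127052536141620437213947946945,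
    901267815842004354546638623821092425, 32897983881441606716004440891972,
    31820054747067794145777495064918278821840, 991727078809143689368301895,
    1285424392639807455489203378628496750161454346, 995763372611320471840034632091778850394065734,
    12617005390507812365696105969351, 23855914903249123451317208175497,
    991838909679385655908909664029421521, 8103880602402769795527917193363221174224,
    1090591649460956858450447469946829706690096961, 351076555063190542417093013189118534,
    1107124952685680557830051117898934159782734154, 901549868351683795691842131755850569,
    43476384236851093790223228246347242166213, 20158749466557279334212,
    1168634379207084529980076548485888864587671361, 28454707288043313566717816560585,
    22120182848474038578282269721414, 20453906379210756419140, 947964271055595883066231027019246030,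
    29441808468673157448630738476911126804225, 33531857541097326247850971131588,
    34165692512618006872557088828612, 25618850608784645259076, 771665018892780308084615498,
    39549674971365221682270655610755, 39549672553513582453012306198339, 25176128751290506509892,
    39549674971365221682270655610755, 984353619178497888042936906, 1221468281452736572371128774,
    713667128363984237398910791, 38270389622345501569419707710402, 40025058453560647587256521064323,
    965084445978698240328230345, 40025058453560647587256521064323, 37794268407547579811881317138241,
    1285213110661389447587466038791720392, 39549672553513582453012306198339,
    1225911517892909848290744001, 718504893286614898972000195] = true := by
  decide +kernel

/-- Data for the group of type `[2, 2, 8]`. -/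
def data_2_2_8 : GroupData where
  ns := [2, 2, 8]
  E := 8
  reps :=
    [[0, 0, 1], [4, 0, 1], [0, 4, 1], [4, 4, 1], [0, 0, 3], [4, 0, 3], [0, 4, 3], [4, 4, 3], [0,
    0, 2], [4, 0, 2], [0, 4, 2], [4, 4, 2], [4, 0, 0], [0, 4, 0], [4, 4, 0], [0, 0, 4], [4, 0, 4],
    [0, 4, 4], [4, 4, 4], [0, 0, 0]]
  ks :=
    [[1, 0, 0], [0, 1, 0], [1, 1, 0], [0, 0, 1], [1, 0, 1], [0, 1, 1], [1, 1, 1], [0, 0, 2], [1,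
    0, 2], [0, 1, 2], [1, 1, 2], [0, 0, 3], [1, 0, 3], [0, 1, 3], [1, 1, 3], [0, 0, 4], [1, 0, 4],
    [0, 1, 4], [1, 1, 4]]
  us :=
    [[[1, 0, 4], [1, 1, 4], [0, 0, 1]], [[1, 1, 0], [1, 0, 0], [1, 0, 1]], [[1, 1, 0], [0, 1, 0],
    [0, 0, 1]], [[0, 1, 0], [1, 0, 0], [0, 1, 1]], [[1, 1, 4], [0, 1, 0], [0, 0, 1]], [[0, 1, 0],
    [1, 0, 0], [0, 0, 1]], [[1, 0, 0], [0, 1, 0], [1, 1, 3]], [[1, 1, 0], [0, 1, 0], [0, 1, 1]],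
    [[1, 0, 0], [0, 1, 0], [1, 0, 1]], [[1, 0, 0], [0, 1, 4], [1, 0, 1]]]

set_option maxRecDepth 100000 in
theorem check_2_2_8 : checkGroup data_2_2_8
    [867363434355031624, 894385032094088776, 984586643131379419502273231, 37637115936704613744388,
    37637115936704613744388, 36453371594010442730552460439754, 32181487025966866300473155253070,
    1290642548581051371425334539113831891, 40491573180826027404553288443079,
    33283016978146727908513430110148, 930411630140128328, 30992830475312370431875010985924,
    931171873837626995102646212, 43403014617457220854218973190599919955778,
    23862094928352389213935982700482, 1143899362334401825964521544, 678205652759541832,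
    678205652759541832, 1424647529481450876793561303862225553546628239,
    30991328677619140814965664350148, 28572482306012313145677, 25924488693299513293575127488325,
    30481688925760718889166, 33276950716163714462533924112023845103562, 24439155479541604076743,
    37637115936704613744388, 37637115936704613744388, 37637115936704613744388,
    30996478978832280356811798963910, 26558333336226741827840501798213, 29453314610958562740423,
    27826022621490885072713546912069, 37637115936704613744388, 37637115936704613744388,
    37637115936704613744388, 25293115169715126961400315103431, 27192177979153952348257122440005,
    742976289153465637458111904019007435, 28171406754175324995518865329113858047940,
    26800307057245074709829, 27685746269733244852805, 1069883962058501070042659489960842885,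
    28347113834417765633921357798651344353220, 24430580175027636404099028006498881292107,
    35506084886341893750724, 38600145984793740072221038247812, 35506080312783678930884,
    38600145984793740072221038247812, 984403643319108873905930116, 38600145984793740072221038247812,
    38600145984793740072221038247812, 38600145984793740072221038247812,
    38600145984793740072221038247812, 38600145984793740072221038247812] = true := by
  decide +kernel

/-- Data for the group of type `[2, 4, 4]`. -/
def data_2_4_4 : GroupData where
  ns := [2, 4, 4]
  E := 4
  reps :=
    [[0, 1, 0], [2, 1, 0], [0, 0, 1], [2, 0, 1], [0, 1, 1], [2, 1, 1], [0, 2, 1], [2, 2, 1], [0,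
    3, 1], [2, 3, 1], [0, 1, 2], [2, 1, 2], [2, 0, 0], [0, 2, 0], [2, 2, 0], [0, 0, 2], [2, 0, 2],
    [0, 2, 2], [2, 2, 2], [0, 0, 0]]
  ks :=
    [[1, 0, 0], [0, 1, 0], [1, 1, 0], [0, 2, 0], [1, 2, 0], [0, 0, 1], [1, 0, 1], [0, 1, 1], [1,
    1, 1], [0, 2, 1], [1, 2, 1], [0, 3, 1], [1, 3, 1], [0, 0, 2], [1, 0, 2], [0, 1, 2], [1, 1, 2],
    [0, 2, 2], [1, 2, 2]]
  us :=
    [[[1, 0, 2], [1, 1, 2], [0, 0, 1]], [[1, 0, 0], [0, 0, 1], [1, 1, 0]], [[1, 0, 0], [0, 3, 1],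
    [0, 0, 1]], [[1, 0, 0], [0, 1, 0], [0, 0, 3]], [[1, 2, 0], [0, 0, 1], [0, 1, 0]], [[1, 0, 0],
    [1, 1, 0], [0, 0, 1]], [[1, 2, 0], [0, 1, 0], [0, 0, 1]], [[1, 0, 2], [0, 3, 1], [1, 0, 1]],
    [[1, 0, 2], [0, 1, 0], [0, 0, 1]], [[1, 0, 0], [0, 0, 1], [0, 1, 0]], [[1, 0, 0], [0, 1, 0],
    [1, 0, 1]], [[1, 0, 0], [1, 1, 2], [0, 0, 3]], [[1, 2, 2], [0, 1, 0], [0, 0, 1]], [[1, 0, 2],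
    [1, 1, 1], [0, 0, 1]], [[1, 0, 0], [1, 3, 1], [0, 0, 1]], [[1, 0, 0], [0, 0, 1], [0, 3, 1]],
    [[1, 2, 2], [0, 0, 1], [0, 1, 0]], [[1, 0, 2], [0, 1, 0], [0, 0, 3]], [[1, 0, 0], [1, 3, 1],
    [0, 3, 0]]]

set_option maxRecDepth 100000 in
theorem check_2_4_4 : checkGroup data_2_4_4
    [263922043293335112, 8732233237046915437679696310145, 1130048319852849282575198523119402626,
    948331404362939400, 28773689880308618486869932539074,
    45584666894931402050085602665273667808391717873233, 227892696485002312,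
    267970169240517215880579031635160393, 30429542635485450479673972088128622798337592131334,
    38595873849923666254086143572681, 293022264898533347859595142,
    569100582734128553361418027807244166, 31710586532582514007677968309331282391210156750984,
    1119528107183219848901248394671053521, 19658458564726286056668903561336008040314619255633,
    20208706391444853683949159343056, 21010100960291564832363406881748621564429993137303313579782,
    29529317021576599416396927239644753811399, 10810064221558714959953138617130785341380,
    662196516008165255712919280121117636, 1196949832482001591436671048,
    1077996373756978076483883793262278087, 462083450328119368, 462083450328119368,
    1399494115248200466137327912840128334762734795, 1285197433561815482794630015788607731266974658,
    889981056695013292964414048449174548212969424] = true := by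
  decide +kernel

/-- Data for the group of type `[2, 2, 2, 4]`. -/
def data_2_2_2_4 : GroupData where
  ns := [2, 2, 2, 4]
  E := 4
  reps :=
    [[0, 0, 0, 1], [2, 0, 0, 1], [0, 2, 0, 1], [2, 2, 0, 1], [0, 0, 2, 1], [2, 0, 2, 1], [0, 2, 2,
    1], [2, 2, 2, 1], [2, 0, 0, 0], [0, 2, 0, 0], [2, 2, 0, 0], [0, 0, 2, 0], [2, 0, 2, 0], [0, 2,
    2, 0], [2, 2, 2, 0], [0, 0, 0, 2], [2, 0, 0, 2], [0, 2, 0, 2], [2, 2, 0, 2], [0, 0, 2, 2], [2,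
    0, 2, 2], [0, 2, 2, 2], [2, 2, 2, 2], [0, 0, 0, 0]]
  ks :=
    [[1, 0, 0, 0], [0, 1, 0, 0], [1, 1, 0, 0], [0, 0, 1, 0], [1, 0, 1, 0], [0, 1, 1, 0], [1, 1, 1,
    0], [0, 0, 0, 1], [1, 0, 0, 1], [0, 1, 0, 1], [1, 1, 0, 1], [0, 0, 1, 1], [1, 0, 1, 1], [0, 1,
    1, 1], [1, 1, 1, 1], [0, 0, 0, 2], [1, 0, 0, 2], [0, 1, 0, 2], [1, 1, 0, 2], [0, 0, 1, 2], [1,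
    0, 1, 2], [0, 1, 1, 2], [1, 1, 1, 2]]
  us :=
    [[[1, 0, 0, 2], [1, 1, 0, 2], [0, 0, 1, 0], [1, 1, 0, 1]], [[0, 1, 0, 0], [1, 0, 1, 0], [1, 0,
    0, 0], [0, 0, 0, 1]], [[1, 1, 0, 0], [0, 1, 1, 0], [0, 0, 1, 0], [0, 0, 0, 1]], [[1, 0, 1, 0],
    [0, 0, 1, 0], [0, 1, 0, 0], [0, 0, 0, 1]], [[1, 1, 1, 2], [1, 0, 0, 0], [0, 0, 1, 0], [0, 0,
    0, 1]], [[0, 1, 0, 0], [1, 0, 0, 0], [0, 0, 1, 0], [1, 0, 0, 1]], [[1, 0, 1, 0], [0, 1, 0, 0],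
    [0, 0, 1, 0], [0, 0, 0, 1]], [[1, 0, 0, 0], [0, 0, 1, 0], [0, 1, 0, 0], [0, 1, 0, 1]], [[1, 1,
    1, 2], [0, 1, 0, 0], [0, 0, 1, 0], [0, 0, 0, 1]], [[1, 0, 1, 0], [0, 1, 1, 0], [0, 0, 1, 0],
    [0, 0, 0, 1]], [[1, 1, 0, 0], [0, 1, 0, 0], [0, 0, 1, 0], [0, 0, 0, 1]], [[0, 1, 0, 0], [1, 0,
    0, 0], [0, 0, 1, 0], [0, 0, 0, 1]], [[1, 1, 0, 2], [0, 1, 0, 0], [0, 0, 1, 0], [1, 1, 0, 1]],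
    [[1, 0, 0, 0], [0, 1, 1, 2], [0, 0, 1, 0], [0, 0, 0, 1]], [[0, 0, 1, 0], [1, 1, 1, 2], [1, 0,
    0, 0], [0, 0, 0, 1]], [[1, 0, 0, 0], [0, 1, 1, 0], [0, 0, 1, 0], [1, 1, 1, 1]], [[0, 1, 0, 0],
    [1, 1, 1, 2], [0, 0, 1, 0], [0, 0, 0, 1]]]

set_option maxRecDepth 100000 in
theorem check_2_2_2_4 : checkGroup data_2_2_2_4
    [1036207876986961864, 1016083242897768392, 880979376171483080,
    803978670856433599189316463807563462474662281123456076650820744478680731210279662202257952800687897981867273,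
    691717688613208008, 17687994990572330782211986194376,
    43482535003072017429000555683274574536656] = true := by
  decide +kernel

/-- Data for the group of type `[2, 2, 2, 2, 2]`. -/
def data_2_2_2_2_2 : GroupData where
  ns := [2, 2, 2, 2, 2]
  E := 2
  reps :=
    [[1, 0, 0, 0, 0], [0, 1, 0, 0, 0], [1, 1, 0, 0, 0], [0, 0, 1, 0, 0], [1, 0, 1, 0, 0], [0, 1,
    1, 0, 0], [1, 1, 1, 0, 0], [0, 0, 0, 1, 0], [1, 0, 0, 1, 0], [0, 1, 0, 1, 0], [1, 1, 0, 1, 0],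
    [0, 0, 1, 1, 0], [1, 0, 1, 1, 0], [0, 1, 1, 1, 0], [1, 1, 1, 1, 0], [0, 0, 0, 0, 1], [1, 0, 0,
    0, 1], [0, 1, 0, 0, 1], [1, 1, 0, 0, 1], [0, 0, 1, 0, 1], [1, 0, 1, 0, 1], [0, 1, 1, 0, 1],
    [1, 1, 1, 0, 1], [0, 0, 0, 1, 1], [1, 0, 0, 1, 1], [0, 1, 0, 1, 1], [1, 1, 0, 1, 1], [0, 0, 1,
    1, 1], [1, 0, 1, 1, 1], [0, 1, 1, 1, 1], [1, 1, 1, 1, 1], [0, 0, 0, 0, 0]]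
  ks :=
    [[1, 0, 0, 0, 0], [0, 1, 0, 0, 0], [1, 1, 0, 0, 0], [0, 0, 1, 0, 0], [1, 0, 1, 0, 0], [0, 1,
    1, 0, 0], [1, 1, 1, 0, 0], [0, 0, 0, 1, 0], [1, 0, 0, 1, 0], [0, 1, 0, 1, 0], [1, 1, 0, 1, 0],
    [0, 0, 1, 1, 0], [1, 0, 1, 1, 0], [0, 1, 1, 1, 0], [1, 1, 1, 1, 0], [0, 0, 0, 0, 1], [1, 0, 0,
    0, 1], [0, 1, 0, 0, 1], [1, 1, 0, 0, 1], [0, 0, 1, 0, 1], [1, 0, 1, 0, 1], [0, 1, 1, 0, 1],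
    [1, 1, 1, 0, 1], [0, 0, 0, 1, 1], [1, 0, 0, 1, 1], [0, 1, 0, 1, 1], [1, 1, 0, 1, 1], [0, 0, 1,
    1, 1], [1, 0, 1, 1, 1], [0, 1, 1, 1, 1], [1, 1, 1, 1, 1]]
  us :=
    [[[1, 1, 0, 1, 1], [1, 0, 0, 1, 1], [0, 0, 1, 0, 0], [0, 0, 0, 1, 0], [0, 0, 0, 0, 1]], [[1,
    0, 0, 0, 0], [0, 0, 1, 0, 0], [0, 0, 0, 1, 0], [0, 0, 0, 0, 1], [0, 1, 0, 0, 0]], [[1, 0, 0,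
    0, 0], [0, 1, 1, 1, 1], [0, 0, 1, 0, 0], [0, 0, 0, 1, 0], [0, 0, 0, 0, 1]], [[1, 0, 0, 0, 0],
    [0, 1, 0, 0, 0], [0, 0, 1, 1, 1], [0, 0, 1, 0, 1], [0, 0, 0, 0, 1]], [[1, 0, 1, 0, 1], [0, 1,
    0, 0, 0], [0, 0, 1, 0, 0], [0, 0, 0, 1, 0], [0, 0, 0, 0, 1]], [[1, 0, 0, 0, 0], [0, 1, 0, 0,
    0], [0, 0, 1, 0, 0], [0, 0, 0, 0, 1], [0, 0, 0, 1, 0]], [[0, 1, 0, 0, 1], [1, 0, 0, 1, 0], [0,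
    0, 1, 0, 0], [0, 0, 0, 1, 0], [0, 0, 0, 0, 1]], [[0, 1, 0, 0, 0], [0, 0, 1, 0, 0], [1, 0, 0,
    0, 0], [0, 0, 0, 1, 0], [0, 0, 0, 0, 1]], [[1, 1, 0, 0, 1], [0, 1, 0, 0, 0], [0, 0, 1, 1, 1],
    [0, 0, 0, 1, 0], [0, 0, 0, 0, 1]], [[1, 0, 0, 0, 1], [0, 1, 0, 0, 0], [0, 0, 1, 0, 0], [0, 0,
    0, 1, 0], [0, 0, 0, 0, 1]], [[1, 0, 0, 0, 0], [0, 1, 0, 1, 0], [0, 0, 1, 0, 0], [0, 0, 0, 1,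
    0], [0, 0, 0, 0, 1]], [[1, 0, 0, 0, 0], [0, 0, 1, 0, 0], [0, 1, 0, 0, 1], [0, 0, 0, 1, 0], [0,
    0, 0, 0, 1]], [[1, 0, 0, 1, 0], [0, 1, 0, 0, 0], [0, 0, 1, 0, 0], [0, 0, 0, 1, 0], [0, 0, 0,
    0, 1]], [[1, 0, 1, 0, 1], [0, 1, 1, 0, 1], [0, 0, 1, 0, 0], [0, 0, 0, 1, 0], [0, 0, 0, 0, 1]],
    [[1, 0, 0, 0, 0], [0, 1, 0, 0, 0], [0, 0, 1, 0, 1], [0, 0, 0, 1, 0], [0, 0, 0, 0, 1]], [[0, 1,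
    0, 0, 1], [1, 1, 0, 0, 1], [0, 0, 1, 0, 0], [0, 0, 0, 1, 0], [0, 0, 0, 0, 1]], [[1, 1, 0, 1,
    0], [0, 1, 0, 1, 1], [0, 1, 0, 1, 0], [0, 1, 1, 0, 0], [1, 0, 1, 0, 0]], [[1, 1, 1, 0, 0], [0,
    1, 0, 0, 0], [0, 0, 1, 0, 0], [0, 0, 0, 1, 0], [0, 0, 0, 0, 1]]]

set_option maxRecDepth 100000 in
theorem check_2_2_2_2_2 : checkGroup data_2_2_2_2_2
    [] = true := by
  decide +kernel

theorem exists_checkGroup : ∀ ns ∈ groupTypes,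
    ∃ D certs, checkGroup D certs = true ∧ D.ns = ns := by
  simp only [groupTypes, List.forall_mem_cons]
  exact ⟨⟨_, _, check_11, rfl⟩, ⟨_, _, check_13, rfl⟩, ⟨_, _, check_2_7, rfl⟩,
    ⟨_, _, check_3_5, rfl⟩, ⟨_, _, check_16, rfl⟩, ⟨_, _, check_17, rfl⟩, ⟨_, _, check_2_9, rfl⟩,
    ⟨_, _, check_19, rfl⟩, ⟨_, _, check_4_5, rfl⟩, ⟨_, _, check_3_7, rfl⟩, ⟨_, _, check_23, rfl⟩,
    ⟨_, _, check_3_8, rfl⟩, ⟨_, _, check_25, rfl⟩, ⟨_, _, check_27, rfl⟩, ⟨_, _, check_29, rfl⟩,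
    ⟨_, _, check_31, rfl⟩, ⟨_, _, check_5_7, rfl⟩, ⟨_, _, check_37, rfl⟩,
    ⟨_, _, check_2_3_3, rfl⟩, ⟨_, _, check_2_2_5, rfl⟩, ⟨_, _, check_2_3_4, rfl⟩,
    ⟨_, _, check_2_2_2_3, rfl⟩, ⟨_, _, check_5_5, rfl⟩, ⟨_, _, check_3_9, rfl⟩,
    ⟨_, _, check_3_3_3, rfl⟩, ⟨_, _, check_4_8, rfl⟩, ⟨_, _, check_2_2_8, rfl⟩,
    ⟨_, _, check_2_4_4, rfl⟩, ⟨_, _, check_2_2_2_4, rfl⟩, ⟨_, _, check_2_2_2_2_2, rfl⟩, by simp⟩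

theorem card_quotient_le_sixteen (Λ Λ' : Submodule ℤ (EuclideanSpace ℝ (Fin 9)))
    [DiscreteTopology Λ] [IsZLattice ℝ Λ] {m : ℝ} (hm : 0 < m)
    (hmin : ∀ x ∈ Λ, x ≠ 0 → m ≤ ‖x‖ ^ 2) {e : Fin 9 → EuclideanSpace ℝ (Fin 9)}
    (hli : LinearIndependent ℝ e) (he : ∀ i, e i ∈ Λ) (he' : ∀ i, ‖e i‖ ^ 2 = m)
    (hΛ' : Λ' = Submodule.span ℤ (Set.range e)) :
    Nat.card (Λ ⧸ Λ'.comap Λ.subtype) ≤ 16 := by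
  by_contra! h
  obtain ⟨ns, hns, f, hf⟩ := exists_injective_groupType _ h
    (card_quotient_le Λ Λ' hm hmin hli he he' hΛ')
  obtain ⟨D, certs, hD, rfl⟩ := exists_checkGroup ns hns
  obtain ⟨e', b, hr⟩ := exists_realizes Λ Λ' hm hmin hli he he' hΛ' (checkGroup_iff.1 hD).1 hf
  exact not_realizes hD e' b hr

end LatticeIndex

/-- For every lattice `Λ` in `ℝ⁹` and every Minkowskian sublattice `Λ'` of
`Λ`, one has `[Λ : Λ'] ≤ 16`: the maximal index of a `9`-dimensional
well-rounded lattice is at most `16`. -/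
theorem index_le_sixteen_dim_nine
    (Λ Λ' : Submodule ℤ (EuclideanSpace ℝ (Fin 9)))
    (hΛ : IsLattice Λ) (hmink : IsMinkowskian Λ Λ') :
    subIndex Λ Λ' ≤ 16 := by
  obtain ⟨e, hli, he, hΛ'⟩ := hmink
  have : DiscreteTopology Λ := hΛ.1
  have : IsZLattice ℝ Λ := ⟨hΛ.2⟩
  have hm : 0 < latticeMin Λ := by
    rw [← (he 0).2.2]
    exact real_inner_self_pos.2 (he 0).2.1
  refine LatticeIndex.card_quotient_le_sixteen Λ Λ' hm (fun x hx h0 => ?_) hli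
    (fun i => (he i).1) (fun i => ?_) hΛ'
  · rw [← real_inner_self_eq_norm_sq]
    refine csInf_le ⟨0, ?_⟩ ⟨x, hx, h0, rfl⟩
    rintro _ ⟨y, -, -, rfl⟩
    exact real_inner_self_nonneg
  · rw [← real_inner_self_eq_norm_sq]
    exact (he i).2.2
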